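/- Let k be a perfect field of characteristic p > 0 and let (R, I) be a standard graded pair over k such that R is a two-dimensional domain. Then α(R, I), the maximum support of the Hilbert–Kunz density function of (R, I), is a rational number. -/

import Mathlib

/-!
STATEMENT 3: For a standard graded pair `(R, I)` over a perfect field of characteristic
`p > 0`, with `R` a two-dimensional domain, the maximum support `α(R, I)` of the
Hilbert–Kunz density function of `(R, I)` is a rational number.
-/

open Filter Topology

/-- The Frobenius power `I^{[q]}` of an ideal `I`. -/
def Ideal.frobPow {R : Type*} [CommRing R] (I : Ideal R) (q : ℕ) : Ideal R :=
  Ideal.span ((fun f => f ^ q) '' (I : Set R))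

/-- `dim_k (R/J)_m`: the `k`-dimension of the degree-`m` graded piece of `R/J`,
computed as `dim_k (𝒜 m / (J ∩ 𝒜 m))`. -/
noncomputable def gradedPieceDim {k R : Type*} [Field k] [CommRing R] [Algebra k R]
    (𝒜 : ℕ → Submodule k R) (J : Ideal R) (m : ℕ) : ℕ :=
  Module.finrank k ((𝒜 m) ⧸ (Submodule.comap (𝒜 m).subtype (J.restrictScalars k)))

set_option linter.unusedSectionVars false
open Filter Topology

/-- Polynomial ring in two variables. -/
abbrev Pol (k : Type*) [Field k] := MvPolynomial (Fin 2) k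

namespace HK

open MvPolynomial

section hompoly
variable {k : Type*} [Field k]

theorem single_cases (n : ℕ) (s : Fin 2 →₀ ℕ) (h0 : s 0 = 0) (hs : s.degree = n) :
    s = Finsupp.single 1 n := by
  ext i
  have : s.degree = s 0 + s 1 := by
    rw [Finsupp.degree_eq_sum]; simp
  fin_cases i <;> simp <;> omega

theorem hom_split (n : ℕ) (h : Pol k) (hh : h.IsHomogeneous n) :
    ∃ (c : k) (h' : Pol k), h = C c * X 1 ^ n + X 0 * h' ∧
      ((n = 0 ∧ h' = 0) ∨ (1 ≤ n ∧ h'.IsHomogeneous (n - 1))) := by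
  refine ⟨coeff (Finsupp.single 1 n) h, h.divMonomial (Finsupp.single 0 1), ?_, ?_⟩
  · conv_lhs => rw [← divMonomial_add_modMonomial_single h 0]
    rw [add_comm]
    congr 1
    ext s
    rw [X_pow_eq_monomial, C_mul_monomial, coeff_monomial, mul_one]
    by_cases hs : Finsupp.single 0 1 ≤ s
    · rw [coeff_modMonomial_of_le _ hs, if_neg]
      rintro rfl
      have := hs 0
      simp at this
    · rw [coeff_modMonomial_of_not_le _ hs]
      have h0 : s 0 = 0 := by
        by_contra h0
        apply hs
        rw [Finsupp.single_le_iff]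
        omega
      by_cases hsn : s.degree = n
      · have := single_cases n s h0 hsn
        rw [if_pos this.symm, this]
      · rw [if_neg, hh.coeff_eq_zero hsn]
        rintro rfl
        simp at hsn
  · have key : ∀ s, coeff s (h.divMonomial (Finsupp.single 0 1)) ≠ 0 → s.degree + 1 = n := by
      intro s hs
      rw [coeff_divMonomial] at hs
      by_contra hne
      apply hs
      apply hh.coeff_eq_zero
      rw [map_add, Finsupp.degree_single]
      omega
    rcases Nat.eq_zero_or_pos n with rfl | hn
    · left
      refine ⟨rfl, ?_⟩
      ext s
      by_contra hs
      have := key s (by simpa using hs)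
      omega
    · right
      refine ⟨hn, ?_⟩
      intro s hs
      have := key s hs
      have h3 := congrFun (congrArg DFunLike.coe (Finsupp.degree_eq_weight_one (R := ℕ) (σ := Fin 2))) s
      have h4 : s.degree = Finsupp.weight 1 s := h3
      omega

end hompoly

section S2
variable {k : Type*} [Field k] {E : Type*} [AddCommGroup E] [Module k E] [Module (Pol k) E]
  [IsScalarTower k (Pol k) E]

/-- A graded family satisfying Serre's condition S2. -/
structure IsS2 (δ : ℤ) (M : ℤ → Submodule k E) : Prop where
  x_mem : ∀ m v, v ∈ M m → (X 0 : Pol k) • v ∈ M (m + δ)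
  y_mem : ∀ m v, v ∈ M m → (X 1 : Pol k) • v ∈ M (m + δ)
  s2 : ∀ m v v', v ∈ M m → v' ∈ M m → (X 1 : Pol k) • v = (X 0 : Pol k) • v' →
    ∃ u ∈ M (m - δ), v = (X 0 : Pol k) • u
  indep : iSupIndep M
  bdd : ∃ B : ℤ, ∀ m < B, M m = ⊥
  fin : ∀ m, FiniteDimensional k (M m)

variable {δ : ℤ} {M : ℤ → Submodule k E}

theorem IsS2.ypow_mem (hM : IsS2 δ M) (n : ℕ) (m : ℤ) (v : E) (hv : v ∈ M m) :
    (X 1 ^ n : Pol k) • v ∈ M (m + n * δ) := by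
  induction n with
  | zero => simpa using hv
  | succ n ih =>
    rw [pow_succ', mul_smul]
    have := hM.y_mem _ _ ih
    convert this using 2
    push_cast; ring

theorem IsS2.s2_pow (hM : IsS2 δ M) (n : ℕ) (m : ℤ) (v w : E) (hv : v ∈ M m)
    (hw : w ∈ M (m + (n - 1) * δ)) (h : (X 1 ^ n : Pol k) • v = (X 0 : Pol k) • w) :
    ∃ u ∈ M (m - δ), v = (X 0 : Pol k) • u := by
  induction n generalizing w with
  | zero => 
    refine ⟨w, ?_, by simpa using h⟩
    convert hw using 2
    push_cast; ring
  | succ n ih =>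
    rw [pow_succ', mul_smul] at h
    have h1 := hM.ypow_mem n m v hv
    obtain ⟨u, hu, hu'⟩ := hM.s2 (m + n * δ) _ w h1 (by convert hw using 2; push_cast; ring) h
    refine ih u ?_ hu'
    convert hu using 2
    ring

theorem IsS2.hom_mem (hM : IsS2 δ M) (n : ℕ) (h : Pol k) (hh : h.IsHomogeneous n)
    (m : ℤ) (v : E) (hv : v ∈ M m) : h • v ∈ M (m + n * δ) := by
  induction n generalizing h m v with
  | zero =>
    obtain ⟨c, h', rfl, h2⟩ := hom_split 0 h hh
    rcases h2 with ⟨-, rfl⟩ | ⟨h2, _⟩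
    · rw [← MvPolynomial.algebraMap_eq]
      simp only [pow_zero, mul_one, mul_zero, add_zero, algebraMap_smul]
      simpa using (M m).smul_mem c hv
    · omega
  | succ n ih =>
    obtain ⟨c, h', rfl, h2⟩ := hom_split _ h hh
    rcases h2 with ⟨h2, _⟩ | ⟨-, h2⟩
    · omega
    rw [add_smul]
    apply Submodule.add_mem
    · rw [mul_smul, ← MvPolynomial.algebraMap_eq, algebraMap_smul]
      exact Submodule.smul_mem _ _ (hM.ypow_mem _ _ _ hv)
    · rw [mul_smul]
      have := hM.x_mem _ _ (ih h' h2 m v hv)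
      convert this using 2
      push_cast; ring

theorem IsS2.hom_rel [Module.IsTorsionFree (Pol k) E] (hM : IsS2 δ M) {J : Type*} [Fintype J] (m : ℤ)
    (b : J → E) (hb : ∀ j, b j ∈ M m)
    (hbi : ∀ c : J → k, (∃ u ∈ M (m - δ), ∑ j, c j • b j = (X 0 : Pol k) • u) → c = 0)
    (n : ℕ) (h : J → Pol k) (hh : ∀ j, (h j).IsHomogeneous n) (h0 : ∑ j, h j • b j = 0) :
    h = 0 := by
  induction n generalizing h with
  | zero =>
    choose c h' hc using fun j => hom_split 0 (h j) (hh j)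
    have hc' : ∀ j, h j = C (c j) := by
      intro j
      obtain ⟨h1, ⟨_, h2⟩ | ⟨h2, _⟩⟩ := hc j
      · rw [h1, h2]; simp
      · omega
    have : c = 0 := by
      apply hbi
      refine ⟨0, Submodule.zero_mem _, ?_⟩
      rw [smul_zero, ← h0]
      refine Finset.sum_congr rfl fun j _ => ?_
      rw [hc', ← MvPolynomial.algebraMap_eq, algebraMap_smul]
    ext1 j
    rw [hc', this]; simp
  | succ n ih =>
    choose c h' hc using fun j => hom_split _ (h j) (hh j)
    have hc1 : ∀ j, h j = C (c j) * X 1 ^ (n + 1) + X 0 * h' j := fun j => (hc j).1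
    have hc2 : ∀ j, (h' j).IsHomogeneous n := by
      intro j
      obtain ⟨h1, ⟨h2, _⟩ | ⟨_, h2⟩⟩ := hc j
      · omega
      · exact h2
    have hsum : (X 1 ^ (n + 1) : Pol k) • (∑ j, c j • b j) + (X 0 : Pol k) • ∑ j, h' j • b j = 0 := by
      rw [← h0, Finset.smul_sum, Finset.smul_sum, ← Finset.sum_add_distrib]
      refine Finset.sum_congr rfl fun j _ => ?_
      rw [hc1, add_smul, mul_smul, mul_smul, ← MvPolynomial.algebraMap_eq, algebraMap_smul, smul_comm]
    have hw : ∑ j, h' j • b j ∈ M (m + n * δ) :=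
      Submodule.sum_mem _ fun j _ => hM.hom_mem n _ (hc2 j) m _ (hb j)
    have hc0 : c = 0 := by
      apply hbi
      refine hM.s2_pow (n + 1) m _ (- ∑ j, h' j • b j) 
        (Submodule.sum_mem _ fun j _ => Submodule.smul_mem _ _ (hb j)) ?_ ?_
      · apply Submodule.neg_mem
        convert hw using 2
        push_cast; ring
      · rw [smul_neg]
        exact eq_neg_of_add_eq_zero_left hsum
    have hz : ∑ j, h' j • b j = 0 := by
      rw [hc0] at hsum
      simpa using hsum
    have h'0 := ih h' hc2 hz
    ext1 j
    rw [hc1, hc0, h'0]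
    simp

end S2
end HK

set_option linter.unusedSectionVars false
namespace HK
open MvPolynomial

section window
variable {k : Type*} [Field k] {E : Type*} [AddCommGroup E] [Module k E] [Module (Pol k) E]
  [IsScalarTower k (Pol k) E] [Module.IsTorsionFree (Pol k) E]
variable {δ : ℕ} {M : ℤ → Submodule k E}

theorem IsS2.pol_indep (hδ : 0 < δ) (hM : IsS2 (δ : ℤ) M) (m : ℤ) {J : Fin δ → Type*}
    [∀ i, Fintype (J i)]
    (b : ∀ i, J i → E) (hb : ∀ (i : Fin δ) (j : J i), b i j ∈ M (m + (i : ℕ)))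
    (hbi : ∀ i, ∀ c : J i → k,
      (∃ u ∈ M (m + (i : ℕ) - δ), ∑ j, c j • b i j = (X 0 : Pol k) • u) → c = 0) :
    LinearIndependent (Pol k) (fun p : (Σ i, J i) => b p.1 p.2) := by
  rw [Fintype.linearIndependent_iff]
  intro h h0
  obtain ⟨N, hN⟩ : ∃ N, ∀ p, (h p).totalDegree < N := by
    refine ⟨(Finset.univ.sup fun p => (h p).totalDegree) + 1, fun p => ?_⟩
    exact Nat.lt_succ_of_le (Finset.le_sup (f := fun p => (h p).totalDegree) (Finset.mem_univ p))
  have hsum : ∀ p, h p = ∑ n ∈ Finset.range N, homogeneousComponent n (h p) := by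
    intro p
    conv_lhs => rw [← sum_homogeneousComponent (h p)]
    apply Finset.sum_subset
    · intro n hn
      have := hN p
      simp at hn ⊢
      omega
    · intro n _ hn
      apply homogeneousComponent_eq_zero
      simp at hn; omega
  have hind := (iSupIndep.comp hM.indep (f := fun q : Fin δ × ℕ => m + (q.1 : ℕ) + q.2 * δ) (by
    rintro ⟨i, n⟩ ⟨i', n'⟩ hh
    have h1 : (i : ℕ) + n * δ = (i' : ℕ) + n' * δ := by
      simp only at hh
      zify; linarith
    have hi : (i : ℕ) = i' := by
      have := congrArg (· % δ) h1
      simpa [Nat.add_mul_mod_self_right, Nat.mod_eq_of_lt i.2, Nat.mod_eq_of_lt i'.2] using this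
    have hn : n = n' := by
      rw [hi] at h1
      exact Nat.eq_of_mul_eq_mul_right hδ (by omega)
    rw [hn, Fin.ext hi]))
  rw [iSupIndep_iff_finsetSum_eq_zero_imp_eq_zero] at hind
  have key := hind (Finset.univ ×ˢ Finset.range N)
    (fun q => ∑ j, homogeneousComponent q.2 (h ⟨q.1, j⟩) • b q.1 j)
    (fun q _ => Submodule.sum_mem _ fun j _ =>
      hM.hom_mem _ _ (homogeneousComponent_isHomogeneous _ _) _ _ (hb _ _)) (by
      rw [Finset.sum_product, ← h0, Fintype.sum_sigma]
      refine Finset.sum_congr rfl fun i _ => ?_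
      refine (Finset.sum_comm (β := E) (s := Finset.range N) (t := Finset.univ)
        (f := fun n j => homogeneousComponent n (h ⟨i, j⟩) • b i j)).trans ?_
      refine Finset.sum_congr rfl fun j _ => ?_
      conv_rhs => rw [hsum]
      rw [Finset.sum_smul])
  rintro ⟨i, j⟩
  rw [hsum]
  apply Finset.sum_eq_zero
  intro n hn
  have := hM.hom_rel (m + (i : ℕ)) (b i) (hb i) (hbi i) n
    (fun j => homogeneousComponent n (h ⟨i, j⟩)) (fun j => homogeneousComponent_isHomogeneous _ _)
    (key (i, n) (by simpa using hn))
  exact congrFun this j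

/-- Choose lifts of a basis of `M m / X0 M (m - δ)`. -/
theorem IsS2.exists_lift (hM : IsS2 (δ : ℤ) M) (m : ℤ) :
    ∃ b : Fin (Module.finrank k (M m) - Module.finrank k (M (m - δ))) → E,
      (∀ j, b j ∈ M m) ∧ ∀ c : _ → k,
      (∃ u ∈ M (m - δ), ∑ j, c j • b j = (X 0 : Pol k) • u) → c = 0 := by
  have := hM.fin m
  have := hM.fin (m - δ)
  let φ : M (m - δ) →ₗ[k] M m :=
    { toFun := fun v => ⟨(X 0 : Pol k) • (v : E), by
        have := hM.x_mem _ _ v.2; simpa using this⟩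
      map_add' := by intro a b; ext; simp
      map_smul' := by
        intro c a; ext; simp only [SetLike.val_smul, RingHom.id_apply]
        rw [← algebraMap_smul (Pol k) c (a : E), ← algebraMap_smul (Pol k) c (_ • (a : E)), smul_comm] }
  have hinj : Function.Injective φ := by
    intro a b hab
    have : (X 0 : Pol k) • (a : E) = (X 0 : Pol k) • (b : E) := congrArg Subtype.val hab
    exact Subtype.ext (smul_right_injective E (X_ne_zero 0) this)
  have hr : Module.finrank k (LinearMap.range φ) = Module.finrank k (M (m - δ)) :=
    LinearMap.finrank_range_of_inj hinj
  have hq : Module.finrank k (M m ⧸ LinearMap.range φ) =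
      Module.finrank k (M m) - Module.finrank k (M (m - δ)) := by
    have := Submodule.finrank_quotient_add_finrank (LinearMap.range φ)
    omega
  let B := Module.finBasisOfFinrankEq k (M m ⧸ LinearMap.range φ) hq
  choose b hb using fun j => Submodule.mkQ_surjective (LinearMap.range φ) (B j)
  refine ⟨fun j => b j, fun j => (b j).2, ?_⟩
  rintro c ⟨u, hu, hcu⟩
  have h1 : ∑ j, c j • b j = φ ⟨u, hu⟩ := by
    ext
    simpa [φ] using hcu
  have h2 : ∑ j, c j • B j = 0 := by
    have h3 : (LinearMap.range φ).mkQ (∑ j, c j • b j) = 0 := by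
      rw [h1]
      simp
    rw [map_sum] at h3
    simpa only [map_smul, hb] using h3
  have := Fintype.linearIndependent_iff.1 B.linearIndependent c h2
  ext1 j; exact this j

variable {K0 K : Type*} [Field K0] [Field K] [Algebra (Pol k) K0] [IsFractionRing (Pol k) K0]
  [Algebra K0 K] [FiniteDimensional K0 K] [Module K0 E] [Module K E] [FiniteDimensional K E]
  [IsScalarTower K0 K E] [IsScalarTower (Pol k) K0 E]

/-- K-span of pieces of degree at most t. -/
def UU (K : Type*) [Field K] [Module K E] (M : ℤ → Submodule k E) (t : ℤ) : Submodule K E :=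
  Submodule.span K (⋃ s ≤ t, (M s : Set E))

theorem mem_UU {t s : ℤ} (h : s ≤ t) {v : E} (hv : v ∈ M s) : v ∈ UU K M t :=
  Submodule.subset_span (by simp only [Set.mem_iUnion]; exact ⟨s, h, hv⟩)

theorem UU_mono : Monotone (UU K M) := by
  intro s t hst
  apply Submodule.span_mono
  intro v hv
  simp only [Set.mem_iUnion] at hv ⊢
  obtain ⟨r, hr, hv⟩ := hv
  exact ⟨r, hr.trans hst, hv⟩

include K0 in
theorem IsS2.window (hδ : 0 < δ) (hM : IsS2 (δ : ℤ) M) (m : ℤ) :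
    ∑ i ∈ Finset.range δ, Module.finrank k (M (m + i)) ≤
    ∑ i ∈ Finset.range δ, Module.finrank k (M (m + i - δ)) +
      Module.finrank K0 K * Module.finrank K (UU K M (m + δ - 1)) := by
  choose b hb hbi using fun i : Fin δ => hM.exists_lift (m + (i : ℕ))
  have hli := hM.pol_indep hδ m b hb hbi
  rw [LinearIndependent.iff_fractionRing (R := Pol k) (K := K0)] at hli
  let U := (UU K M (m + δ - 1)).restrictScalars K0
  have hmem : ∀ p : (Σ i : Fin δ, Fin (Module.finrank k (M (m + (i : ℕ))) -
      Module.finrank k (M (m + (i : ℕ) - δ)))), b p.1 p.2 ∈ U := by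
    rintro ⟨i, j⟩
    exact mem_UU (K := K) (by have := i.2; omega) (hb i j)
  have : FiniteDimensional K0 E := Module.Finite.trans K E
  have hli2 : LinearIndependent K0 (fun p : (Σ i : Fin δ, Fin (Module.finrank k (M (m + (i : ℕ))) -
      Module.finrank k (M (m + (i : ℕ) - δ)))) => (⟨b p.1 p.2, hmem p⟩ : U)) := by
    apply LinearIndependent.of_comp U.subtype
    exact hli
  have hcard := hli2.fintype_card_le_finrank
  rw [Fintype.card_sigma] at hcard
  simp only [Fintype.card_fin] at hcard
  have hU : Module.finrank K0 U = Module.finrank K0 K * Module.finrank K (UU K M (m + δ - 1)) := by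
    rw [Module.finrank_mul_finrank K0 K (UU K M (m + δ - 1))]
    rfl
  rw [hU, Fin.sum_univ_eq_sum_range (fun i : ℕ => Module.finrank k (M (m + (i : ℕ))) -
      Module.finrank k (M (m + (i : ℕ) - δ)))] at hcard
  calc _ ≤ ∑ i ∈ Finset.range δ, (Module.finrank k (M (m + i - δ)) + 
        (Module.finrank k (M (m + (i : ℕ))) - Module.finrank k (M (m + (i : ℕ) - δ)))) :=
        Finset.sum_le_sum fun i _ => by omega
    _ ≤ _ := by rw [Finset.sum_add_distrib]; omega


theorem IsS2.adapted_aux (hM : IsS2 (δ : ℤ) M) (B : ℤ) (hB : ∀ m < B, M m = ⊥) (j : ℕ) :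
    ∃ (b : Set E) (n : E → ℤ), LinearIndepOn K id b ∧ (∀ v ∈ b, v ∈ M (n v)) ∧
      (∀ v ∈ b, v ∈ UU K M (B - 1 + j)) ∧
      ∀ t ≤ B - 1 + j, UU K M t ≤ Submodule.span K {v ∈ b | n v ≤ t} := by
  induction j with
  | zero =>
    refine ⟨∅, fun _ => 0, linearIndepOn_empty _ _, by simp, by simp, ?_⟩
    intro t ht
    apply Submodule.span_le.2
    intro v hv
    simp only [Set.mem_iUnion] at hv
    obtain ⟨s, hs, hv⟩ := hv
    rw [hB s (by simp at ht; omega)] at hv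
    have : v = 0 := by simpa using hv
    rw [this]; exact Submodule.zero_mem _
  | succ j ih =>
    obtain ⟨b, n, hli, hmem, hU, hsp⟩ := ih
    obtain ⟨b', hb't, hbb', hspan, hli'⟩ := exists_linearIndepOn_extension hli
      (Set.subset_union_left (s := b) (t := (M (B - 1 + j + 1) : Set E)))
    classical
    refine ⟨b', fun v => if v ∈ b then n v else B - 1 + j + 1, hli', ?_, ?_, ?_⟩
    · intro v hv
      by_cases hvb : v ∈ b
      · simpa [hvb] using hmem v hvb
      · simp only [hvb, if_false]
        rcases hb't hv with h | h
        · exact absurd h hvb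
        · exact h
    · intro v hv
      rcases hb't hv with h | h
      · exact UU_mono (by push_cast; omega) (hU v h)
      · exact mem_UU (by push_cast; omega) h
    · intro t ht
      by_cases ht' : t ≤ B - 1 + j
      · refine (hsp t ht').trans (Submodule.span_mono ?_)
        rintro v ⟨hv, hnv⟩
        refine ⟨hbb' hv, ?_⟩
        simpa [hv] using hnv
      · have hteq : t = B - 1 + j + 1 := by push_cast at ht; omega
        have hall : b' = {v ∈ b' | (if v ∈ b then n v else B - 1 + j + 1) ≤ t} ∨ True := Or.inr trivial
        have hlow : UU K M (B - 1 + j) ≤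
            Submodule.span K {v ∈ b' | (if v ∈ b then n v else B - 1 + j + 1) ≤ t} := by
          refine (hsp _ le_rfl).trans (Submodule.span_mono ?_)
          rintro v ⟨hv, hnv⟩
          refine ⟨hbb' hv, ?_⟩
          simp only [hv, if_true]
          omega
        have hb'sub : Submodule.span K b' ≤
            Submodule.span K {v ∈ b' | (if v ∈ b then n v else B - 1 + j + 1) ≤ t} := by
          apply Submodule.span_le.2
          intro v hv
          by_cases hvb : v ∈ b
          · exact hlow (hU v hvb)
          · apply Submodule.subset_span
            refine ⟨hv, ?_⟩
            simp only [hvb, if_false]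
            omega
        apply Submodule.span_le.2
        intro v hv
        simp only [Set.mem_iUnion] at hv
        obtain ⟨s, hs, hv⟩ := hv
        by_cases hs' : s ≤ B - 1 + j
        · exact hlow (mem_UU hs' hv)
        · have : s = B - 1 + j + 1 := by omega
          subst this
          apply hb'sub
          simp only [Set.image_id] at hspan
          exact hspan (Or.inr hv)

theorem IsS2.adapted (hM : IsS2 (δ : ℤ) M) (W : Submodule K E)
    (hW : ∀ t, UU K M t ≤ W) (t0 : ℤ) (ht0 : UU K M t0 = W) :
    ∃ (v : Fin (Module.finrank K W) → E) (n : Fin (Module.finrank K W) → ℤ),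
      LinearIndependent K v ∧ (∀ i, v i ∈ M (n i)) ∧ Submodule.span K (Set.range v) = W ∧
      (∀ t, UU K M t = W → ∀ i, n i ≤ t) ∧
      (∀ t, Module.finrank K (UU K M t) ≤ (Finset.univ.filter fun i => n i ≤ t).card) := by
  classical
  obtain ⟨B, hB⟩ := hM.bdd
  obtain ⟨b, n, hli, hmem, hU, hsp⟩ := hM.adapted_aux (K := K) B hB (t0 - (B - 1)).toNat
  set T := B - 1 + ((t0 - (B - 1)).toNat : ℤ) with hT
  have hT0 : t0 ≤ T := by omega
  have hTW : UU K M T = W := le_antisymm (hW _) (ht0 ▸ UU_mono hT0)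
  have hspan : Submodule.span K b = W := by
    apply le_antisymm
    · apply Submodule.span_le.2
      intro v hv
      rw [← hTW]; exact hU v hv
    · rw [← hTW]
      exact (hsp T le_rfl).trans (Submodule.span_mono (fun v hv => hv.1))
  have hli' : LinearIndependent K (fun v : b => (v : E)) := hli
  have hfin : Finite b := hli'.finite
  have := Fintype.ofFinite b
  have hcard : Module.finrank K W = Fintype.card b := by
    rw [← hspan]
    have h := finrank_span_eq_card hli'
    rwa [Subtype.range_coe] at h
  let e : Fin (Module.finrank K W) ≃ b := (finCongr hcard).trans (Fintype.equivFin b).symm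
  have hrk : ∀ t, Module.finrank K (UU K M t) ≤
      (Finset.univ.filter fun i => n (e i) ≤ t).card := by
    have hlow : ∀ t ≤ T, Module.finrank K (UU K M t) ≤
        (Finset.univ.filter fun i => n (e i) ≤ t).card := by
      intro t ht
      refine (Submodule.finrank_mono (hsp t ht)).trans ?_
      have himg : {v ∈ b | n v ≤ t} = 
          ((Finset.univ.filter fun i => n (e i) ≤ t).image (fun i => (e i : E)) : Finset E) := by
        ext v
        simp only [Set.mem_ofPred_eq, Finset.coe_image, Finset.coe_filter, Finset.mem_univ, true_and,
          Set.mem_image]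
        constructor
        · rintro ⟨hv, hn⟩
          exact ⟨e.symm ⟨v, hv⟩, by simpa using hn, by simp⟩
        · rintro ⟨i, hi, rfl⟩
          exact ⟨(e i).2, hi⟩
      rw [himg]
      exact (finrank_span_finset_le_card _).trans Finset.card_image_le
    intro t
    by_cases ht : t ≤ T
    · exact hlow t ht
    · have h1 := hlow T le_rfl
      have h2 : UU K M t = UU K M T := by
        rw [hTW]
        exact le_antisymm (hW _) (hTW ▸ UU_mono (by omega))
      rw [h2]
      refine h1.trans (Finset.card_le_card ?_)
      intro i hi
      simp only [Finset.mem_filter, Finset.mem_univ, true_and] at hi ⊢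
      omega
  refine ⟨fun i => e i, fun i => n (e i), hli'.comp e e.injective, fun i => hmem _ (e i).2,
    ?_, ?_, hrk⟩
  · refine Eq.trans ?_ hspan
    congr 1
    ext v
    constructor
    · rintro ⟨i, rfl⟩; exact (e i).2
    · intro hv; exact ⟨e.symm ⟨v, hv⟩, by simp⟩
  · intro t ht i
    have h1 := hrk t
    rw [ht] at h1
    have h2 : (Finset.univ.filter fun i => n (e i) ≤ t) = Finset.univ := by
      apply Finset.eq_univ_of_card
      refine le_antisymm (Finset.card_le_univ _) ?_
      simpa using h1
    have := Finset.mem_univ i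
    rw [← h2] at this
    simpa using this

include K0 in
theorem IsS2.MU (hδ : 0 < δ) (hM : IsS2 (δ : ℤ) M) (W : Submodule K E)
    (hW : ∀ t, UU K M t ≤ W) (t0 : ℤ) (ht0 : UU K M t0 = W) :
    ∃ (v : Fin (Module.finrank K W) → E) (n : Fin (Module.finrank K W) → ℤ),
      LinearIndependent K v ∧ (∀ i, v i ∈ M (n i)) ∧ Submodule.span K (Set.range v) = W ∧
      (∀ t, UU K M t = W → ∀ i, n i ≤ t) ∧
      ∀ m : ℤ, (δ : ℤ) * ∑ i ∈ Finset.range δ, (Module.finrank k (M (m + i)) : ℤ) ≤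
        Module.finrank K0 K * ∑ i, max (m + 2 * δ - n i) 0 := by
  obtain ⟨v, n, h1, h2, h3, h4, h5⟩ := hM.adapted W hW t0 ht0
  refine ⟨v, n, h1, h2, h3, h4, ?_⟩
  obtain ⟨B, hB⟩ := hM.bdd
  have key : ∀ j : ℕ, ∀ m : ℤ, m ≤ B - δ + j → 
      (δ : ℤ) * ∑ i ∈ Finset.range δ, (Module.finrank k (M (m + i)) : ℤ) ≤
        Module.finrank K0 K * ∑ i, max (m + 2 * δ - n i) 0 := by
    intro j
    induction j with
    | zero =>
      intro m hm
      have : ∑ i ∈ Finset.range δ, (Module.finrank k (M (m + i)) : ℤ) = 0 := by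
        apply Finset.sum_eq_zero
        intro i hi
        rw [hB]
        · simp
        · simp at hi hm; omega
      rw [this, mul_zero]
      exact mul_nonneg (by positivity) (Finset.sum_nonneg fun i _ => le_max_right _ _)
    | succ j ih =>
      intro m hm
      have hw := hM.window (K := K) (K0 := K0) hδ m
      have hi := ih (m - δ) (by push_cast at hm; omega)
      have h6 := h5 (m + δ - 1)
      have hw' : ∑ i ∈ Finset.range δ, (Module.finrank k (M (m + i)) : ℤ) ≤
        ∑ i ∈ Finset.range δ, (Module.finrank k (M (m - δ + i)) : ℤ) +
        Module.finrank K0 K * ((Finset.univ.filter fun i => n i ≤ m + δ - 1).card : ℤ) := by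
        have e1 : ∀ i : ℕ, Module.finrank k (M (m - δ + i)) = Module.finrank k (M (m + i - δ)) :=
          fun i => by rw [show m - (δ : ℤ) + i = m + i - δ by ring]
        simp only [e1]
        have : ((Module.finrank K0 K * Module.finrank K (UU K M (m + δ - 1)) : ℕ) : ℤ) ≤
          Module.finrank K0 K * ((Finset.univ.filter fun i => n i ≤ m + δ - 1).card : ℤ) := by
          push_cast
          gcongr
        have hw2 : (∑ i ∈ Finset.range δ, (Module.finrank k (M (m + i)) : ℤ)) ≤
          ∑ i ∈ Finset.range δ, (Module.finrank k (M (m + i - δ)) : ℤ) + 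
          ((Module.finrank K0 K * Module.finrank K (UU K M (m + δ - 1)) : ℕ) : ℤ) := by
          exact_mod_cast hw
        linarith
      have hfin : ∑ i, max (m - δ + 2 * δ - n i) 0 +
          δ * ((Finset.univ.filter fun i => n i ≤ m + δ - 1).card : ℤ) ≤
          ∑ i, max (m + 2 * δ - n i) 0 := by
        rw [Finset.card_filter]
        push_cast
        rw [Finset.mul_sum, ← Finset.sum_add_distrib]
        apply Finset.sum_le_sum
        intro i _
        split_ifs with h <;> omega
      calc _ ≤ (δ : ℤ) * (∑ i ∈ Finset.range δ, (Module.finrank k (M (m - δ + i)) : ℤ) +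
        Module.finrank K0 K * ((Finset.univ.filter fun i => n i ≤ m + δ - 1).card : ℤ)) := by gcongr
        _ ≤ Module.finrank K0 K * (∑ i, max (m - δ + 2 * δ - n i) 0 +
          δ * ((Finset.univ.filter fun i => n i ≤ m + δ - 1).card : ℤ)) := by
            rw [mul_add, mul_add]
            linarith
        _ ≤ _ := by gcongr
  intro m
  exact key (m - (B - δ)).toNat m (by omega)

end window
end HK

set_option linter.unusedSectionVars false
namespace HK
open MvPolynomial

section ufd
variable {A : Type*} [CommRing A] [IsDomain A] [UniqueFactorizationMonoid A]

theorem ufd_dvd {ι : Type*} (μ : ι → A) (hμ : ∀ π, Prime π → ∃ i, ¬ π ∣ μ i) (n : ℕ)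
    (g : A) (hg : g ≠ 0) (c : A) (h : ∀ i, g ∣ μ i ^ n * c) : g ∣ c := by
  induction g using UniqueFactorizationMonoid.induction_on_prime generalizing c with
  | h₁ => exact absurd rfl hg
  | h₂ x hx => exact hx.dvd
  | h₃ a π ha hπ ih =>
    obtain ⟨i, hi⟩ := hμ π hπ
    have h1 : π ∣ c := by
      rcases hπ.dvd_or_dvd ((dvd_mul_right π a).trans (h i)) with h2 | h2
      · exact absurd (hπ.dvd_of_dvd_pow h2) hi
      · exact h2
    obtain ⟨c', rfl⟩ := h1
    apply mul_dvd_mul_left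
    apply ih ha
    intro j
    have := h j
    rw [mul_left_comm] at this
    exact (mul_dvd_mul_iff_left hπ.ne_zero).1 this

theorem ufd_gcd {ι : Type*} (i0 : ι) (a : ι → A) (h : a i0 ≠ 0) :
    ∃ (γ : A) (μ : ι → A), γ ≠ 0 ∧ (∀ i, a i = γ * μ i) ∧ ∀ π, Prime π → ∃ i, ¬ π ∣ μ i := by
  generalize hx : a i0 = x
  revert a
  apply WellFounded.induction (r := DvdNotUnit) wellFounded_dvdNotUnit x
  intro x ih a h hx
  by_cases hp : ∀ π, Prime π → ∃ i, ¬ π ∣ a i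
  · exact ⟨1, a, one_ne_zero, by simp, hp⟩
  push Not at hp
  obtain ⟨π, hπ, hd⟩ := hp
  choose a' ha' using hd
  have h0 : a' i0 ≠ 0 := by
    intro h0; apply h; rw [ha', h0, mul_zero]
  obtain ⟨γ, μ, h1, h2, h3⟩ := ih (a' i0) ⟨h0, π, hπ.not_isUnit, by rw [← hx, ha', mul_comm]⟩ a' h0 rfl
  refine ⟨π * γ, μ, mul_ne_zero hπ.ne_zero h1, fun i => ?_, h3⟩
  rw [ha', h2, mul_assoc]

end ufd

section values
variable {k : Type*} [Field k]

theorem infinite_quot (π : Pol k) (hπ : Prime π) : Infinite (Pol k ⧸ Ideal.span {π}) := by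
  by_contra hfin
  rw [not_infinite_iff_finite] at hfin
  have key : ∀ i : Fin 2, ∃ a b : ℕ, a ≠ b ∧ π ∣ X i ^ a - X i ^ b := by
    intro i
    obtain ⟨a, b, hab, h⟩ := Finite.exists_ne_map_eq_of_infinite
      (fun n : ℕ => Ideal.Quotient.mk (Ideal.span {π}) (X i ^ n))
    refine ⟨a, b, hab, ?_⟩
    rw [Ideal.Quotient.eq, Ideal.mem_span_singleton] at h
    exact h
  have hdeg : ∀ i j : Fin 2, i ≠ j → degreeOf j π = 0 := by
    intro i j hij
    obtain ⟨a, b, hab, c, hc⟩ := key i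
    have hne : (X i ^ a - X i ^ b : Pol k) ≠ 0 := by
      intro h0
      rw [sub_eq_zero, X_pow_eq_monomial, X_pow_eq_monomial,
        MvPolynomial.monomial_left_inj one_ne_zero] at h0
      have := DFunLike.congr_fun h0 i
      simp at this
      exact hab this
    have hc0 : c ≠ 0 := by
      rintro rfl; rw [mul_zero] at hc; exact hne hc
    have h1 : degreeOf j (X i ^ a - X i ^ b : Pol k) = 0 := by
      refine Nat.le_zero.1 ((degreeOf_sub_le _ _ _).trans ?_)
      have hx : ∀ n, degreeOf j (X i ^ n : Pol k) = 0 := by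
        intro n
        refine Nat.le_zero.1 ((degreeOf_pow_le _ _ _).trans ?_)
        rw [degreeOf_X_of_ne hij.symm]; simp
      rw [hx, hx]; simp
    rw [hc, degreeOf_mul_eq hπ.ne_zero hc0] at h1
    omega
  have h0 : π.totalDegree = 0 := by
    rw [totalDegree_eq_zero_iff]
    intro m hm i
    have h2 : degreeOf i π = 0 := by
      fin_cases i
      · exact hdeg 1 0 (by simp)
      · exact hdeg 0 1 (by simp)
    have := degreeOf_le_iff.1 (le_of_eq h2) m (by simpa using hm)
    omega
  obtain ⟨c, hc⟩ : ∃ c, π = C c := ⟨_, totalDegree_eq_zero_iff_eq_C.1 h0⟩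
  apply hπ.not_isUnit
  rw [hc]
  have : c ≠ 0 := by
    rintro rfl; apply hπ.ne_zero; rw [hc, C_0]
  exact (IsUnit.mk0 c this).map C

open Polynomial in
theorem values_dvd (d : Pol k) (hd : d ≠ 0) (Q : Polynomial (Pol k)) (h : ∀ l, d ∣ Q.eval l) :
    Polynomial.C d ∣ Q := by
  induction d using UniqueFactorizationMonoid.induction_on_prime generalizing Q with
  | h₁ => exact absurd rfl hd
  | h₂ x hx => exact (hx.map Polynomial.C).dvd
  | h₃ a π ha hπ ih =>
    have := infinite_quot π hπ
    have hprime : (Ideal.span {π}).IsPrime := (Ideal.span_singleton_prime hπ.ne_zero).2 hπ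
    have h1 : Q.map (Ideal.Quotient.mk (Ideal.span {π})) = 0 := by
      apply Polynomial.funext
      intro r
      obtain ⟨l, rfl⟩ := Ideal.Quotient.mk_surjective r
      rw [Polynomial.eval_map_apply, Polynomial.eval_zero, Ideal.Quotient.eq_zero_iff_mem,
        Ideal.mem_span_singleton]
      exact (dvd_mul_right π a).trans (h l)
    have h2 : Polynomial.C π ∣ Q := by
      rw [Polynomial.C_dvd_iff_dvd_coeff]
      intro i
      have := congrArg (fun P => Polynomial.coeff P i) h1
      simp only [Polynomial.coeff_map, Polynomial.coeff_zero] at this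
      rwa [Ideal.Quotient.eq_zero_iff_mem, Ideal.mem_span_singleton] at this
    obtain ⟨Q', rfl⟩ := h2
    rw [Polynomial.C_mul]
    apply mul_dvd_mul_left
    apply ih ha
    intro l
    have := h l
    rw [Polynomial.eval_mul, Polynomial.eval_C] at this
    exact (mul_dvd_mul_iff_left hπ.ne_zero).1 this

variable {K0 : Type*} [Field K0] [Algebra (Pol k) K0] [IsFractionRing (Pol k) K0]

theorem values_lift (P : Polynomial K0)
    (h : ∀ l : Pol k, ∃ a : Pol k, P.eval (algebraMap (Pol k) K0 l) = algebraMap _ K0 a) :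
    ∃ Q : Polynomial (Pol k), P = Q.map (algebraMap (Pol k) K0) := by
  have hinj := IsFractionRing.injective (Pol k) K0
  obtain ⟨d, hdm, hd⟩ := IsLocalization.integerNormalization_spec (nonZeroDivisors (Pol k)) P
  set Q := IsLocalization.integerNormalization (nonZeroDivisors (Pol k)) P with hQ
  have hd0 : (d : Pol k) ≠ 0 := nonZeroDivisors.ne_zero hdm
  obtain ⟨Q', hQ'⟩ := values_dvd (d : Pol k) hd0 Q (by
    intro l
    obtain ⟨a, ha⟩ := h l
    refine ⟨a, hinj ?_⟩
    rw [← Polynomial.eval_map_apply, hd]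
    rw [Algebra.smul_def, map_mul, ← ha]
    simp [Polynomial.algebraMap_apply]
    )
  refine ⟨Q', ?_⟩
  have h0 : algebraMap (Pol k) K0 d ≠ 0 := by
    intro h0; apply hd0; apply hinj; rw [h0, map_zero]
  have h1 : Polynomial.C (algebraMap (Pol k) K0 d) * P = Polynomial.C (algebraMap (Pol k) K0 d) * Q'.map (algebraMap (Pol k) K0) := by
    rw [← Polynomial.map_C, ← Polynomial.map_mul, ← hQ', hd, Algebra.smul_def]
    simp [Polynomial.algebraMap_apply]
  exact mul_left_cancel₀ (by simp [h0]) h1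

end values

section norm
variable {k : Type*} [Field k] {K0 K : Type*} [Field K0] [Field K] [Algebra (Pol k) K0]
  [IsFractionRing (Pol k) K0] [Algebra K0 K] [FiniteDimensional K0 K] [Algebra (Pol k) K]
  [IsScalarTower (Pol k) K0 K]

variable (k K0) in
open Classical in
/-- The norm of an integral element as a polynomial. -/
noncomputable def NA (z : K) : Pol k :=
  if h : ∃ a : Pol k, algebraMap (Pol k) K0 a = Algebra.norm K0 z then h.choose else 0

theorem NA_spec {z : K} (hz : IsIntegral (Pol k) z) :
    algebraMap (Pol k) K0 (NA k K0 z) = Algebra.norm K0 z := by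
  have h : ∃ a : Pol k, algebraMap (Pol k) K0 a = Algebra.norm K0 z := by
    have := Algebra.isIntegral_norm K0 hz
    exact IsIntegrallyClosed.algebraMap_eq_of_integral this
  rw [NA, dif_pos h]
  exact h.choose_spec

theorem NA_eq {z : K} (a : Pol k) (h : algebraMap (Pol k) K0 a = Algebra.norm K0 z) :
    NA k K0 z = a := by
  have h' : ∃ a : Pol k, algebraMap (Pol k) K0 a = Algebra.norm K0 z := ⟨a, h⟩
  apply IsFractionRing.injective (Pol k) K0
  rw [h, NA, dif_pos h', h'.choose_spec]

theorem NA_mul {z w : K} (hz : IsIntegral (Pol k) z) (hw : IsIntegral (Pol k) w) :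
    NA k K0 (z * w) = NA k K0 z * NA k K0 w := by
  apply NA_eq
  rw [map_mul, map_mul, NA_spec hz, NA_spec hw]

theorem NA_pow {z : K} (hz : IsIntegral (Pol k) z) (n : ℕ) :
    NA k K0 (z ^ n) = NA k K0 z ^ n := by
  apply NA_eq
  rw [map_pow, map_pow, NA_spec hz]

theorem NA_ne_zero {z : K} (hz : IsIntegral (Pol k) z) (h : z ≠ 0) : NA k K0 z ≠ 0 := by
  intro h0
  have := NA_spec (K0 := K0) hz
  rw [h0, map_zero] at this
  exact h (Algebra.norm_eq_zero_iff.1 this.symm)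

theorem NA_algebraMap (a : Pol k) :
    NA k K0 (algebraMap (Pol k) K a) = a ^ Module.finrank K0 K := by
  apply NA_eq
  rw [IsScalarTower.algebraMap_apply (Pol k) K0 K, Algebra.norm_algebraMap, map_pow]

theorem NA_dvd {z w : K} (hz : IsIntegral (Pol k) z) (u : K)
    (hu : IsIntegral (Pol k) u) (h : w = z * u) : NA k K0 z ∣ NA k K0 w :=
  ⟨NA k K0 u, by rw [h, NA_mul hz hu]⟩

/-- key integrality: `μ • (g / w)` is integral. -/
theorem integral_quot {g w : K} (hg : IsIntegral (Pol k) g) (hw : IsIntegral (Pol k) w) (hw0 : w ≠ 0)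
    (γ μ : Pol k) (hγ : γ ≠ 0) (hN : NA k K0 w = γ * μ)
    (hd : ∀ l : Pol k, γ ∣ NA k K0 (algebraMap (Pol k) K l * w - g)) :
    IsIntegral (Pol k) (algebraMap (Pol k) K μ * (g / w)) := by
  have hinj := IsFractionRing.injective (Pol k) K0
  have hγ' : algebraMap (Pol k) K0 γ ≠ 0 := by
    intro h; apply hγ; apply hinj; rw [h, map_zero]
  have hμ : μ ≠ 0 := by
    rintro rfl
    exact NA_ne_zero (K0 := K0) hw hw0 (by rw [hN, mul_zero])
  have hμ' : algebraMap (Pol k) K0 μ ≠ 0 := by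
    intro h; apply hμ; apply hinj; rw [h, map_zero]
  set y := g / w with hy
  set χ := (LinearMap.mulLeft K0 y).charpoly with hχ
  have hmonic : χ.Monic := LinearMap.charpoly_monic _
  have heval : ∀ t : K0, χ.eval t = Algebra.norm K0 (algebraMap K0 K t - y) := by
    intro t
    rw [hχ, LinearMap.eval_charpoly, Algebra.norm_apply]
    congr 1
    ext v
    simp [Algebra.smul_def]
  have hroot : Polynomial.aeval y χ = 0 := by
    have h1 := LinearMap.aeval_self_charpoly (LinearMap.mulLeft K0 y)
    have h2 : ∀ P : Polynomial K0, Polynomial.aeval (LinearMap.mulLeft K0 y) P =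
        LinearMap.mulLeft K0 (Polynomial.aeval y P) := by
      intro P
      have := Polynomial.aeval_algHom_apply (Algebra.lmul K0 K) y P
      exact this
    rw [h2] at h1
    have := congrArg (fun f => f 1) h1
    simpa using this
  obtain ⟨Q, hQ⟩ := values_lift (k := k) (Polynomial.C (algebraMap (Pol k) K0 μ) * χ) (by
    intro l
    obtain ⟨a, ha⟩ := hd l
    refine ⟨a, ?_⟩
    rw [Polynomial.eval_mul, Polynomial.eval_C, heval]
    apply mul_left_cancel₀ hγ'
    rw [← map_mul (algebraMap (Pol k) K0) γ a, ← ha, NA_spec ((isIntegral_algebraMap.mul hw).sub hg),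
      ← mul_assoc, ← map_mul, ← hN, NA_spec hw, ← map_mul]
    congr 1
    rw [← IsScalarTower.algebraMap_apply, hy]
    field_simp)
  have hlead : Q.leadingCoeff = μ := by
    apply hinj
    rw [← Polynomial.leadingCoeff_map_of_injective hinj, ← hQ, Polynomial.leadingCoeff_mul,
      hmonic.leadingCoeff, mul_one, Polynomial.leadingCoeff_C]
  have hQ0 : Polynomial.aeval y Q = 0 := by
    rw [← Polynomial.aeval_map_algebraMap K0, ← hQ, map_mul, hroot, mul_zero]
  have := isIntegral_leadingCoeff_smul Q y hQ0
  rwa [hlead, Algebra.smul_def] at this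

theorem AL {Φ : Type*} [Fintype Φ] (g : Φ → K) (hg : ∀ φ, IsIntegral (Pol k) (g φ))
    (hne : ∃ φ, g φ ≠ 0) :
    ∃ γ : Pol k, γ ≠ 0 ∧
      (∃ (S : Set K) (μ : S → Pol k), (∀ w ∈ S, w ∈ Submodule.span (Pol k) (Set.range g)) ∧
        (∀ i : S, NA k K0 (i : K) = γ * μ i) ∧ (∀ π, Prime π → ∃ i, ¬ π ∣ μ i)) ∧
      ∀ (n : ℕ) (c : Φ → K), (∀ φ, IsIntegral (Pol k) (c φ)) →
        γ ^ n ∣ NA k K0 (∑ φ, c φ * g φ ^ n) := by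
  obtain ⟨φ0, hφ0⟩ := hne
  set J := Submodule.span (Pol k) (Set.range g) with hJ
  have hJint : ∀ w ∈ J, IsIntegral (Pol k) w := by
    intro w hw
    induction hw using Submodule.span_induction with
    | mem x hx => obtain ⟨φ, rfl⟩ := hx; exact hg φ
    | zero => exact isIntegral_zero
    | add x y _ _ hx hy => exact hx.add hy
    | smul a x _ hx => exact hx.smul a
  have hgJ : ∀ φ, g φ ∈ J := fun φ => Submodule.subset_span ⟨φ, rfl⟩
  obtain ⟨γ, μ, hγ, hN, hprime⟩ := ufd_gcd (A := Pol k) (ι := (J : Set K)) ⟨g φ0, hgJ φ0⟩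
    (fun w => NA k K0 (w : K)) (NA_ne_zero (hg φ0) hφ0)
  refine ⟨γ, hγ, ⟨J, μ, fun w hw => hw, hN, hprime⟩, ?_⟩
  intro n c hc
  set z := ∑ φ, c φ * g φ ^ n with hz
  have hzint : IsIntegral (Pol k) z := IsIntegral.sum _ fun φ _ => (hc φ).mul ((hg φ).pow n)
  rcases Nat.eq_zero_or_pos n with rfl | hn
  · simp
  apply ufd_dvd μ hprime (Module.finrank K0 K * n) _ (pow_ne_zero _ hγ)
  rintro ⟨w, hw⟩
  have hwint := hJint w hw
  have hD : 0 < Module.finrank K0 K := Module.finrank_pos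
  by_cases hw0 : w = 0
  · have : μ ⟨w, hw⟩ = 0 := by
      have h1 := hN ⟨w, hw⟩
      simp only [hw0] at h1
      rw [show NA k K0 (0 : K) = 0 from NA_eq 0 (by simp [Algebra.norm_zero])] at h1
      have := (mul_eq_zero.1 h1.symm).resolve_left hγ
      subst hw0; exact this
    rw [this, zero_pow (by positivity), zero_mul]
    exact dvd_zero _
  have hint : ∀ φ, IsIntegral (Pol k) (algebraMap (Pol k) K (μ ⟨w, hw⟩) * (g φ / w)) := by
    intro φ
    refine integral_quot (K0 := K0) (hg φ) hwint hw0 γ _ hγ (hN ⟨w, hw⟩) ?_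
    intro l
    have hmem : algebraMap (Pol k) K l * w - g φ ∈ J := by
      rw [← Algebra.smul_def]
      exact J.sub_mem (J.smul_mem _ hw) (hgJ φ)
    exact ⟨_, hN ⟨_, hmem⟩⟩
  set M := μ ⟨w, hw⟩ with hM
  have hint2 : IsIntegral (Pol k) (∑ φ, c φ * (algebraMap (Pol k) K M * (g φ / w)) ^ n) :=
    IsIntegral.sum _ fun φ _ => (hc φ).mul ((hint φ).pow n)
  have heq : w ^ n * (∑ φ, c φ * (algebraMap (Pol k) K M * (g φ / w)) ^ n) =
      (algebraMap (Pol k) K M) ^ n * z := by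
    rw [hz, Finset.mul_sum, Finset.mul_sum]
    refine Finset.sum_congr rfl fun φ _ => ?_
    rw [mul_pow, div_pow]
    field_simp
  have h2 := congrArg (NA k K0) heq
  rw [NA_mul (hwint.pow n) hint2, NA_mul (isIntegral_algebraMap.pow n) hzint, NA_pow hwint,
    NA_pow isIntegral_algebraMap, NA_algebraMap, hN ⟨w, hw⟩, ← pow_mul] at h2
  rw [← h2, mul_pow, mul_assoc]
  exact dvd_mul_right _ _

end norm
end HK

set_option linter.unusedSectionVars false
namespace HK
open MvPolynomial

section Az
variable {k : Type*} [Field k]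

/-- Homogeneous polynomials of degree `t / δ`. -/
noncomputable def Az (k : Type*) [Field k] (δ : ℕ) (t : ℤ) : Submodule k (Pol k) :=
  weightedHomogeneousSubmodule k (fun _ : Fin 2 => (δ : ℤ)) t

variable {δ : ℕ}

theorem weight_eq (d : Fin 2 →₀ ℕ) :
    Finsupp.weight (fun _ : Fin 2 => (δ : ℤ)) d = d.degree * δ := by
  rw [Finsupp.weight_apply, Finsupp.degree_eq_sum, Finsupp.sum_fintype _ _ (by simp)]
  simp [add_mul]

theorem mem_Az {t : ℤ} {a : Pol k} : a ∈ Az k δ t ↔ ∀ d, coeff d a ≠ 0 → (d.degree * δ : ℤ) = t := by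
  unfold Az
  rw [mem_weightedHomogeneousSubmodule]
  constructor
  · intro h d hd
    rw [← weight_eq]; exact h hd
  · intro h d hd
    rw [weight_eq]; exact h d hd

theorem Az_one : (1 : Pol k) ∈ Az k δ 0 := isWeightedHomogeneous_one _ _

theorem Az_X (i : Fin 2) : (X i : Pol k) ∈ Az k δ δ := isWeightedHomogeneous_X _ _ _

theorem Az_mul {s t : ℤ} {a b : Pol k} (ha : a ∈ Az k δ s) (hb : b ∈ Az k δ t) :
    a * b ∈ Az k δ (s + t) := IsWeightedHomogeneous.mul ha hb

theorem Az_X_pow (i : Fin 2) (M : ℕ) : (X i ^ M : Pol k) ∈ Az k δ (M * δ) := by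
  induction M with
  | zero => simpa using Az_one
  | succ M ih =>
    rw [pow_succ]
    have := Az_mul ih (Az_X i)
    convert this using 2
    push_cast; ring

theorem Az_totalDegree {t : ℤ} {a : Pol k} (ha : a ∈ Az k δ t) (h0 : a ≠ 0) :
    (δ : ℤ) * a.totalDegree = t := by
  obtain ⟨d, hd, hda⟩ := Finset.exists_mem_eq_sup a.support (support_nonempty.2 h0)
    (fun s => s.sum fun _ e => e)
  rw [mem_Az] at ha
  have := ha d (by simpa using hd)
  have e : a.totalDegree = d.degree := hda
  rw [e, ← this]; ring

theorem Az_div {t : ℤ} {a c : Pol k} (s : Fin 2 →₀ ℕ) (h : a = monomial s 1 * c) (ha : a ∈ Az k δ t) :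
    c ∈ Az k δ (t - s.degree * δ) := by
  rw [mem_Az] at ha ⊢
  intro d hd
  have h1 : coeff (s + d) a = coeff d c := by
    rw [h, coeff_monomial_mul, one_mul]
  have := ha (s + d) (by rw [h1]; exact hd)
  rw [map_add] at this
  push_cast at this
  linarith

theorem Az_li (n : ℕ) : ∃ v : Fin (n + 1) → Pol k, LinearIndependent k v ∧
    ∀ i, v i ∈ Az k δ (n * δ) := by
  refine ⟨fun i => basisMonomials (Fin 2) k (Finsupp.single 0 (i : ℕ) + Finsupp.single 1 (n - i)),
    ?_, ?_⟩
  · refine (MvPolynomial.basisMonomials (Fin 2) k).linearIndependent.comp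
      (fun i : Fin (n + 1) => Finsupp.single (0 : Fin 2) (i : ℕ) + Finsupp.single 1 (n - i)) ?_
    intro i j hij
    have := DFunLike.congr_fun hij 0
    simp at this
    exact Fin.ext this
  · intro i
    rw [mem_Az]
    intro d hd
    simp only [coe_basisMonomials] at hd
    rw [coeff_monomial] at hd
    split_ifs at hd with h
    · rw [← h, map_add, Finsupp.degree_single, Finsupp.degree_single]
      congr 2
      have := i.2
      omega
    · exact absurd rfl hd

end Az

/-- Determinant homogeneity. -/
theorem prod_mem_gr {S : Type*} [CommRing S] (G : ℤ → AddSubgroup S) (h1 : (1 : S) ∈ G 0)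
    (hm : ∀ i j a b, a ∈ G i → b ∈ G j → a * b ∈ G (i + j)) {σ : Type*} (s : Finset σ)
    (f : σ → S) (d : σ → ℤ) (h : ∀ i ∈ s, f i ∈ G (d i)) : ∏ i ∈ s, f i ∈ G (∑ i ∈ s, d i) := by
  classical
  induction s using Finset.induction_on with
  | empty => simpa using h1
  | insert a s ha ih =>
    rw [Finset.prod_insert ha, Finset.sum_insert ha]
    exact hm _ _ _ _ (h a (by simp)) (ih fun i hi => h i (by simp [hi]))

theorem det_mem_gr {S : Type*} [CommRing S] (G : ℤ → AddSubgroup S) (h1 : (1 : S) ∈ G 0)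
    (hm : ∀ i j a b, a ∈ G i → b ∈ G j → a * b ∈ G (i + j)) {σ : Type*} [Fintype σ] [DecidableEq σ]
    (X : Matrix σ σ S) (r w : σ → ℤ) (h : ∀ i j, X i j ∈ G (r i - w j)) :
    X.det ∈ G (∑ i, r i - ∑ i, w i) := by
  rw [Matrix.det_apply]
  apply AddSubgroup.sum_mem
  intro τ _
  have := prod_mem_gr G h1 hm Finset.univ (fun i => X (τ i) i) (fun i => r (τ i) - w i)
    (fun i _ => h _ _)
  rw [Finset.sum_sub_distrib, Equiv.sum_comp τ r] at this
  rcases Int.units_eq_one_or (Equiv.Perm.sign τ) with h | h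
  · rw [h, one_smul]; exact this
  · rw [h, Units.neg_smul, one_smul]; exact AddSubgroup.neg_mem _ this

/-- The set-up: a graded domain inside its fraction field with graded Noether normalization. -/
structure Setup (k K0 K : Type*) [Field k] [Field K0] [Field K] [Algebra (Pol k) K0]
    [Algebra K0 K] [Algebra (Pol k) K] [Algebra k K] where
  g : ℤ → Submodule k K
  g_neg : ∀ j < 0, g j = ⊥
  one_mem : 1 ∈ g 0
  mul_mem : ∀ i j a b, a ∈ g i → b ∈ g j → a * b ∈ g (i + j)
  indep : iSupIndep g
  δ : ℕ
  δ_pos : 0 < δ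
  x_mem : algebraMap (Pol k) K (X 0) ∈ g δ
  y_mem : algebraMap (Pol k) K (X 1) ∈ g δ
  l : K
  l_ne : l ≠ 0
  l_mem : l ∈ g 1
  integral : ∀ i, ∀ a ∈ g i, IsIntegral (Pol k) a
  fin : ∀ i, FiniteDimensional k (g i)
  e : Fin (Module.finrank K0 K) → K
  ε : Fin (Module.finrank K0 K) → ℤ
  e_mem : ∀ i, e i ∈ g (ε i)
  e_indep : LinearIndependent K0 e
  b : Pol k
  b_ne : b ≠ 0
  b0 : ℤ
  b_hom : b ∈ Az k δ b0
  FH : ∀ t, ∀ r ∈ g t, ∃ a : Fin (Module.finrank K0 K) → Pol k,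
    algebraMap (Pol k) K b * r = ∑ l, algebraMap (Pol k) K (a l) * e l ∧
    ∀ l, a l ∈ Az k δ (t + b0 - ε l)

namespace Setup
variable {k K0 K : Type*} [Field k] [Field K0] [Field K] [Algebra (Pol k) K0]
  [IsFractionRing (Pol k) K0] [Algebra K0 K] [FiniteDimensional K0 K] [Algebra (Pol k) K]
  [IsScalarTower (Pol k) K0 K] [Algebra k K] [IsScalarTower k (Pol k) K] (S : Setup k K0 K)

local notation "D" => Module.finrank K0 K

theorem alg_inj (k K0 K : Type*) [Field k] [Field K0] [Field K] [Algebra (Pol k) K0]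
  [IsFractionRing (Pol k) K0] [Algebra K0 K] [Algebra (Pol k) K]
  [IsScalarTower (Pol k) K0 K] : Function.Injective (algebraMap (Pol k) K) := by
  rw [IsScalarTower.algebraMap_eq (Pol k) K0 K]
  exact (algebraMap K0 K).injective.comp (IsFractionRing.injective (Pol k) K0)

theorem alg_ne (k K0 K : Type*) [Field k] [Field K0] [Field K] [Algebra (Pol k) K0]
  [IsFractionRing (Pol k) K0] [Algebra K0 K] [Algebra (Pol k) K]
  [IsScalarTower (Pol k) K0 K] {a : Pol k} (h : a ≠ 0) : algebraMap (Pol k) K a ≠ 0 :=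
  fun h0 => h (alg_inj k K0 K (by rw [h0, map_zero]))

theorem Az_mem {t : ℤ} {a : Pol k} (ha : a ∈ Az k S.δ t) : algebraMap (Pol k) K a ∈ S.g t := by
  have hx : ∀ i : Fin 2, ∀ n : ℕ, algebraMap (Pol k) K (X i ^ n) ∈ S.g (n * S.δ) := by
    intro i n
    induction n with
    | zero => simpa using S.one_mem
    | succ n ih =>
      rw [pow_succ, map_mul]
      have hi : algebraMap (Pol k) K (X i) ∈ S.g S.δ := by
        fin_cases i
        · exact S.x_mem
        · exact S.y_mem
      have := S.mul_mem _ _ _ _ ih hi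
      convert this using 2
      push_cast; ring
  rw [mem_Az] at ha
  rw [a.as_sum, map_sum]
  apply Submodule.sum_mem
  intro d hd
  have h1 := ha d (by simpa using hd)
  have h2 : monomial d (coeff d a) = coeff d a • (X 0 ^ d 0 * X 1 ^ d 1 : Pol k) := by
    rw [monomial_eq, Finsupp.prod_fintype _ _ (by simp), Fin.prod_univ_two, smul_eq_C_mul]
  have h3 : algebraMap (Pol k) K (coeff d a • (X 0 ^ d 0 * X 1 ^ d 1 : Pol k)) =
      coeff d a • algebraMap (Pol k) K (X 0 ^ d 0 * X 1 ^ d 1 : Pol k) := by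
    rw [Algebra.algebraMap_eq_smul_one, Algebra.algebraMap_eq_smul_one, smul_assoc]
  rw [h2, h3]
  apply Submodule.smul_mem
  rw [map_mul]
  have := S.mul_mem _ _ _ _ (hx 0 (d 0)) (hx 1 (d 1))
  convert this using 2
  rw [← h1, Finsupp.degree_eq_sum]
  simp; ring

theorem e_unique {a a' : Fin D → Pol k} (h : ∑ l, algebraMap (Pol k) K (a l) * S.e l =
    ∑ l, algebraMap (Pol k) K (a' l) * S.e l) : a = a' := by
  have h1 := (LinearIndependent.iff_fractionRing (R := Pol k) (K := K0)).2 S.e_indep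
  rw [Fintype.linearIndependent_iff] at h1
  ext1 l
  have := h1 (fun l => a l - a' l) (by
    simp only [Algebra.smul_def, map_sub, sub_mul, Finset.sum_sub_distrib, h, sub_self]) l
  exact sub_eq_zero.1 this

theorem b_hull (M : ℕ) (t : ℤ) (z : K) (h0 : algebraMap (Pol k) K (X 0 ^ M) * z ∈ S.g (t + M * S.δ))
    (h1 : algebraMap (Pol k) K (X 1 ^ M) * z ∈ S.g (t + M * S.δ)) :
    algebraMap (Pol k) K S.b * z ∈ S.g (t + S.b0) := by
  obtain ⟨a, ha, haz⟩ := S.FH _ _ h0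
  obtain ⟨a', ha', haz'⟩ := S.FH _ _ h1
  have heq : (fun l => X 1 ^ M * a l) = (fun l => X 0 ^ M * a' l) := by
    apply S.e_unique
    simp only [map_mul _ (X _ ^ M), mul_assoc, ← Finset.mul_sum]
    rw [← ha, ← ha']
    ring
  have hd : ∀ l, ∃ c, a l = X 0 ^ M * c := by
    intro l
    have h2 : (X 0 ^ M : Pol k) ∣ X 1 ^ M * a l := ⟨a' l, congrFun heq l⟩
    have h3 : ¬ (X 0 : Pol k) ∣ X 1 ^ M := by
      intro h
      have := X_prime.dvd_of_dvd_pow h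
      rw [X_dvd_X] at this
      simp at this
    exact X_prime.pow_dvd_of_dvd_mul_left M h3 h2
  choose c hc using hd
  have hcz : ∀ l, c l ∈ Az k S.δ (t + S.b0 - S.ε l) := by
    intro l
    have := Az_div (Finsupp.single 0 M) (by rw [hc l, X_pow_eq_monomial]) (haz l)
    convert this using 2
    rw [Finsupp.degree_single]; ring
  have hz : algebraMap (Pol k) K S.b * z = ∑ l, algebraMap (Pol k) K (c l) * S.e l := by
    apply mul_left_cancel₀ (alg_ne k K0 K (pow_ne_zero M (X_ne_zero (0 : Fin 2))))
    rw [mul_left_comm, ha, Finset.mul_sum]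
    refine Finset.sum_congr rfl fun l _ => ?_
    rw [hc l, map_mul]; ring
  rw [hz]
  apply Submodule.sum_mem
  intro l _
  have := S.mul_mem _ _ _ _ (S.Az_mem (hcz l)) (S.e_mem l)
  convert this using 2
  ring

/-- norm degrees -/
theorem norm_degree {t : ℤ} {z : K} (hz : z ∈ S.g t) (h0 : z ≠ 0) :
    (S.δ : ℤ) * (NA k K0 z).totalDegree = D * t := by
  have hint := S.integral t z hz
  choose a ha haz using fun i => S.FH (t + S.ε i) (z * S.e i) (S.mul_mem _ _ _ _ hz (S.e_mem i))
  let B : Module.Basis (Fin D) K0 K := basisOfLinearIndependentOfCardEqFinrank' S.e S.e_indep (by simp)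
  have hB : ∀ i, B i = S.e i := fun i => by simp [B]
  have hmat : Algebra.leftMulMatrix B (algebraMap (Pol k) K S.b * z) =
      (Matrix.of fun i j => algebraMap (Pol k) K0 (a j i)) := by
    ext i j
    rw [Algebra.leftMulMatrix_eq_repr_mul, Matrix.of_apply, hB, mul_assoc, ha]
    have : ∀ l, algebraMap (Pol k) K (a j l) * S.e l = (algebraMap (Pol k) K0 (a j l)) • B l := by
      intro l
      rw [hB, Algebra.smul_def, ← IsScalarTower.algebraMap_apply]
    simp only [this]
    rw [B.repr_sum_self]
  have hN : NA k K0 (algebraMap (Pol k) K S.b * z) = (Matrix.of fun i j => a j i).det := by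
    apply NA_eq
    rw [Algebra.norm_eq_matrix_det B, hmat, RingHom.map_det]
    rfl
  have hdet := det_mem_gr (fun t => (Az k S.δ t).toAddSubgroup) Az_one
    (fun i j a b ha hb => Az_mul ha hb) (Matrix.of fun i j => a j i)
    (fun i => - S.ε i) (fun j => - (t + S.ε j + S.b0)) (by
      intro i j
      have := haz j i
      show a j i ∈ Az k S.δ _
      convert this using 2
      ring)
  rw [← hN, NA_mul isIntegral_algebraMap hint, NA_algebraMap] at hdet
  have hNz := NA_ne_zero (K0 := K0) hint h0
  have hdeg := Az_totalDegree hdet (mul_ne_zero (pow_ne_zero _ S.b_ne) hNz)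
  rw [totalDegree_mul_of_isDomain (pow_ne_zero _ S.b_ne) hNz] at hdeg
  have hb : (S.b ^ D).totalDegree = D * S.b.totalDegree := by
    generalize D = n
    induction n with
    | zero => simp
    | succ n ih =>
      rw [pow_succ, totalDegree_mul_of_isDomain (pow_ne_zero _ S.b_ne) S.b_ne, ih]; ring
  have hb' := Az_totalDegree S.b_hom S.b_ne
  rw [hb] at hdeg
  push_cast at hdeg
  simp only [Finset.sum_neg_distrib, Finset.sum_add_distrib, Finset.sum_const, Finset.card_univ,
    Fintype.card_fin, nsmul_eq_mul] at hdeg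
  have : (S.δ : ℤ) * (D * S.b.totalDegree) = D * S.b0 := by rw [← hb']; ring
  linarith

end Setup
end HK

set_option linter.unusedSectionVars false
namespace HK
open MvPolynomial

section Hull
variable {k K0 K : Type*} [Field k] [Field K0] [Field K] [Algebra (Pol k) K0]
  [IsFractionRing (Pol k) K0] [Algebra K0 K] [FiniteDimensional K0 K] [Algebra (Pol k) K]
  [IsScalarTower (Pol k) K0 K] [Algebra k K] [IsScalarTower k (Pol k) K]

local notation "D" => Module.finrank K0 K

/-- Saturation of a graded family. -/
def hull {ι : Type*} (δ : ℕ) (P : ℤ → Submodule k (ι → K)) (t : ℤ) : Submodule k (ι → K) where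
  carrier := {v | ∃ M0 : ℕ, ∀ M : ℕ, M0 ≤ M → (X 0 ^ M : Pol k) • v ∈ P (t + M * δ) ∧
    (X 1 ^ M : Pol k) • v ∈ P (t + M * δ)}
  add_mem' := by
    rintro v w ⟨M0, h0⟩ ⟨M1, h1⟩
    refine ⟨max M0 M1, fun M hM => ?_⟩
    rw [smul_add, smul_add]
    exact ⟨Submodule.add_mem _ (h0 M (le_trans (le_max_left _ _) hM)).1
      (h1 M (le_trans (le_max_right _ _) hM)).1,
      Submodule.add_mem _ (h0 M (le_trans (le_max_left _ _) hM)).2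
      (h1 M (le_trans (le_max_right _ _) hM)).2⟩
  zero_mem' := ⟨0, fun M _ => by simp⟩
  smul_mem' := by
    rintro c v ⟨M0, h0⟩
    refine ⟨M0, fun M hM => ?_⟩
    have h : ∀ a : Pol k, a • c • v = c • a • v := fun a => smul_comm _ _ _
    rw [h, h]
    exact ⟨Submodule.smul_mem _ _ (h0 M hM).1, Submodule.smul_mem _ _ (h0 M hM).2⟩

theorem mem_hull {ι : Type*} {δ : ℕ} {P : ℤ → Submodule k (ι → K)} {t : ℤ} {v : ι → K} :
    v ∈ hull δ P t ↔ ∃ M0 : ℕ, ∀ M : ℕ, M0 ≤ M → (X 0 ^ M : Pol k) • v ∈ P (t + M * δ) ∧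
    (X 1 ^ M : Pol k) • v ∈ P (t + M * δ) := Iff.rfl

/-- Graded families of vectors. -/
structure Fam (S : Setup k K0 K) {ι : Type*} (w : ι → ℤ) (P : ℤ → Submodule k (ι → K)) : Prop where
  x_mem : ∀ t v, v ∈ P t → (X 0 : Pol k) • v ∈ P (t + S.δ)
  y_mem : ∀ t v, v ∈ P t → (X 1 : Pol k) • v ∈ P (t + S.δ)
  l_mem : ∀ t v, v ∈ P t → S.l • v ∈ P (t + 1)
  comp : ∀ t v, v ∈ P t → ∀ i, v i ∈ S.g (t - w i)

variable {S : Setup k K0 K} {ι : Type*} {w : ι → ℤ} {P : ℤ → Submodule k (ι → K)}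

theorem Fam.pow_mem (hP : Fam S w P) (M : ℕ) (t : ℤ) (v : ι → K) (hv : v ∈ P t) :
    (X 0 ^ M : Pol k) • v ∈ P (t + M * S.δ) ∧ (X 1 ^ M : Pol k) • v ∈ P (t + M * S.δ) := by
  induction M with
  | zero => simpa using hv
  | succ M ih =>
    have h1 := hP.x_mem _ _ ih.1
    have h2 := hP.y_mem _ _ ih.2
    rw [← mul_smul, ← pow_succ'] at h1 h2
    have : t + M * S.δ + S.δ = t + ((M + 1 : ℕ) : ℤ) * S.δ := by push_cast; ring
    rw [this] at h1 h2
    exact ⟨h1, h2⟩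

theorem Fam.lpow_mem (hP : Fam S w P) (M : ℕ) (t : ℤ) (v : ι → K) (hv : v ∈ P t) :
    S.l ^ M • v ∈ P (t + M) := by
  induction M with
  | zero => simpa using hv
  | succ M ih =>
    have h1 := hP.l_mem _ _ ih
    rw [← mul_smul, ← pow_succ'] at h1
    convert h1 using 2
    push_cast; ring

theorem Fam.le_hull (hP : Fam S w P) (t : ℤ) : P t ≤ hull S.δ P t :=
  fun v hv => ⟨0, fun M _ => hP.pow_mem M t v hv⟩

theorem Fam.b_mem (hP : Fam S w P) {t : ℤ} {v : ι → K} (hv : v ∈ hull S.δ P t) (i : ι) :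
    algebraMap (Pol k) K S.b * v i ∈ S.g (t - w i + S.b0) := by
  obtain ⟨M, hM⟩ := hv
  obtain ⟨h0, h1⟩ := hM M le_rfl
  apply S.b_hull M
  · have := hP.comp _ _ h0 i
    rw [Pi.smul_apply, Algebra.smul_def] at this
    convert this using 2; ring
  · have := hP.comp _ _ h1 i
    rw [Pi.smul_apply, Algebra.smul_def] at this
    convert this using 2; ring

/-- multiplication by b composed with coordinate -/
noncomputable def bcoord (S : Setup k K0 K) (i : ι) : (ι → K) →ₗ[k] K :=
  (LinearMap.mulLeft k (algebraMap (Pol k) K S.b)) ∘ₗ LinearMap.proj i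

theorem bcoord_apply (i : ι) (v : ι → K) : bcoord S i v = algebraMap (Pol k) K S.b * v i := rfl

theorem bcoord_inj (v : ι → K) (h : ∀ i, bcoord S i v = 0) : v = 0 := by
  ext i
  have := h i
  rw [bcoord_apply] at this
  exact (mul_eq_zero.1 this).resolve_left (Setup.alg_ne k K0 K S.b_ne)

theorem Fam.hull_S2 [Finite ι] (hP : Fam S w P) : IsS2 (S.δ : ℤ) (hull S.δ P) where
  x_mem := by
    rintro m v ⟨M0, h⟩
    refine ⟨M0, fun M hM => ?_⟩
    have := h M hM
    have h1 := hP.x_mem _ _ this.1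
    have h2 := hP.x_mem _ _ this.2
    rw [smul_comm] at h1 h2
    have e : m + M * S.δ + S.δ = m + S.δ + M * S.δ := by ring
    rw [e] at h1 h2
    exact ⟨h1, h2⟩
  y_mem := by
    rintro m v ⟨M0, h⟩
    refine ⟨M0, fun M hM => ?_⟩
    have := h M hM
    have h1 := hP.y_mem _ _ this.1
    have h2 := hP.y_mem _ _ this.2
    rw [smul_comm] at h1 h2
    have e : m + M * S.δ + S.δ = m + S.δ + M * S.δ := by ring
    rw [e] at h1 h2
    exact ⟨h1, h2⟩
  s2 := by
    rintro m v v' ⟨M0, h⟩ ⟨M1, h'⟩ hvv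
    have hx : algebraMap (Pol k) K (X 0) ≠ 0 := Setup.alg_ne k K0 K (X_ne_zero _)
    have hu : v = (X 0 : Pol k) • ((algebraMap (Pol k) K (X 0))⁻¹ • v) := by
      rw [← algebraMap_smul K (X 0 : Pol k), smul_smul, mul_inv_cancel₀ hx, one_smul]
    refine ⟨_, ?_, hu⟩
    set u := ((algebraMap (Pol k) K (X 0))⁻¹ • v) with hudef
    have hu' : v' = (X 1 : Pol k) • u := by
      have h3 : (X 0 : Pol k) • v' = (X 0 : Pol k) • (X 1 : Pol k) • u := by
        rw [← hvv, smul_comm, ← hu]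
      rw [← algebraMap_smul K (X 0 : Pol k) v', ← algebraMap_smul K (X 0 : Pol k) (_ • u)] at h3
      exact smul_right_injective _ hx h3
    refine ⟨max M0 M1 + 1, fun M hM => ?_⟩
    obtain ⟨M', rfl⟩ : ∃ M', M = M' + 1 := ⟨M - 1, by omega⟩
    have e : m - S.δ + ((M' + 1 : ℕ) : ℤ) * S.δ = m + M' * S.δ := by push_cast; ring
    rw [e, pow_succ, mul_smul, ← hu, pow_succ, mul_smul, ← hu']
    exact ⟨(h M' (by omega)).1, (h' M' (by omega)).2⟩
  indep := by
    rw [iSupIndep_def]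
    intro t
    rw [Submodule.disjoint_def]
    intro v hv hv'
    apply bcoord_inj (S := S)
    intro i
    have h1 := hP.b_mem hv i
    have h2 : (⨆ j, ⨆ (_ : j ≠ t), hull S.δ P j) ≤
        (⨆ j, ⨆ (_ : j ≠ t - w i + S.b0), S.g j).comap (bcoord S i) := by
      refine iSup₂_le fun j hj u hu => ?_
      have h3 := hP.b_mem hu i
      have : j - w i + S.b0 ≠ t - w i + S.b0 := by
        intro h; apply hj; linarith
      exact (le_iSup₂_of_le (f := fun j (_ : j ≠ t - w i + S.b0) => S.g j) _ this le_rfl) h3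
    exact (Submodule.disjoint_def.1 (iSupIndep_def.1 S.indep (t - w i + S.b0))) _ h1 (h2 hv')
  bdd := by
    have := Fintype.ofFinite ι
    refine ⟨- ∑ i, |w i| - |S.b0|, fun m hm => ?_⟩
    rw [eq_bot_iff]
    intro v hv
    apply bcoord_inj (S := S)
    intro i
    have h1 := hP.b_mem hv i
    have h2 : |w i| ≤ ∑ i, |w i| := Finset.single_le_sum (f := fun i => |w i|) (fun i _ => abs_nonneg _) (Finset.mem_univ i)
    have h3 := neg_le_abs (w i)
    have h4 := le_abs_self S.b0
    rw [S.g_neg _ (by linarith)] at h1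
    exact h1
  fin := by
    intro m
    have := S.fin
    have : ∀ i, FiniteDimensional k (S.g (m - w i + S.b0)) := fun i => S.fin _
    let φ : hull S.δ P m →ₗ[k] (∀ i, S.g (m - w i + S.b0)) :=
      LinearMap.pi fun i => LinearMap.codRestrict _ (bcoord S i ∘ₗ (hull S.δ P m).subtype)
        (fun v => hP.b_mem v.2 i)
    apply Module.Finite.of_injective φ
    rw [← LinearMap.ker_eq_bot, LinearMap.ker_eq_bot']
    intro v hv
    apply Subtype.ext
    apply bcoord_inj (S := S)
    intro i
    exact congrArg Subtype.val (congrFun hv i)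

theorem Fam.fin [Finite ι] (hP : Fam S w P) (t : ℤ) : FiniteDimensional k (P t) := by
  have := hP.hull_S2.fin t
  exact Submodule.finiteDimensional_of_le (hP.le_hull t)

theorem Fam.MU [Finite ι] (hP : Fam S w P) (W : Submodule K (ι → K)) (hW : ∀ t, P t ≤ W.restrictScalars k)
    (t0 : ℤ) (ht0 : UU K P t0 = W) :
    ∃ (v : Fin (Module.finrank K W) → (ι → K)) (n : Fin (Module.finrank K W) → ℤ),
      LinearIndependent K v ∧ (∀ i, v i ∈ hull S.δ P (n i)) ∧ Submodule.span K (Set.range v) = W ∧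
      (∀ t, UU K P t = W → ∀ i, n i ≤ t) ∧
      ∀ t : ℤ, (S.δ : ℤ) ^ 2 * (Module.finrank k (P t) : ℤ) ≤ D * ∑ i, max (t + 2 * S.δ - n i) 0 := by
  have hW' : ∀ t, UU K (hull S.δ P) t ≤ W := by
    intro t
    unfold UU
    rw [Submodule.span_le]
    intro v hv
    simp only [Set.mem_iUnion] at hv
    obtain ⟨s, _, M, hM⟩ := hv
    have h1 := hW _ (hM M le_rfl).1
    rw [Submodule.restrictScalars_mem, ← algebraMap_smul K (X 0 ^ M : Pol k)] at h1
    exact (Submodule.smul_mem_iff _ (Setup.alg_ne k K0 K (pow_ne_zero _ (X_ne_zero _)))).1 h1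
  have hU : ∀ t, UU K P t = W → UU K (hull S.δ P) t = W := by
    intro t ht
    apply le_antisymm (hW' t)
    rw [← ht]
    apply Submodule.span_mono
    intro v hv
    simp only [Set.mem_iUnion] at hv ⊢
    obtain ⟨s, hs, h⟩ := hv
    exact ⟨s, hs, hP.le_hull s h⟩
  have : Module.IsTorsionFree (Pol k) K := by
    rw [Module.isTorsionFree_iff_algebraMap_injective]
    exact Setup.alg_inj k K0 K
  obtain ⟨v, n, h1, h2, h3, h4, h5⟩ := hP.hull_S2.MU (K0 := K0) S.δ_pos W hW' t0 (hU t0 ht0)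
  refine ⟨v, n, h1, h2, h3, fun t ht => h4 t (hU t ht), fun t => ?_⟩
  refine le_trans ?_ (h5 t)
  rw [pow_two, mul_assoc]
  apply mul_le_mul_of_nonneg_left _ (by positivity)
  have h6 : ∀ i ∈ Finset.range S.δ, (Module.finrank k (P t) : ℤ) ≤ Module.finrank k (hull S.δ P (t + i)) := by
    intro i _
    have := hP.hull_S2.fin (t + i)
    let φ : P t →ₗ[k] hull S.δ P (t + i) :=
      LinearMap.codRestrict _ ((LinearMap.lsmul K (ι → K) (S.l ^ i)).restrictScalars k ∘ₗ (P t).subtype)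
        (fun v => hP.le_hull _ (hP.lpow_mem i t v.1 v.2))
    have : Function.Injective φ := by
      intro a b hab
      apply Subtype.ext
      have := congrArg Subtype.val hab
      exact smul_right_injective _ (pow_ne_zero i S.l_ne) this
    exact_mod_cast LinearMap.finrank_le_finrank_of_injective this
  have := Finset.sum_le_sum h6
  simpa using this

end Hull
end HK

set_option linter.unusedSectionVars false
namespace HK
open MvPolynomial

theorem mem_UU' {k K E : Type*} [Field k] [Field K] [AddCommGroup E] [Module k E] [Module K E]
    {M : ℤ → Submodule k E} {t s : ℤ} (h : s ≤ t) {v : E} (hv : v ∈ M s) : v ∈ UU K M t :=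
  Submodule.subset_span (by simp only [Set.mem_iUnion]; exact ⟨s, h, hv⟩)

namespace Setup
variable {k K0 K : Type*} [Field k] [Field K0] [Field K] [Algebra (Pol k) K0]
  [IsFractionRing (Pol k) K0] [Algebra K0 K] [FiniteDimensional K0 K] [Algebra (Pol k) K]
  [IsScalarTower (Pol k) K0 K] [Algebra k K] [IsScalarTower k (Pol k) K] (S : Setup k K0 K)

local notation "D" => Module.finrank K0 K

theorem Az_fin (t : ℤ) : FiniteDimensional k (Az k S.δ t) := by
  have := S.fin t
  let φ : Az k S.δ t →ₗ[k] S.g t :=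
    LinearMap.codRestrict _ ((IsScalarTower.toAlgHom k (Pol k) K).toLinearMap ∘ₗ (Az k S.δ t).subtype)
      (fun v => S.Az_mem v.2)
  apply Module.Finite.of_injective φ
  intro a b hab
  apply Subtype.ext
  exact alg_inj k K0 K (congrArg Subtype.val hab)

theorem h_ge (t : ℤ) : ∑ l, Module.finrank k (Az k S.δ (t - S.ε l)) ≤ Module.finrank k (S.g t) := by
  have := S.fin t
  have := S.Az_fin
  rw [← Module.finrank_pi_fintype (R := k) (M := fun l => Az k S.δ (t - S.ε l))]
  let ψ : (∀ l, Az k S.δ (t - S.ε l)) →ₗ[k] K :=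
    ∑ l, (LinearMap.mulRight k (S.e l)) ∘ₗ (IsScalarTower.toAlgHom k (Pol k) K).toLinearMap ∘ₗ
      (Az k S.δ (t - S.ε l)).subtype ∘ₗ LinearMap.proj l
  have hψ : ∀ a, ψ a = ∑ l, algebraMap (Pol k) K (a l) * S.e l := by
    intro a
    simp [ψ]
  let φ : (∀ l, Az k S.δ (t - S.ε l)) →ₗ[k] S.g t := LinearMap.codRestrict _ ψ (by
    intro a
    rw [hψ]
    apply Submodule.sum_mem
    intro l _
    have := S.mul_mem _ _ _ _ (S.Az_mem (a l).2) (S.e_mem l)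
    convert this using 2
    ring)
  have hinj : Function.Injective φ := by
    intro a b hab
    have h1 : ψ a = ψ b := congrArg Subtype.val hab
    rw [hψ, hψ] at h1
    have := S.e_unique h1
    ext1 l
    exact Subtype.ext (congrFun this l)
  exact LinearMap.finrank_le_finrank_of_injective hinj

theorem h_mono (t : ℤ) (i : ℕ) : Module.finrank k (S.g (t - i)) ≤ Module.finrank k (S.g t) := by
  have := S.fin t
  have hl : ∀ i : ℕ, S.l ^ i ∈ S.g i := by
    intro i
    induction i with
    | zero => simpa using S.one_mem
    | succ i ih =>
      rw [pow_succ]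
      exact_mod_cast S.mul_mem _ _ _ _ ih S.l_mem
  let φ : S.g (t - i) →ₗ[k] S.g t := LinearMap.codRestrict _
    (LinearMap.mulRight k (S.l ^ i) ∘ₗ (S.g (t - i)).subtype) (by
      intro a
      have := S.mul_mem _ _ _ _ a.2 (hl i)
      rw [sub_add_cancel] at this
      exact this)
  have hinj : Function.Injective φ := by
    intro a b hab
    apply Subtype.ext
    exact mul_right_cancel₀ (pow_ne_zero i S.l_ne) (congrArg Subtype.val hab)
  exact LinearMap.finrank_le_finrank_of_injective hinj

theorem Az_sum (t : ℤ) : t ≤ S.δ * ∑ i ∈ Finset.range S.δ, (Module.finrank k (Az k S.δ (t - i)) : ℤ) := by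
  rcases lt_or_ge t 0 with h | h
  · refine le_trans h.le (by positivity)
  obtain ⟨T, rfl⟩ := Int.eq_ofNat_of_zero_le h
  have hδ := S.δ_pos
  have h1 : (Module.finrank k (Az k S.δ (T - (T % S.δ : ℕ))) : ℤ) ≤
    ∑ i ∈ Finset.range S.δ, (Module.finrank k (Az k S.δ (T - i)) : ℤ) :=
    Finset.single_le_sum (f := fun i : ℕ => (Module.finrank k (Az k S.δ (T - i)) : ℤ))
      (fun i _ => by positivity) (Finset.mem_range.2 (Nat.mod_lt T hδ))
  have e : (T : ℤ) - (T % S.δ : ℕ) = ((T / S.δ : ℕ) : ℤ) * S.δ := by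
    have := Nat.mod_add_div T S.δ
    have h2 : ((T % S.δ : ℕ) : ℤ) + S.δ * (T / S.δ : ℕ) = T := by exact_mod_cast this
    linarith
  rw [e] at h1
  have h3 : (T / S.δ : ℕ) + 1 ≤ Module.finrank k (Az k S.δ ((T / S.δ : ℕ) * S.δ)) := by
    have := S.Az_fin ((T / S.δ : ℕ) * S.δ)
    obtain ⟨v, hv, hmem⟩ := Az_li (k := k) (δ := S.δ) (T / S.δ)
    have : LinearIndependent k (fun i => (⟨v i, hmem i⟩ : Az k S.δ ((T / S.δ : ℕ) * S.δ))) :=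
      LinearIndependent.of_comp (Az k S.δ _).subtype hv
    simpa using this.fintype_card_le_finrank
  have h4 : (T : ℤ) ≤ S.δ * ((T / S.δ : ℕ) + 1) := by
    exact_mod_cast (Nat.lt_mul_div_succ T hδ).le
  have h5 : (((T / S.δ : ℕ) : ℤ) + 1) ≤ Module.finrank k (Az k S.δ ((T / S.δ : ℕ) * S.δ)) := by exact_mod_cast h3
  refine h4.trans ?_
  apply mul_le_mul_of_nonneg_left _ (by positivity)
  exact h5.trans h1

theorem h_lower (t : ℤ) : D * t - ∑ l, S.ε l ≤ (S.δ : ℤ) ^ 2 * Module.finrank k (S.g t) := by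
  have h1 : ∑ i ∈ Finset.range S.δ, (∑ l, (Module.finrank k (Az k S.δ (t - S.ε l - i)) : ℤ)) ≤
      ∑ i ∈ Finset.range S.δ, (Module.finrank k (S.g t) : ℤ) := by
    refine Finset.sum_le_sum fun i _ => ?_
    have h2 := (S.h_ge (t - i)).trans (S.h_mono t i)
    have h3 : ∀ l, t - i - S.ε l = t - S.ε l - i := fun l => by ring
    rw [Finset.sum_congr rfl fun l _ => by rw [h3 l]] at h2
    exact_mod_cast h2
  rw [Finset.sum_comm] at h1
  simp only [Finset.sum_const, Finset.card_range, nsmul_eq_mul] at h1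
  have h4 := Finset.sum_le_sum fun l (_ : l ∈ Finset.univ) => S.Az_sum (t - S.ε l)
  rw [← Finset.mul_sum, Finset.sum_sub_distrib] at h4
  simp only [Finset.sum_const, Finset.card_univ, Fintype.card_fin, nsmul_eq_mul] at h4
  refine h4.trans ?_
  rw [pow_two, mul_assoc]
  exact mul_le_mul_of_nonneg_left h1 (by positivity)

theorem h_upper (t : ℤ) : (S.δ : ℤ) ^ 2 * Module.finrank k (S.g t) ≤ D * max (t + 2 * S.δ + S.b0) 0 := by
  let P : ℤ → Submodule k (Unit → K) := fun t => (S.g t).comap (LinearMap.proj ())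
  have hP : Fam S (fun _ : Unit => 0) P := by
    have hm : ∀ (t : ℤ) (d : ℤ) (a : K) (v : Unit → K), a ∈ S.g d → v ∈ P t → a • v ∈ P (t + d) := by
      intro t d a v ha hv
      have := S.mul_mem _ _ _ _ ha hv
      rw [add_comm] at this
      exact this
    refine ⟨?_, ?_, ?_, ?_⟩
    · intro t v hv
      rw [← algebraMap_smul K (X 0 : Pol k)]
      exact hm _ _ _ _ S.x_mem hv
    · intro t v hv
      rw [← algebraMap_smul K (X 1 : Pol k)]
      exact hm _ _ _ _ S.y_mem hv
    · intro t v hv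
      exact hm _ _ _ _ S.l_mem hv
    · intro t v hv i
      rw [sub_zero]
      exact hv
  obtain ⟨v, n, h1, h2, -, -, h5⟩ := hP.MU ⊤ (fun t => le_top) 0 (by
    rw [eq_top_iff]
    intro v _
    have h1 : (1 : Unit → K) ∈ UU K P 0 := mem_UU' (s := 0) le_rfl (S.one_mem)
    have : v = v () • (1 : Unit → K) := by ext; simp
    rw [this]
    exact Submodule.smul_mem _ _ h1)
  have hn : ∀ i, - S.b0 ≤ n i := by
    intro i
    by_contra! hcon
    have h3 := hP.b_mem (h2 i) ()
    rw [S.g_neg _ (by linarith)] at h3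
    apply h1.ne_zero i
    apply bcoord_inj (S := S)
    intro j
    exact h3
  have h6 : Module.finrank k (S.g t) = Module.finrank k (P t) := by
    have : P t = (S.g t).map (LinearEquiv.funUnique Unit k K).symm.toLinearMap := by
      ext v
      simp only [P, Submodule.mem_comap, Submodule.mem_map]
      constructor
      · intro hv
        exact ⟨_, hv, by ext; rfl⟩
      · rintro ⟨a, ha, rfl⟩
        exact ha
    rw [this]
    exact (LinearEquiv.finrank_map_eq _ _).symm
  rw [h6]
  refine (h5 t).trans ?_
  apply mul_le_mul_of_nonneg_left _ (by positivity)
  have h7 : ∀ i ∈ Finset.univ, max (t + 2 * S.δ - n i) 0 ≤ max (t + 2 * S.δ + S.b0) 0 := by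
    intro i _
    apply max_le_max _ le_rfl
    have := hn i
    linarith
  refine (Finset.sum_le_sum h7).trans ?_
  simp

theorem h_bound : ∃ C : ℤ, ∀ t, |(S.δ : ℤ) ^ 2 * Module.finrank k (S.g t) - D * max t 0| ≤ C := by
  refine ⟨|∑ l, S.ε l| + D * (2 * S.δ + |S.b0|), fun t => ?_⟩
  have hb := abs_nonneg S.b0
  have he := abs_nonneg (∑ l, S.ε l)
  have hD : (0 : ℤ) ≤ D := by positivity
  rw [abs_le]
  constructor
  · rcases le_or_gt t 0 with h | h
    · rw [max_eq_right h]
      have : (0 : ℤ) ≤ (S.δ : ℤ) ^ 2 * Module.finrank k (S.g t) := by positivity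
      have : (0 : ℤ) ≤ D * (2 * S.δ + |S.b0|) := by positivity
      linarith
    · rw [max_eq_left h.le]
      have h1 := S.h_lower t
      have : (0 : ℤ) ≤ D * (2 * S.δ + |S.b0|) := by positivity
      have := le_abs_self (∑ l, S.ε l)
      linarith
  · have h1 := S.h_upper t
    have h2 : max (t + 2 * S.δ + S.b0) 0 ≤ max t 0 + (2 * S.δ + |S.b0|) := by
      apply max_le
      · have := le_abs_self S.b0
        have := le_max_left t 0
        linarith
      · have := le_max_right t 0
        positivity
    have h3 := mul_le_mul_of_nonneg_left h2 hD
    rw [mul_add] at h3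
    linarith

end Setup
end HK

set_option linter.unusedSectionVars false
namespace HK
open MvPolynomial

section Mx
variable {K : Type*} [Field K] {r τ ι : Type*} [Fintype r] [Fintype τ] [Fintype ι] [DecidableEq r]
  [DecidableEq τ] [DecidableEq ι] (ε : r ⊕ τ ≃ ι)

/-- stacked matrix -/
def Mx (u : r → ι → K) (a : τ → ι → K) : Matrix (r ⊕ τ) (r ⊕ τ) K :=
  Matrix.of fun s s' => Sum.elim u a s (ε s')

theorem Mx_inl (u : r → ι → K) (a : τ → ι → K) (i : r) (s' : r ⊕ τ) :
    Mx ε u a (Sum.inl i) s' = u i (ε s') := rfl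

theorem Mx_inr (u : r → ι → K) (a : τ → ι → K) (s : τ) (s' : r ⊕ τ) :
    Mx ε u a (Sum.inr s) s' = a s (ε s') := rfl

theorem Mx_det_ne (u : r → ι → K) (a : τ → ι → K) (h : LinearIndependent K (Sum.elim u a)) :
    (Mx ε u a).det ≠ 0 := by
  rw [← isUnit_iff_ne_zero, ← Matrix.isUnit_iff_isUnit_det, ← Matrix.linearIndependent_rows_iff_isUnit]
  have := h.map' (LinearEquiv.funCongrLeft K K ε).toLinearMap (LinearEquiv.ker _)
  exact this

theorem Mx_comb (u v : r → ι → K) (a : τ → ι → K) (C : Matrix r r K)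
    (h : ∀ i, v i = ∑ j, C i j • u j) : (Mx ε v a).det = C.det * (Mx ε u a).det := by
  have : Mx ε v a = Matrix.fromBlocks C 0 0 1 * Mx ε u a := by
    ext s s'
    rw [Matrix.mul_apply, Fintype.sum_sum_type]
    rcases s with i | s
    · simp [Mx, h, Finset.sum_apply]
    · simp [Mx, Matrix.one_apply]
  rw [this, Matrix.det_mul, Matrix.det_fromBlocks_zero₁₂, Matrix.det_one, mul_one]

theorem Mx_expand (u : r → ι → K) (a : τ → ι → K) :
    (Mx ε u a).det = ∑ φ : τ → ι, (∏ s, a s (φ s)) * (Mx ε u (fun s => Pi.single (φ s) 1)).det := by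
  let F : MultilinearMap K (fun _ : r ⊕ τ => (r ⊕ τ → K)) K :=
    (Matrix.detRowAlternating (n := r ⊕ τ) (R := K)).toMultilinearMap
  let F2 : MultilinearMap K (fun _ : τ => (r ⊕ τ → K)) K :=
    (MultilinearMap.currySumEquiv F) (fun i s' => u i (ε s'))
  have hF : ∀ a : τ → ι → K, (Mx ε u a).det = F2 (fun s s' => a s (ε s')) := by
    intro a
    show Matrix.det _ = Matrix.det _
    congr 1
    ext s s'
    rcases s with i | s <;> rfl
  rw [hF]
  have h1 : (fun (s : τ) (s' : r ⊕ τ) => a s (ε s')) =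
      fun s => ∑ j : ι, a s j • (fun s' : r ⊕ τ => (Pi.single j 1 : ι → K) (ε s')) := by
    ext s s'
    simp [Finset.sum_apply, Pi.single_apply]
  rw [h1, MultilinearMap.map_sum]
  refine Finset.sum_congr rfl fun φ _ => ?_
  rw [MultilinearMap.map_smul_univ, hF, smul_eq_mul]

theorem Mx_pow (p : ℕ) [Fact p.Prime] [CharP K p] (e : ℕ) (u : r → ι → K) (φ : τ → ι) :
    (Mx ε (fun i j => u i j ^ p ^ e) (fun s => Pi.single (φ s) 1)).det =
      (Mx ε u (fun s => Pi.single (φ s) 1)).det ^ p ^ e := by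
  have h := RingHom.map_det (iterateFrobenius K p e) (Mx ε u (fun s => Pi.single (φ s) 1))
  rw [iterateFrobenius_def] at h
  rw [h]
  congr 1
  ext s s'
  rcases s with i | s
  · simp [Mx, iterateFrobenius_def]
  · simp only [Mx, Matrix.of_apply, Sum.elim_inr, RingHom.mapMatrix_apply, Matrix.map_apply, Pi.single_apply]
    split_ifs <;> simp

theorem Mx_cramer (u : r → ι → K) (a0 a : τ → ι → K)
    (ψ : τ → τ → K) (hψ : ∀ l, ∃ c : r → K, (Mx ε u a0).det • a l = ∑ i, c i • u i + ∑ s, ψ l s • a0 s) :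
    (Mx ε u a0).det ^ Fintype.card τ * (Mx ε u a).det = (Matrix.of ψ).det * (Mx ε u a0).det := by
  choose c hc using hψ
  have : Matrix.fromBlocks (1 : Matrix r r K) 0 0 ((Mx ε u a0).det • (1 : Matrix τ τ K)) * Mx ε u a =
      Matrix.fromBlocks (1 : Matrix r r K) 0 (Matrix.of c) (Matrix.of ψ) * Mx ε u a0 := by
    ext s s'
    rw [Matrix.mul_apply, Matrix.mul_apply, Fintype.sum_sum_type, Fintype.sum_sum_type]
    rcases s with i | s
    · simp [Mx]
    · have := congrFun (hc s) (ε s')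
      simp only [Pi.smul_apply, Pi.add_apply, Finset.sum_apply, smul_eq_mul] at this
      simp only [Matrix.fromBlocks_apply₂₁, Matrix.fromBlocks_apply₂₂, Matrix.of_apply, Matrix.smul_apply,
        Matrix.zero_apply, zero_mul, Finset.sum_const_zero, zero_add, Matrix.one_apply, smul_eq_mul,
        mul_ite, mul_one, mul_zero, ite_mul, Finset.sum_ite_eq, Finset.mem_univ, if_true]
      exact this
  have h2 := congrArg Matrix.det this
  rw [Matrix.det_mul, Matrix.det_mul, Matrix.det_fromBlocks_zero₁₂, Matrix.det_fromBlocks_zero₁₂,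
    Matrix.det_smul, Matrix.det_one, Matrix.det_one] at h2
  simpa using h2

/-- Cramer map -/
noncomputable def psi (u : r → ι → K) (a0 : τ → ι → K) : (ι → K) →ₗ[K] (τ → K) :=
  LinearMap.funLeft K K Sum.inr ∘ₗ (Matrix.cramer (Mx ε u a0).transpose) ∘ₗ LinearMap.funLeft K K ε

theorem psi_apply (u : r → ι → K) (a0 : τ → ι → K) (v : ι → K) (s : τ) :
    psi ε u a0 v s = (Mx ε u (Function.update a0 s v)).det := by
  show Matrix.cramer (Mx ε u a0).transpose (fun s' => v (ε s')) (Sum.inr s) = _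
  rw [Matrix.cramer_transpose_apply]
  congr 1
  ext s1 s2
  rw [Matrix.updateRow_apply]
  rcases s1 with i | s1
  · rw [if_neg (by simp), Mx_inl, Mx_inl]
  · rw [Mx_inr, Mx_inr]
    simp only [Sum.inr.injEq]
    split_ifs with h
    · subst h; rw [Function.update_self]
    · rw [Function.update_of_ne h]

theorem psi_spec (u : r → ι → K) (a0 : τ → ι → K) (v : ι → K) :
    ∃ c : r → K, (Mx ε u a0).det • v = ∑ i, c i • u i + ∑ s, psi ε u a0 v s • a0 s := by
  refine ⟨fun i => Matrix.cramer (Mx ε u a0).transpose (fun s' => v (ε s')) (Sum.inl i), ?_⟩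
  have h := Matrix.mulVec_cramer (Mx ε u a0).transpose (fun s' => v (ε s'))
  rw [Matrix.det_transpose] at h
  ext j
  obtain ⟨s', rfl⟩ := ε.surjective j
  have h1 := congrFun h s'
  rw [Matrix.mulVec, dotProduct, Fintype.sum_sum_type] at h1
  simp only [Pi.smul_apply, Pi.add_apply, Finset.sum_apply, smul_eq_mul] at h1 ⊢
  rw [← h1]
  simp only [Mx, Matrix.transpose_apply, Matrix.of_apply, Sum.elim_inl, Sum.elim_inr]
  congr 1
  · exact Finset.sum_congr rfl fun i _ => mul_comm _ _
  · exact Finset.sum_congr rfl fun i _ => mul_comm _ _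

theorem psi_self (u : r → ι → K) (a0 : τ → ι → K) (s : τ) :
    psi ε u a0 (a0 s) = Pi.single s (Mx ε u a0).det := by
  ext s'
  rw [psi_apply, Pi.single_apply]
  split_ifs with h
  · subst h; rw [Function.update_eq_self]
  · apply Matrix.det_zero_of_row_eq (i := Sum.inr s) (j := Sum.inr s')
    · simp [Ne.symm h]
    · ext x
      rw [Mx_inr, Mx_inr, Function.update_self, Function.update_of_ne (Ne.symm h)]

theorem psi_u (u : r → ι → K) (a0 : τ → ι → K) (i : r) : psi ε u a0 (u i) = 0 := by
  ext s'
  rw [psi_apply, Pi.zero_apply]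
  apply Matrix.det_zero_of_row_eq (i := Sum.inl i) (j := Sum.inr s')
  · simp
  · ext x
    rw [Mx_inr, Mx_inl, Function.update_self]

theorem psi_ker (u : r → ι → K) (a0 : τ → ι → K) (h0 : (Mx ε u a0).det ≠ 0) :
    LinearMap.ker (psi ε u a0) = Submodule.span K (Set.range u) := by
  apply le_antisymm
  · intro v hv
    obtain ⟨c, hc⟩ := psi_spec ε u a0 v
    rw [LinearMap.mem_ker.1 hv] at hc
    simp only [Pi.zero_apply, zero_smul, Finset.sum_const_zero, add_zero] at hc
    rw [← Submodule.smul_mem_iff _ h0, hc]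
    exact Submodule.sum_mem _ fun i _ => Submodule.smul_mem _ _ (Submodule.subset_span ⟨i, rfl⟩)
  · rw [Submodule.span_le]
    rintro _ ⟨i, rfl⟩
    exact psi_u ε u a0 i

/-- Extension to a basis by standard vectors. -/
theorem exists_ext {ρ : ℕ} (u : Fin ρ → ι → K) (hu : LinearIndependent K u) :
    ∃ (n : ℕ) (_ : Fin ρ ⊕ Fin n ≃ ι) (jj : Fin n → ι),
      LinearIndependent K (Sum.elim u (fun s => (Pi.single (jj s) 1 : ι → K))) := by
  have hs : LinearIndepOn K id (Set.range u) := hu.linearIndepOn_id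
  have hst : Set.range u ⊆ Set.range u ∪ Set.range (fun j : ι => (Pi.single j 1 : ι → K)) :=
    Set.subset_union_left
  set b := hs.extend hst with hb
  have hbi : LinearIndepOn K id b := hs.linearIndepOn_extend hst
  have hsub : Set.range u ⊆ b := hs.subset_extend hst
  have hbsub := hs.extend_subset hst
  have hspan : Submodule.span K b = ⊤ := by
    rw [eq_top_iff, hs.span_extend_eq_span hst]
    have h1 := (Pi.basisFun K ι).span_eq
    rw [← h1]
    apply Submodule.span_mono
    rintro _ ⟨j, rfl⟩
    right
    exact ⟨j, by simp⟩
  have hfin : b.Finite := hbi.setFinite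
  let T : Set (ι → K) := b \ Set.range u
  have hT : T.Finite := hfin.subset Set.sdiff_subset
  have : Fintype T := hT.fintype
  let en : Fin (Fintype.card T) ≃ T := (Fintype.equivFin T).symm
  have hjj : ∀ s, ∃ j : ι, (Pi.single j 1 : ι → K) = (en s : ι → K) := by
    intro s
    have h1 := (en s).2
    rcases hbsub h1.1 with h2 | h2
    · exact absurd h2 h1.2
    · exact h2
  choose jj hjj using hjj
  have hli : LinearIndependent K (Sum.elim u (fun s => (Pi.single (jj s) 1 : ι → K))) := by
    have h1 : LinearIndependent K (fun x : b => (x : ι → K)) := hbi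
    let f : Fin ρ ⊕ Fin (Fintype.card T) → b :=
      Sum.elim (fun i => ⟨u i, hsub ⟨i, rfl⟩⟩) (fun s => ⟨en s, (en s).2.1⟩)
    have hf : Function.Injective f := by
      apply Function.Injective.sumElim
      · intro i j h; exact hu.injective (congrArg Subtype.val h)
      · intro i j h
        exact en.injective (Subtype.ext (Subtype.mk.inj h))
      · intro i s h
        exact (en s).2.2 ⟨i, congrArg Subtype.val h⟩
    have h2 := h1.comp f hf
    convert h2 using 1
    ext1 x
    rcases x with i | s
    · rfl
    · exact hjj s
  have htop : ⊤ ≤ Submodule.span K (Set.range (Sum.elim u (fun s => (Pi.single (jj s) 1 : ι → K)))) := by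
    rw [← hspan]
    apply Submodule.span_mono
    intro v hv
    by_cases h : v ∈ Set.range u
    · obtain ⟨i, rfl⟩ := h
      exact ⟨Sum.inl i, rfl⟩
    · refine ⟨Sum.inr (en.symm ⟨v, hv, h⟩), ?_⟩
      simp [hjj]
  let B := Module.Basis.mk hli htop
  have hcard : Fintype.card (Fin ρ ⊕ Fin (Fintype.card T)) = Fintype.card ι := by
    rw [← Module.finrank_eq_card_basis B, Module.finrank_fintype_fun_eq_card]
  exact ⟨_, Fintype.equivOfCardEq hcard, jj, hli⟩

end Mx
end HK

set_option linter.unusedSectionVars false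
namespace HK
open MvPolynomial

section Rt
variable {k K0 K : Type*} [Field k] [Field K0] [Field K] [Algebra (Pol k) K0]
  [IsFractionRing (Pol k) K0] [Algebra K0 K] [FiniteDimensional K0 K] [Algebra (Pol k) K]
  [IsScalarTower (Pol k) K0 K] [Algebra k K] [IsScalarTower k (Pol k) K] (S : Setup k K0 K)

local notation "D" => Module.finrank K0 K

/-- graded free module piece -/
def Rt {ι : Type*} (w : ι → ℤ) (t : ℤ) : Submodule k (ι → K) :=
  ⨅ i, (S.g (t - w i)).comap (LinearMap.proj i)

variable {ι : Type*} {w : ι → ℤ} {t : ℤ}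

theorem mem_Rt {v : ι → K} : v ∈ Rt S w t ↔ ∀ i, v i ∈ S.g (t - w i) := by
  simp [Rt]

theorem Rt_smul {v : ι → K} {d : ℤ} {a : K} (ha : a ∈ S.g d) (hv : v ∈ Rt S w t) :
    a • v ∈ Rt S w (t + d) := by
  rw [mem_Rt] at hv ⊢
  intro i
  have := S.mul_mem _ _ _ _ ha (hv i)
  have e : d + (t - w i) = t + d - w i := by ring
  rw [e] at this
  exact this

theorem Fam_inter (W : Submodule K (ι → K)) : Fam S w (fun t => Rt S w t ⊓ W.restrictScalars k) where
  x_mem := by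
    rintro t v ⟨h1, h2⟩
    rw [← algebraMap_smul K (X 0 : Pol k)]
    exact ⟨Rt_smul S S.x_mem h1, W.smul_mem _ h2⟩
  y_mem := by
    rintro t v ⟨h1, h2⟩
    rw [← algebraMap_smul K (X 1 : Pol k)]
    exact ⟨Rt_smul S S.y_mem h1, W.smul_mem _ h2⟩
  l_mem := by
    rintro t v ⟨h1, h2⟩
    exact ⟨Rt_smul S S.l_mem h1, W.smul_mem _ h2⟩
  comp := by
    rintro t v ⟨h1, h2⟩
    exact (mem_Rt S).1 h1

theorem Rt_fin [Finite ι] : FiniteDimensional k (Rt S w t) := by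
  have := (Fam_inter S (w := w) ⊤).fin t
  have e : Rt S w t ⊓ (⊤ : Submodule K (ι → K)).restrictScalars k = Rt S w t := by simp
  rwa [e] at this

theorem Rt_finrank [Fintype ι] : Module.finrank k (Rt S w t) = ∑ i, Module.finrank k (S.g (t - w i)) := by
  have := S.fin
  rw [← Module.finrank_pi_fintype (R := k) (M := fun i => S.g (t - w i))]
  apply LinearEquiv.finrank_eq
  exact {
    toFun := fun v i => ⟨v.1 i, (mem_Rt S).1 v.2 i⟩
    map_add' := fun _ _ => rfl
    map_smul' := fun _ _ => rfl
    invFun := fun v => ⟨fun i => (v i).1, (mem_Rt S).2 fun i => (v i).2⟩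
    left_inv := fun _ => rfl
    right_inv := fun _ => rfl }

theorem single_mem_Rt [DecidableEq ι] (j : ι) : (Pi.single j 1 : ι → K) ∈ Rt S w (w j) := by
  rw [mem_Rt]
  intro i
  rw [Pi.single_apply]
  split_ifs with h
  · subst h; rw [sub_self]; exact S.one_mem
  · exact Submodule.zero_mem _

theorem Mx_deg {r τ : Type*} [Fintype r] [Fintype τ] [Fintype ι] [DecidableEq r]
    [DecidableEq τ] (ε : r ⊕ τ ≃ ι) (u : r → ι → K) (a : τ → ι → K)
    (m : r → ℤ) (m' : τ → ℤ) (hu : ∀ i, u i ∈ Rt S w (m i)) (ha : ∀ i, a i ∈ Rt S w (m' i)) :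
    (Mx ε u a).det ∈ S.g (∑ i, m i + ∑ i, m' i - ∑ i, w i) := by
  have h := det_mem_gr (fun t => (S.g t).toAddSubgroup) S.one_mem S.mul_mem (Mx ε u a)
    (Sum.elim m m') (fun s => w (ε s)) (by
      intro i j
      rcases i with i | i
      · exact (mem_Rt S).1 (hu i) _
      · exact (mem_Rt S).1 (ha i) _)
  rw [Fintype.sum_sum_type, Equiv.sum_comp ε w] at h
  exact h

/-- lower bound of dimension via independent vectors -/
theorem inter_lower [Finite ι] (W : Submodule K (ι → K)) {r : Type*} [Fintype r] (v : r → ι → K)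
    (n : r → ℤ) (hv : LinearIndependent K v) (hW : ∀ i, v i ∈ W) (hR : ∀ i, v i ∈ Rt S w (n i)) (t : ℤ) :
    ∑ i, Module.finrank k (S.g (t - n i)) ≤
      Module.finrank k (Rt S w t ⊓ W.restrictScalars k : Submodule k (ι → K)) := by
  have := S.fin
  have := (Fam_inter S (w := w) W).fin t
  rw [← Module.finrank_pi_fintype (R := k) (M := fun i => S.g (t - n i))]
  let ψ : (∀ i, S.g (t - n i)) →ₗ[k] (ι → K) :=
    ∑ i, ((LinearMap.toSpanSingleton K (ι → K) (v i)).restrictScalars k) ∘ₗ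
      (S.g (t - n i)).subtype ∘ₗ LinearMap.proj i
  have hψ : ∀ a, ψ a = ∑ i, (a i : K) • v i := by
    intro a
    simp [ψ]
  let φ : (∀ i, S.g (t - n i)) →ₗ[k] (Rt S w t ⊓ W.restrictScalars k : Submodule k (ι → K)) :=
    LinearMap.codRestrict _ ψ (by
      intro a
      rw [hψ]
      apply Submodule.sum_mem
      intro i _
      refine ⟨?_, W.smul_mem _ (hW i)⟩
      have := Rt_smul S (a i).2 (hR i)
      rw [add_sub_cancel] at this
      exact this)
  have hinj : Function.Injective φ := by
    intro a b hab
    have h1 : ψ a = ψ b := congrArg Subtype.val hab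
    rw [hψ, hψ] at h1
    ext1 i
    apply Subtype.ext
    exact Fintype.linearIndependent_iffₛ.1 hv _ _ h1 i
  exact LinearMap.finrank_le_finrank_of_injective hinj

end Rt
end HK

set_option linter.unusedSectionVars false
namespace HK
open MvPolynomial

section Pin
variable {k K0 K : Type*} [Field k] [Field K0] [Field K] [Algebra (Pol k) K0]
  [IsFractionRing (Pol k) K0] [Algebra K0 K] [FiniteDimensional K0 K] [Algebra (Pol k) K]
  [IsScalarTower (Pol k) K0 K] [Algebra k K] [IsScalarTower k (Pol k) K] (S : Setup k K0 K)
  {ι : Type*} [Fintype ι] [DecidableEq ι] {w : ι → ℤ} {m : ℤ}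
  (p : ℕ) [Fact p.Prime] [CharP K p]

local notation "D" => Module.finrank K0 K

theorem Setup.pow_mem {t : ℤ} {a : K} (ha : a ∈ S.g t) (n : ℕ) : a ^ n ∈ S.g (n * t) := by
  induction n with
  | zero => simpa using S.one_mem
  | succ n ih =>
    rw [pow_succ]
    have := S.mul_mem _ _ _ _ ih ha
    convert this using 2
    push_cast; ring

theorem Rt_pow {u : ι → K} (hu : u ∈ Rt S w m) (n : ℕ) :
    (fun j => u j ^ n) ∈ Rt S (fun j => n * w j) (n * m) := by
  rw [mem_Rt] at hu ⊢
  intro i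
  have := S.pow_mem (hu i) n
  rw [mul_sub] at this
  exact this

variable {ρ ν : ℕ} (ε : Fin ρ ⊕ Fin ν ≃ ι) (u : Fin ρ → ι → K) (jj : Fin ν → ι)

/-- the minors -/
def gphi (φ : Fin ν → ι) : K := (Mx ε u (fun s => (Pi.single (φ s) 1 : ι → K))).det

theorem gphi_mem (hu : ∀ i, u i ∈ Rt S w m) (φ : Fin ν → ι) :
    gphi ε u φ ∈ S.g (ρ * m + ∑ s, w (φ s) - ∑ i, w i) := by
  have := Mx_deg S (w := w) ε u (fun s => (Pi.single (φ s) 1 : ι → K)) (fun _ => m) (fun s => w (φ s))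
    hu (fun s => single_mem_Rt S _)
  simpa [gphi] using this

theorem pinD (hu : ∀ i, u i ∈ Rt S w m) (h0 : gphi ε u jj ≠ 0) (γ : Pol k) (hγ : γ ≠ 0)
    (T : Set K) (μ : T → Pol k) (hT : ∀ w ∈ T, w ∈ Submodule.span (Pol k) (Set.range (gphi ε u)))
    (hμ : ∀ i : T, NA k K0 (i : K) = γ * μ i) (hμ' : ∀ π, Prime π → ∃ i, ¬ π ∣ μ i)
    (e : ℕ) (V : Fin ρ → ι → K) (n : Fin ρ → ℤ) (hV : LinearIndependent K V)
    (hVs : ∀ i, V i ∈ Submodule.span K (Set.range fun i : Fin ρ => fun j => u i j ^ p ^ e))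
    (hVR : ∀ i, V i ∈ Rt S (fun j => ((p ^ e : ℕ) : ℤ) * w j) (n i)) :
    D * ((p ^ e : ℕ) * (ρ * m)) ≤ D * ∑ i, n i + S.δ * ((p ^ e : ℕ) * (γ.totalDegree : ℤ)) := by
  have hcoef : ∀ i, ∃ c : Fin ρ → K, ∑ j, c j • (fun j' => u j j' ^ p ^ e) = V i :=
    fun i => (Submodule.mem_span_range_iff_exists_fun K).1 (hVs i)
  choose C hC using hcoef
  have hCdet : (Matrix.of C).det ≠ 0 := by
    intro h
    obtain ⟨x, hx, hxC⟩ := Matrix.exists_vecMul_eq_zero_iff.2 h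
    apply hx
    ext i
    refine Fintype.linearIndependent_iff.1 hV x ?_ i
    have : ∀ i, x i • V i = ∑ j, (x i * C i j) • (fun j' => u j j' ^ p ^ e) := by
      intro i
      rw [← hC, Finset.smul_sum]
      exact Finset.sum_congr rfl fun j _ => by rw [smul_smul]
    rw [Finset.sum_congr rfl fun i _ => this i, Finset.sum_comm]
    apply Finset.sum_eq_zero
    intro j _
    rw [← Finset.sum_smul]
    have h2 := congrFun hxC j
    rw [Matrix.vecMul, dotProduct] at h2
    simp only [Matrix.of_apply, Pi.zero_apply] at h2
    rw [h2, zero_smul]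
  have hcomb : ∀ φ : Fin ν → ι, (Mx ε V (fun s => (Pi.single (φ s) 1 : ι → K))).det =
      (Matrix.of C).det * gphi ε u φ ^ p ^ e := by
    intro φ
    rw [Mx_comb ε (fun i : Fin ρ => fun j => u i j ^ p ^ e) V _ (Matrix.of C) (fun i => (hC i).symm),
      Mx_pow]
    rfl
  set z1 := (Mx ε V (fun s => (Pi.single (jj s) 1 : ι → K))).det with hz1
  set z2 := gphi ε u jj ^ p ^ e with hz2
  have hz2ne : z2 ≠ 0 := pow_ne_zero _ h0
  have hz1ne : z1 ≠ 0 := by rw [hz1, hcomb]; exact mul_ne_zero hCdet hz2ne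
  have hVdeg : ∀ φ : Fin ν → ι, (Mx ε V (fun s => (Pi.single (φ s) 1 : ι → K))).det ∈
      S.g (∑ i, n i + ∑ s, ((p ^ e : ℕ) : ℤ) * w (φ s) - ∑ j, ((p ^ e : ℕ) : ℤ) * w j) := fun φ =>
    Mx_deg S ε V _ n (fun s => ((p ^ e : ℕ) : ℤ) * w (φ s)) hVR
      (fun s => single_mem_Rt S (w := fun j => ((p ^ e : ℕ) : ℤ) * w j) _)
  have hz1g := hVdeg jj
  rw [← hz1] at hz1g
  have hz2g := S.pow_mem (gphi_mem S ε u hu jj) (p ^ e)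
  rw [← hz2] at hz2g
  have hi1 := S.integral _ _ hz1g
  have hi2 := S.integral _ _ hz2g
  have hgi : ∀ φ, IsIntegral (Pol k) (gphi ε u φ) := fun φ => S.integral _ _ (gphi_mem S ε u hu φ)
  have hdvd : NA k K0 z2 ∣ NA k K0 z1 * γ ^ p ^ e := by
    apply ufd_dvd μ hμ' (p ^ e) _ (NA_ne_zero hi2 hz2ne)
    intro i
    have hwi : IsIntegral (Pol k) (i : K) := by
      have := hT _ i.2
      refine Submodule.span_induction (p := fun x _ => IsIntegral (Pol k) x) ?_ ?_ ?_ ?_ this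
      · rintro _ ⟨φ, rfl⟩; exact hgi φ
      · exact isIntegral_zero
      · intro x y _ _ hx hy; exact hx.add hy
      · intro a x _ hx; rw [Algebra.smul_def]; exact isIntegral_algebraMap.mul hx
    obtain ⟨c, hc⟩ := (Submodule.mem_span_range_iff_exists_fun (Pol k)).1 (hT _ i.2)
    have hpow : (i : K) ^ p ^ e = ∑ φ, algebraMap (Pol k) K (c φ) ^ p ^ e * gphi ε u φ ^ p ^ e := by
      rw [← hc, sum_pow_char_pow]
      refine Finset.sum_congr rfl fun φ _ => ?_
      rw [Algebra.smul_def, mul_pow]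
    have hfac : z1 * (i : K) ^ p ^ e = z2 * ∑ φ, algebraMap (Pol k) K (c φ) ^ p ^ e *
        (Mx ε V (fun s => (Pi.single (φ s) 1 : ι → K))).det := by
      rw [hpow, Finset.mul_sum, Finset.mul_sum]
      refine Finset.sum_congr rfl fun φ _ => ?_
      rw [hcomb, hz1, hcomb]
      ring
    have h1 := NA_dvd (K0 := K0) hi2 _ (by
      apply IsIntegral.sum
      intro φ _
      exact (isIntegral_algebraMap.pow _).mul (S.integral _ _ (hVdeg φ))) hfac
    rw [NA_mul hi1 (hwi.pow _), NA_pow hwi, hμ, mul_pow] at h1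
    convert h1 using 1
    ring
  have hN1 := NA_ne_zero (K0 := K0) hi1 hz1ne
  have hdeg := totalDegree_le_of_dvd_of_isDomain hdvd (mul_ne_zero hN1 (pow_ne_zero _ hγ))
  rw [totalDegree_mul_of_isDomain hN1 (pow_ne_zero _ hγ)] at hdeg
  have hdeg2 := totalDegree_pow γ (p ^ e)
  have hd1 := S.norm_degree hz1g hz1ne
  have hd2 := S.norm_degree hz2g hz2ne
  rw [← Finset.mul_sum, ← Finset.mul_sum] at hd1
  have hdeg3 : ((NA k K0 z2).totalDegree : ℤ) ≤ (NA k K0 z1).totalDegree + (p ^ e : ℕ) * γ.totalDegree := by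
    exact_mod_cast hdeg.trans (by gcongr)
  have hdeg4 := mul_le_mul_of_nonneg_left hdeg3 (by positivity : (0 : ℤ) ≤ S.δ)
  rw [hd2, mul_add, hd1] at hdeg4
  linarith

end Pin
end HK

set_option linter.unusedSectionVars false
namespace HK
open MvPolynomial

theorem finrank_map_add_inf {k E F : Type*} [Field k] [AddCommGroup E] [Module k E] [AddCommGroup F]
    [Module k F] (f : E →ₗ[k] F) (V : Submodule k E) [FiniteDimensional k V] :
    Module.finrank k (V.map f) + Module.finrank k (V ⊓ LinearMap.ker f : Submodule k E) =
      Module.finrank k V := by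
  have h := LinearMap.finrank_range_add_finrank_ker (f.domRestrict V)
  rw [LinearMap.range_domRestrict] at h
  rw [← h]
  congr 1
  rw [← Submodule.map_comap_subtype, Submodule.finrank_map_subtype_eq]
  rfl

section Pin
variable {k K0 K : Type*} [Field k] [Field K0] [Field K] [Algebra (Pol k) K0]
  [IsFractionRing (Pol k) K0] [Algebra K0 K] [FiniteDimensional K0 K] [Algebra (Pol k) K]
  [IsScalarTower (Pol k) K0 K] [Algebra k K] [IsScalarTower k (Pol k) K] (S : Setup k K0 K)
  {ι : Type*} [Fintype ι] [DecidableEq ι] {w : ι → ℤ} {m : ℤ}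
  (p : ℕ) [Fact p.Prime] [CharP K p]

local notation "D" => Module.finrank K0 K

variable {ρ ν : ℕ} (ε : Fin ρ ⊕ Fin ν ≃ ι) (u : Fin ρ → ι → K) (jj : Fin ν → ι)

theorem Q_fam (hu : ∀ i, u i ∈ Rt S w m) :
    Fam S (fun s : Fin ν => -(ρ * m - ∑ j, w j + ∑ s' ∈ Finset.univ \ {s}, w (jj s')))
      (fun t => (Rt S w t).map ((psi ε u (fun s => (Pi.single (jj s) 1 : ι → K))).restrictScalars k)) where
  x_mem := by
    rintro t _ ⟨v, hv, rfl⟩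
    refine ⟨_, Rt_smul S S.x_mem hv, ?_⟩
    rw [← algebraMap_smul K (X 0 : Pol k)]
    simp
  y_mem := by
    rintro t _ ⟨v, hv, rfl⟩
    refine ⟨_, Rt_smul S S.y_mem hv, ?_⟩
    rw [← algebraMap_smul K (X 1 : Pol k)]
    simp
  l_mem := by
    rintro t _ ⟨v, hv, rfl⟩
    refine ⟨_, Rt_smul S S.l_mem hv, ?_⟩
    simp
  comp := by
    rintro t _ ⟨v, hv, rfl⟩ s
    rw [LinearMap.restrictScalars_apply, psi_apply]
    have := Mx_deg S (w := w) ε u (Function.update (fun s => (Pi.single (jj s) 1 : ι → K)) s v)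
      (fun _ => m) (Function.update (fun s => w (jj s)) s t) hu (by
        intro s'
        by_cases h : s' = s
        · subst h; simpa using hv
        · simp only [Function.update_of_ne h]
          exact single_mem_Rt S _)
    rw [Finset.sum_update_of_mem (Finset.mem_univ s)] at this
    convert this using 2
    simp; ring

theorem pinQ (hu : ∀ i, u i ∈ Rt S w m) (h0 : gphi ε u jj ≠ 0) (γ : Pol k) (hγ : γ ≠ 0)
    (hdv : ∀ (n : ℕ) (c : (Fin ν → ι) → K), (∀ φ, IsIntegral (Pol k) (c φ)) →
        γ ^ n ∣ NA k K0 (∑ φ, c φ * gphi ε u φ ^ n))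
    (e : ℕ) : ∃ o : Fin ν → ℤ,
      (∀ t : ℤ, (S.δ : ℤ) ^ 2 * (∑ i, (Module.finrank k (S.g (t - (p ^ e : ℕ) * w i)) : ℤ) -
        Module.finrank k (Rt S (fun j => ((p ^ e : ℕ) : ℤ) * w j) t ⊓
          (Submodule.span K (Set.range fun i : Fin ρ => fun j => u i j ^ p ^ e)).restrictScalars k :
            Submodule k (ι → K)))
        ≤ D * ∑ s, max (t + 2 * S.δ - o s) 0) ∧
      S.δ * ((p ^ e : ℕ) * (γ.totalDegree : ℤ)) ≤
        D * ((p ^ e : ℕ) * (ρ * m) + ∑ s, o s - ∑ j, (p ^ e : ℕ) * w j) := by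
  set w' : ι → ℤ := fun j => ((p ^ e : ℕ) : ℤ) * w j with hw'
  set u' : Fin ρ → ι → K := fun i => fun j => u i j ^ p ^ e with hu'
  set a0 : Fin ν → ι → K := fun s => (Pi.single (jj s) 1 : ι → K) with ha0
  set m' : ℤ := ((p ^ e : ℕ) : ℤ) * m with hm'
  have huR : ∀ i, u' i ∈ Rt S w' m' := fun i => Rt_pow S (hu i) (p ^ e)
  have hz2 : (Mx ε u' a0).det = gphi ε u jj ^ p ^ e := Mx_pow ε p e u jj
  have hz2ne : (Mx ε u' a0).det ≠ 0 := by rw [hz2]; exact pow_ne_zero _ h0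
  set Q : ℤ → Submodule k (Fin ν → K) := fun t => (Rt S w' t).map ((psi ε u' a0).restrictScalars k) with hQ
  have hF := Q_fam S (w := w') (m := m') ε u' jj huR
  have hUU : UU K Q (∑ j, |w' j|) = ⊤ := by
    rw [eq_top_iff, ← (Pi.basisFun K (Fin ν)).span_eq, Submodule.span_le]
    rintro _ ⟨s, rfl⟩
    rw [SetLike.mem_coe, ← Submodule.smul_mem_iff _ hz2ne]
    have h1 : w' (jj s) ≤ ∑ j, |w' j| := (le_abs_self _).trans
      (Finset.single_le_sum (f := fun j => |w' j|) (fun i _ => abs_nonneg _) (Finset.mem_univ _))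
    refine mem_UU' h1 ⟨a0 s, single_mem_Rt S _, ?_⟩
    rw [LinearMap.restrictScalars_apply, psi_self]
    ext s'
    simp [Pi.single_apply]
  have hMU := hF.MU ⊤ (fun t => le_top) _ hUU
  have hfr : Module.finrank K (⊤ : Submodule K (Fin ν → K)) = ν := by simp
  rw [hfr] at hMU
  obtain ⟨v, o, hvli, hvh, -, -, hdim⟩ := hMU
  refine ⟨o, fun t => ?_, ?_⟩
  · have := Rt_fin S (w := w') (t := t)
    have h1 := finrank_map_add_inf ((psi ε u' a0).restrictScalars k) (Rt S w' t)
    have h2 : LinearMap.ker ((psi ε u' a0).restrictScalars k) =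
        (Submodule.span K (Set.range u')).restrictScalars k := by
      rw [← psi_ker ε u' a0 hz2ne]
      rfl
    rw [h2, Rt_finrank] at h1
    have h3 := hdim t
    have h4 : (Module.finrank k (Q t) : ℤ) = ∑ i, (Module.finrank k (S.g (t - w' i)) : ℤ) -
        Module.finrank k (Rt S w' t ⊓ (Submodule.span K (Set.range u')).restrictScalars k :
            Submodule k (ι → K)) := by
      rw [eq_sub_iff_add_eq]
      exact_mod_cast h1
    rw [← h4]
    exact h3
  · choose M0 hM0 using fun l => (mem_hull.1 (hvh l))
    set M := ∑ l, M0 l with hM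
    have hMl : ∀ l, M0 l ≤ M := fun l => Finset.single_le_sum (f := M0) (fun _ _ => Nat.zero_le _) (Finset.mem_univ l)
    -- generic statement for both variables
    have key : ∀ c : Fin 2, ∃ Δ : K, Δ ∈ S.g (ρ * m' + ∑ s, (o s + M * S.δ) - ∑ j, w' j) ∧
        γ ^ p ^ e ∣ NA k K0 Δ ∧ (Mx ε u' a0).det ^ ν * Δ =
          algebraMap (Pol k) K (X c ^ M) ^ ν * (Matrix.of v).det * (Mx ε u' a0).det := by
      intro c
      have hc : ∀ l, ∃ a : ι → K, a ∈ Rt S w' (o l + M * S.δ) ∧ psi ε u' a0 a = (X c ^ M : Pol k) • v l := by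
        intro l
        have := hM0 l M (hMl l)
        fin_cases c
        · exact this.1
        · exact this.2
      choose a haR haψ using hc
      refine ⟨(Mx ε u' a).det, ?_, ?_, ?_⟩
      · have := Mx_deg S (w := w') ε u' a (fun _ => m') (fun s => o s + M * S.δ) huR haR
        simpa using this
      · have h1 := hdv (p ^ e) (fun φ => ∏ s, a s (φ s)) (fun φ => by
          apply IsIntegral.prod
          intro s _
          exact S.integral _ _ ((mem_Rt S).1 (haR s) _))
        rw [Mx_expand]
        have h2 : ∀ φ : Fin ν → ι, (Mx ε u' fun s => (Pi.single (φ s) 1 : ι → K)).det = gphi ε u φ ^ p ^ e :=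
          fun φ => Mx_pow ε p e u φ
        simp only [h2]
        exact h1
      · have h1 := Mx_cramer ε u' a0 a (fun l => psi ε u' a0 (a l)) (fun l => psi_spec ε u' a0 (a l))
        rw [Fintype.card_fin] at h1
        rw [h1]
        congr 1
        have h2 : (Matrix.of fun l => psi ε u' a0 (a l)) = algebraMap (Pol k) K (X c ^ M) • Matrix.of v := by
          ext l s
          simp only [Matrix.of_apply, Matrix.smul_apply, haψ, Pi.smul_apply]
          rw [Algebra.smul_def, smul_eq_mul]
        rw [h2, Matrix.det_smul, Fintype.card_fin]
    have hvdet : (Matrix.of v).det ≠ 0 := by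
      rw [← isUnit_iff_ne_zero, ← Matrix.isUnit_iff_isUnit_det, ← Matrix.linearIndependent_rows_iff_isUnit]
      exact hvli
    obtain ⟨Δ, hΔg, hΔd, hΔ⟩ := key 0
    obtain ⟨Δ', hΔg', hΔd', hΔ'⟩ := key 1
    have hx : algebraMap (Pol k) K (X 0 ^ M) ≠ 0 := Setup.alg_ne k K0 K (pow_ne_zero _ (X_ne_zero _))
    have hΔne : Δ ≠ 0 := by
      intro h
      rw [h, mul_zero] at hΔ
      exact mul_ne_zero (mul_ne_zero (pow_ne_zero _ hx) hvdet) hz2ne hΔ.symm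
    have hrel : algebraMap (Pol k) K ((X 1 ^ M) ^ ν) * Δ = algebraMap (Pol k) K ((X 0 ^ M) ^ ν) * Δ' := by
      apply mul_left_cancel₀ (pow_ne_zero ν hz2ne)
      rw [map_pow _ (X 1 ^ M) ν, map_pow _ (X 0 ^ M) ν]
      linear_combination (algebraMap (Pol k) K (X 1 ^ M)) ^ ν * hΔ - (algebraMap (Pol k) K (X 0 ^ M)) ^ ν * hΔ'
    have hi := S.integral _ _ hΔg
    have hi' := S.integral _ _ hΔg'
    have hN := congrArg (NA k K0) hrel
    rw [NA_mul isIntegral_algebraMap hi, NA_mul isIntegral_algebraMap hi', NA_algebraMap, NA_algebraMap,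
      ← pow_mul, ← pow_mul, ← pow_mul, ← pow_mul] at hN
    set r := M * (ν * D) with hr
    have hnd : ¬ (X 0 : Pol k) ∣ X 1 ^ r := by
      intro h
      have := X_prime.dvd_of_dvd_pow h
      rw [X_dvd_X] at this
      simp at this
    obtain ⟨c, hc⟩ := X_prime.pow_dvd_of_dvd_mul_left r hnd ⟨_, hN⟩
    have hc' : NA k K0 Δ' = X 1 ^ r * c := by
      apply mul_left_cancel₀ (pow_ne_zero r (X_ne_zero (R := k) (0 : Fin 2)))
      rw [← hN, hc]; ring
    have hγc : γ ^ p ^ e ∣ c := by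
      apply ufd_dvd (fun i : Fin 2 => (X i : Pol k)) _ r _ (pow_ne_zero _ hγ)
      · intro i
        fin_cases i
        · simpa [hc] using hΔd
        · simpa [hc'] using hΔd'
      · intro π hπ
        by_contra! hcon
        have h1 := (hcon 0)
        have h2 := (hcon 1)
        have h3 : Associated π (X 0) := (hπ.irreducible).associated_of_dvd X_prime.irreducible h1
        have h4 := (h3.dvd_iff_dvd_left).1 h2
        rw [X_dvd_X] at h4
        simp at h4
    have hNne := NA_ne_zero (K0 := K0) hi hΔne
    have hcne : c ≠ 0 := by
      rintro rfl
      rw [mul_zero] at hc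
      exact hNne hc
    have hdeg1 := S.norm_degree hΔg hΔne
    have hXr : (X 0 ^ r : Pol k).totalDegree = r := totalDegree_X_pow _ _
    rw [hc, totalDegree_mul_of_isDomain (pow_ne_zero _ (X_ne_zero _)) hcne, hXr] at hdeg1
    have hdeg2 := totalDegree_le_of_dvd_of_isDomain hγc hcne
    have hpow : ∀ n : ℕ, (γ ^ n).totalDegree = n * γ.totalDegree := by
      intro n
      induction n with
      | zero => simp
      | succ n ih =>
        rw [pow_succ, totalDegree_mul_of_isDomain (pow_ne_zero _ hγ) hγ, ih]; ring
    rw [hpow] at hdeg2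
    have hdeg3 : ((p ^ e : ℕ) : ℤ) * γ.totalDegree ≤ c.totalDegree := by exact_mod_cast hdeg2
    have hdeg4 := mul_le_mul_of_nonneg_left hdeg3 (by positivity : (0 : ℤ) ≤ S.δ)
    rw [Finset.sum_add_distrib, Finset.sum_const, Finset.card_univ, Fintype.card_fin, nsmul_eq_mul] at hdeg1
    rw [hr, hm'] at hdeg1
    push_cast at hdeg1 hdeg4 ⊢
    linarith

end Pin
end HK

set_option linter.unusedSectionVars false
namespace HK
open MvPolynomial

section Pin
variable {k K0 K : Type*} [Field k] [Field K0] [Field K] [Algebra (Pol k) K0]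
  [IsFractionRing (Pol k) K0] [Algebra K0 K] [FiniteDimensional K0 K] [Algebra (Pol k) K]
  [IsScalarTower (Pol k) K0 K] [Algebra k K] [IsScalarTower k (Pol k) K] (S : Setup k K0 K)
  {ι : Type*} [Fintype ι] [DecidableEq ι] {w : ι → ℤ} {m : ℤ}
  (p : ℕ) [Fact p.Prime] [CharP K p]

local notation "D" => Module.finrank K0 K

theorem frob_li {ρ ν : ℕ} (ε : Fin ρ ⊕ Fin ν ≃ ι) (u : Fin ρ → ι → K) (jj : Fin ν → ι)
    (h0 : gphi ε u jj ≠ 0) (e : ℕ) : LinearIndependent K (fun i : Fin ρ => fun j => u i j ^ p ^ e) := by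
  have h1 : (Mx ε (fun i j => u i j ^ p ^ e) (fun s => (Pi.single (jj s) 1 : ι → K))).det ≠ 0 := by
    rw [Mx_pow ε p e u jj]
    exact pow_ne_zero _ h0
  rw [← isUnit_iff_ne_zero, ← Matrix.isUnit_iff_isUnit_det, ← Matrix.linearIndependent_rows_iff_isUnit] at h1
  have h2 := h1.comp Sum.inl Sum.inl_injective
  exact LinearIndependent.of_comp (LinearEquiv.funCongrLeft K K ε).toLinearMap h2

theorem sum_low {r : Type*} [Fintype r] (n : r → ℤ) (t : ℤ) :
    D * (Fintype.card r * t - ∑ i, n i) - Fintype.card r * (∑ l, S.ε l) ≤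
      (S.δ : ℤ) ^ 2 * ∑ i, (Module.finrank k (S.g (t - n i)) : ℤ) := by
  have := Finset.sum_le_sum (fun i (_ : i ∈ (Finset.univ : Finset r)) => S.h_lower (t - n i))
  rw [Finset.sum_sub_distrib, ← Finset.mul_sum, ← Finset.mul_sum, Finset.sum_sub_distrib] at this
  simpa using this

set_option maxHeartbeats 1000000 in
theorem pin {ρ : ℕ} (u : Fin ρ → ι → K) (hli : LinearIndependent K u) (hu : ∀ i, u i ∈ Rt S w m) :
    (∀ e, LinearIndependent K (fun i : Fin ρ => fun j => u i j ^ p ^ e)) ∧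
    ∃ (C : ℤ) (G : ℕ), ∀ (e : ℕ) (t : ℤ), (p ^ e : ℕ) * m ≤ t →
      |(S.δ : ℤ) ^ 2 * (Module.finrank k (Rt S (fun j => ((p ^ e : ℕ) : ℤ) * w j) t ⊓
          (Submodule.span K (Set.range fun i : Fin ρ => fun j => u i j ^ p ^ e)).restrictScalars k :
            Submodule k (ι → K)) : ℤ) -
        (D * (ρ * t - (p ^ e : ℕ) * (ρ * m)) + S.δ * ((p ^ e : ℕ) * G))| ≤ C := by
  obtain ⟨ν, ε, jj, hext⟩ := exists_ext u hli
  have h0 : gphi ε u jj ≠ 0 := Mx_det_ne ε _ _ hext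
  refine ⟨frob_li p ε u jj h0, ?_⟩
  obtain ⟨γ, hγ, ⟨T, μ, hT, hμ, hμ'⟩, hdv⟩ := AL (k := k) (K0 := K0) (gphi ε u)
    (fun φ => S.integral _ _ (gphi_mem S ε u hu φ)) ⟨jj, h0⟩
  have hcard : (Fintype.card ι : ℤ) = ρ + ν := by
    rw [← Fintype.card_congr ε]; simp
  set E : ℤ := ∑ l, S.ε l with hE
  refine ⟨2 * D * ρ * S.δ + 2 * D * ρ * |S.b0| + ρ * |E| + 2 * D * (ρ + ν) * S.δ + (ρ + ν) * |E|,
    γ.totalDegree, fun e t ht => ?_⟩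
  set N : ℤ := ((p ^ e : ℕ) : ℤ) with hN
  set w' : ι → ℤ := fun j => N * w j with hw'
  set u' : Fin ρ → ι → K := fun i => fun j => u i j ^ p ^ e with hu'
  have huli : LinearIndependent K u' := frob_li p ε u jj h0 e
  have huR : ∀ i, u' i ∈ Rt S w' (N * m) := fun i => Rt_pow S (hu i) (p ^ e)
  set W := Submodule.span K (Set.range u') with hW
  have hfr : Module.finrank K W = ρ := by
    rw [hW, finrank_span_eq_card huli, Fintype.card_fin]
  have hF := Fam_inter S (w := w') W
  have hUU : UU K (fun t => Rt S w' t ⊓ W.restrictScalars k) (N * m) = W := by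
    apply le_antisymm
    · unfold UU
      rw [Submodule.span_le]
      intro v hv
      simp only [Set.mem_iUnion] at hv
      obtain ⟨s, -, hv⟩ := hv
      exact hv.2
    · rw [hW, Submodule.span_le]
      rintro _ ⟨i, rfl⟩
      exact mem_UU' le_rfl ⟨huR i, Submodule.subset_span ⟨i, rfl⟩⟩
  have hMU := hF.MU W (fun t => inf_le_right) _ hUU
  rw [hfr] at hMU
  obtain ⟨v, n, hvli, hvh, hvs, hn, hdim⟩ := hMU
  have hnm := hn _ hUU
  have hbne : algebraMap (Pol k) K S.b ≠ 0 := Setup.alg_ne k K0 K S.b_ne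
  set V : Fin ρ → ι → K := fun i => algebraMap (Pol k) K S.b • v i with hV
  have hVli : LinearIndependent K V := by
    have := hvli.units_smul (fun _ => Units.mk0 _ hbne)
    exact this
  have hVs : ∀ i, V i ∈ W := fun i => W.smul_mem _ (by rw [← hvs]; exact Submodule.subset_span ⟨i, rfl⟩)
  have hVR : ∀ i, V i ∈ Rt S w' (n i + S.b0) := by
    intro i
    rw [mem_Rt]
    intro j
    have := hF.b_mem (hvh i) j
    have e1 : n i - w' j + S.b0 = n i + S.b0 - w' j := by ring
    rw [e1] at this
    exact this
  have hD1 := pinD S p ε u jj hu h0 γ hγ T μ hT hμ hμ' e V _ hVli hVs hVR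
  obtain ⟨o, ho, hoD⟩ := pinQ S p ε u jj hu h0 γ hγ hdv e
  rw [← hN] at ho hoD hD1
  rw [Finset.sum_add_distrib, Finset.sum_const, Finset.card_univ, Fintype.card_fin, nsmul_eq_mul] at hD1
  -- upper bound
  have hup : ∀ t : ℤ, N * m ≤ t → (S.δ : ℤ) ^ 2 * (Module.finrank k (Rt S w' t ⊓ W.restrictScalars k : Submodule k (ι → K)) : ℤ)
      ≤ D * (ρ * (t + 2 * S.δ) - ∑ i, n i) := by
    intro t ht
    refine (hdim t).trans (le_of_eq ?_)
    congr 1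
    rw [Finset.sum_congr rfl (fun i _ => max_eq_left (by have := hnm i; omega)), Finset.sum_sub_distrib]
    simp
  have hlow := inter_lower S (w := w') W V _ hVli hVs hVR t
  have hlow' := sum_low S (fun i => n i + S.b0) t
  rw [Finset.sum_add_distrib, Finset.sum_const, Finset.card_univ, Fintype.card_fin, nsmul_eq_mul] at hlow'
  have hlow2 := mul_le_mul_of_nonneg_left (Nat.cast_le (α := ℤ).2 hlow) (sq_nonneg (S.δ : ℤ))
  push_cast at hlow2
  have hlow3 := hlow'.trans hlow2
  -- large t
  obtain ⟨t0, ht0, hto⟩ : ∃ t0 : ℤ, N * m ≤ t0 ∧ ∀ s, o s ≤ t0 := by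
    refine ⟨|N * m| + ∑ s, |o s|, ?_, fun s => ?_⟩
    · have h1 : 0 ≤ ∑ s, |o s| := Finset.sum_nonneg fun _ _ => abs_nonneg _
      have := le_abs_self (N * m)
      omega
    · have h1 := Finset.single_le_sum (f := fun s => |o s|) (fun _ _ => abs_nonneg _) (Finset.mem_univ s)
      have := le_abs_self (o s)
      have := abs_nonneg (N * m)
      omega
  have hQ := ho t0
  rw [Finset.sum_congr rfl (fun s _ => max_eq_left (by have := hto s; omega)), Finset.sum_sub_distrib] at hQ
  simp only [Finset.sum_const, Finset.card_univ, Fintype.card_fin, nsmul_eq_mul] at hQ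
  rw [mul_sub] at hQ
  have hQl := sum_low S w' t0
  rw [hcard] at hQl
  have hQu := hup t0 ht0
  have hu1 := hup t ht
  have hb := neg_abs_le S.b0
  have hb' := le_abs_self S.b0
  have he' := le_abs_self E
  have hD0 : (0 : ℤ) ≤ D * ρ := by positivity
  have h1 := mul_le_mul_of_nonneg_left hb' hD0
  have h2 := mul_le_mul_of_nonneg_left he' (by positivity : (0 : ℤ) ≤ ρ)
  have h3 := mul_le_mul_of_nonneg_left he' (by positivity : (0 : ℤ) ≤ ρ + ν)
  have hp1 : 0 ≤ (D : ℤ) * ρ * S.δ := by positivity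
  have hp2 : 0 ≤ (D : ℤ) * ρ * |S.b0| := by positivity
  have hp3 : 0 ≤ (ρ : ℤ) * |E| := by positivity
  have hp4 : 0 ≤ (D : ℤ) * (ρ + ν) * S.δ := by positivity
  have hp5 : 0 ≤ ((ρ : ℤ) + ν) * |E| := by positivity
  rw [abs_le]
  constructor <;> linarith
end Pin
end HK

set_option linter.unusedSectionVars false
namespace HK
open MvPolynomial

theorem dim_le_of_integral {A B : Type*} [CommRing A] [CommRing B] (f : A →+* B) (hf : f.IsIntegral) :
    ringKrullDim B ≤ ringKrullDim A := by
  unfold ringKrullDim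
  apply Order.krullDim_le_of_strictMono (PrimeSpectrum.comap f)
  intro P Q h
  rw [← PrimeSpectrum.asIdeal_lt_asIdeal] at h ⊢
  obtain ⟨x, hx, hx'⟩ := SetLike.exists_of_lt h
  letI := f.toAlgebra
  have := P.2
  exact Ideal.comap_lt_comap_of_integral_mem_sdiff h.le ⟨hx, hx'⟩ (hf x)

section
variable {k R : Type*} [Field k] [CommRing R] [IsDomain R] [Algebra k R]
    (𝒜 : ℕ → Submodule k R) [GradedAlgebra 𝒜]

theorem piece_fin (h0 : 𝒜 0 = Submodule.span k {1}) (hstd : ∀ n, 𝒜 (n + 1) = 𝒜 1 * 𝒜 n)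
    (hfg : FiniteDimensional k (𝒜 1)) (n : ℕ) : FiniteDimensional k (𝒜 n) := by
  induction n with
  | zero =>
    refine Module.Finite.iff_fg.2 ?_
    rw [h0]; exact Submodule.fg_span_singleton _
  | succ n ih =>
    refine Module.Finite.iff_fg.2 ?_
    rw [hstd]
    exact (Module.Finite.iff_fg.1 hfg).mul (Module.Finite.iff_fg.1 ih)

theorem piece_le_adjoin (h0 : 𝒜 0 = Submodule.span k {1}) (hstd : ∀ n, 𝒜 (n + 1) = 𝒜 1 * 𝒜 n) (n : ℕ) :
    𝒜 n ≤ Subalgebra.toSubmodule (Algebra.adjoin k (𝒜 1 : Set R)) := by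
  induction n with
  | zero => rw [h0, Submodule.span_le]; rintro _ rfl; exact one_mem (Algebra.adjoin k (𝒜 1 : Set R))
  | succ n ih =>
    rw [hstd, Submodule.mul_le]
    intro a ha b hb
    exact mul_mem (S := Subalgebra k R) (Algebra.subset_adjoin ha) (ih hb)

theorem sub_top_of_pieces (M : Submodule k R) (h : ∀ n, 𝒜 n ≤ M) : M = ⊤ := by
  rw [eq_top_iff, ← (DirectSum.Decomposition.isInternal 𝒜).submodule_iSup_eq_top]
  exact iSup_le h

theorem finType (h0 : 𝒜 0 = Submodule.span k {1}) (hstd : ∀ n, 𝒜 (n + 1) = 𝒜 1 * 𝒜 n)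
    (hfg : FiniteDimensional k (𝒜 1)) : Algebra.FiniteType k R := by
  have h := sub_top_of_pieces 𝒜 _ (piece_le_adjoin 𝒜 h0 hstd)
  obtain ⟨s, hs⟩ := (Module.Finite.iff_fg).1 hfg
  refine ⟨⟨s, ?_⟩⟩
  have h2 : Algebra.adjoin k (𝒜 1 : Set R) = ⊤ := by
    rw [← Algebra.toSubmodule_eq_top]; exact h
  rw [← h2, ← hs, Algebra.adjoin_span]

/-- graded Nakayama -/
theorem finite_of_params (hfin : ∀ n, FiniteDimensional k (𝒜 n)) {σ : Type*} [Finite σ] (c : σ → R) (d : σ → ℕ)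
    (hd : ∀ i, 0 < d i) (hc : ∀ i, c i ∈ 𝒜 (d i)) (N : ℕ)
    (hN : ∀ n ≥ N, (𝒜 n : Set R) ⊆ Ideal.span (Set.range c)) :
    (aeval (R := k) c).toRingHom.Finite := by
  have := Fintype.ofFinite σ
  letI : Algebra (MvPolynomial σ k) R := (aeval (R := k) c).toRingHom.toAlgebra
  have hsm : ∀ (a : MvPolynomial σ k) (r : R), a • r = aeval c a * r := fun a r => rfl
  have hks : IsScalarTower k (MvPolynomial σ k) R := by
    refine ⟨fun a b r => ?_⟩
    rw [hsm, hsm, map_smul, smul_mul_assoc]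
  set M : Submodule (MvPolynomial σ k) R := Submodule.span _ (⋃ n : Fin N, (𝒜 n : Set R)) with hM
  have hle : ∀ n, 𝒜 n ≤ M.restrictScalars k := by
    intro n
    induction n using Nat.strong_induction_on with
    | _ n ih =>
      by_cases hn : n < N
      · intro a ha
        exact Submodule.subset_span (Set.mem_iUnion.2 ⟨⟨n, hn⟩, ha⟩)
      · intro a ha
        have h1 := hN n (not_lt.1 hn) ha
        obtain ⟨r, hr⟩ := (Submodule.mem_span_range_iff_exists_fun R).1 h1
        have h2 : (GradedRing.proj 𝒜 n) a = a := by
          rw [GradedRing.proj_apply, DirectSum.decompose_of_mem_same _ ha]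
        rw [← h2, ← hr, map_sum]
        refine Submodule.sum_mem _ fun i _ => ?_
        rw [GradedRing.proj_apply, smul_eq_mul]
        by_cases hdn : d i ≤ n
        · rw [DirectSum.coe_decompose_mul_of_right_mem_of_le _ (hc i) hdn, mul_comm]
          have h3 := ih (n - d i) (by have := hd i; omega) (DirectSum.decompose 𝒜 (r i) (n - d i)).2
          have := M.smul_mem (X i) h3
          rw [hsm, aeval_X] at this
          exact this
        · rw [DirectSum.coe_decompose_mul_of_right_mem_of_not_le _ (hc i) hdn]
          exact zero_mem _
  have htop : M = ⊤ := by
    have := sub_top_of_pieces 𝒜 _ hle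
    rwa [Submodule.restrictScalars_eq_top_iff] at this
  show Module.Finite (MvPolynomial σ k) R
  refine ⟨?_⟩
  rw [← htop, hM, Submodule.span_iUnion]
  apply Submodule.fg_iSup
  intro n
  obtain ⟨s, hs⟩ := (Module.Finite.iff_fg).1 (hfin n)
  refine ⟨s, ?_⟩
  apply le_antisymm
  · apply Submodule.span_mono
    intro a ha
    rw [← hs]; exact Submodule.subset_span ha
  · rw [Submodule.span_le]
    intro a ha
    rw [SetLike.mem_coe, ← hs] at ha
    exact Submodule.span_le_restrictScalars k (MvPolynomial σ k) _ ha

/-- homogeneous primes are contained in the irrelevant ideal -/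
theorem le_irrel (h0 : 𝒜 0 = Submodule.span k {1}) (P : Ideal R) (hP : P.IsHomogeneous 𝒜) (hne : P ≠ ⊤) :
    P ≤ (HomogeneousIdeal.irrelevant 𝒜).toIdeal := by
  intro a ha
  have h1 := hP 0 ha
  have h2 : (DirectSum.decompose 𝒜 a 0 : R) ∈ 𝒜 0 := (DirectSum.decompose 𝒜 a 0).2
  have h3 : ∀ z ∈ 𝒜 0, ∃ c : k, c • (1 : R) = z := by
    intro z hz
    rwa [h0, Submodule.mem_span_singleton] at hz
  replace h2 := h3 _ h2
  obtain ⟨c, hc⟩ := h2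
  rw [HomogeneousIdeal.mem_iff, HomogeneousIdeal.mem_irrelevant_iff, GradedRing.proj_apply]
  by_contra hcon
  apply hne
  have hc0 : c ≠ 0 := by rintro rfl; rw [zero_smul] at hc; exact hcon hc.symm
  rw [Ideal.eq_top_iff_one]
  rw [← hc] at h1
  have := P.mul_mem_left (algebraMap k R c⁻¹) h1
  rwa [Algebra.smul_def, mul_one, ← map_mul, inv_mul_cancel₀ hc0, map_one] at this

theorem min_hom (J : Ideal R) (hJ : J.IsHomogeneous 𝒜) (P : Ideal R) (hP : P ∈ J.minimalPrimes) :
    P.IsHomogeneous 𝒜 := by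
  rw [Ideal.IsHomogeneous.iff_eq]
  apply le_antisymm (Ideal.toIdeal_homogeneousCore_le 𝒜 P)
  refine hP.2 ⟨Ideal.IsPrime.homogeneousCore hP.1.1, ?_⟩ (Ideal.toIdeal_homogeneousCore_le 𝒜 P)
  rw [← hJ.toIdeal_homogeneousCore_eq_self]
  exact Ideal.homogeneousCore_mono 𝒜 hP.1.2

theorem irrel_prime (h0 : 𝒜 0 = Submodule.span k {1}) : (HomogeneousIdeal.irrelevant 𝒜).toIdeal.IsPrime := by
  have hne : (HomogeneousIdeal.irrelevant 𝒜).toIdeal ≠ ⊤ := by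
    rw [Ne, Ideal.eq_top_iff_one, HomogeneousIdeal.mem_iff, HomogeneousIdeal.mem_irrelevant_iff, GradedRing.proj_apply,
      DirectSum.decompose_of_mem_same _ SetLike.GradedOne.one_mem]
    exact one_ne_zero
  obtain ⟨M, hM, hle⟩ := Ideal.exists_le_maximal _ hne
  have h1 := Ideal.IsPrime.homogeneousCore (𝒜 := 𝒜) hM.isPrime
  have h2 : (HomogeneousIdeal.irrelevant 𝒜).toIdeal = (M.homogeneousCore 𝒜).toIdeal := by
    apply le_antisymm
    · have := Ideal.homogeneousCore_mono 𝒜 hle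
      rwa [HomogeneousIdeal.toIdeal_homogeneousCore_eq_self] at this
    · exact le_irrel 𝒜 h0 _ (M.homogeneousCore 𝒜).isHomogeneous h1.ne_top
  rw [h2]; exact h1

theorem exists_hom_of_not_le (P Q : Ideal R) (hP : P.IsHomogeneous 𝒜) (h : ¬ P ≤ Q) :
    ∃ n, ∃ a ∈ 𝒜 n, a ∈ P ∧ a ∉ Q := by
  classical
  by_contra! hcon
  apply h
  intro a ha
  rw [← DirectSum.sum_support_decompose 𝒜 a]
  exact Q.sum_mem fun i _ => hcon i _ (DirectSum.decompose 𝒜 a i).2 (hP i ha)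

/-- homogeneous avoidance for an antichain of primes -/
theorem hom_avoid (F : Finset (Ideal R)) (hF : ∀ P ∈ F, P.IsPrime ∧ P.IsHomogeneous 𝒜)
    (hac : ∀ P ∈ F, ∀ Q ∈ F, P ≤ Q → P = Q)
    (hirr : ∀ P ∈ F, ¬ (HomogeneousIdeal.irrelevant 𝒜).toIdeal ≤ P) :
    ∃ n > 0, ∃ y ∈ 𝒜 n, ∀ P ∈ F, y ∉ P := by
  classical
  have h1 : ∀ P : F, ∃ n > 0, ∃ z ∈ 𝒜 n, z ∉ P.1 ∧ ∀ Q ∈ F, Q ≠ P.1 → z ∈ Q := by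
    intro P
    obtain ⟨n0, a0, ha0, ha0i, ha0P⟩ := exists_hom_of_not_le 𝒜 _ _
      (HomogeneousIdeal.irrelevant 𝒜).isHomogeneous (hirr P.1 P.2)
    have h2 : ∀ Q : F, ∃ n, ∃ a ∈ 𝒜 n, a ∉ P.1 ∧ (Q.1 ≠ P.1 → a ∈ Q.1) := by
      intro Q
      by_cases hQ : Q.1 = P.1
      · exact ⟨0, 1, SetLike.GradedOne.one_mem, (Ideal.ne_top_iff_one _).1 (hF P.1 P.2).1.ne_top, fun h => absurd hQ h⟩
      · obtain ⟨n, a, ha, h3, h4⟩ := exists_hom_of_not_le 𝒜 Q.1 P.1 (hF Q.1 Q.2).2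
          (fun h => hQ (hac _ Q.2 _ P.2 h))
        exact ⟨n, a, ha, h4, fun _ => h3⟩
    choose n a ha haP haQ using h2
    have hP := (hF P.1 P.2).1
    refine ⟨n0 + ∑ Q, n Q, ?_, a0 * ∏ Q, a Q, ?_, ?_, ?_⟩
    · rcases Nat.eq_zero_or_pos n0 with h | h
      · exfalso
        subst h
        rw [HomogeneousIdeal.mem_iff, HomogeneousIdeal.mem_irrelevant_iff, GradedRing.proj_apply,
          DirectSum.decompose_of_mem_same _ ha0] at ha0i
        rw [ha0i] at ha0P
        exact ha0P (zero_mem _)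
      · omega
    · exact SetLike.GradedMul.mul_mem ha0 (SetLike.prod_mem_graded 𝒜 n a (fun Q _ => ha Q))
    · intro h
      rcases hP.mem_or_mem h with h | h
      · exact ha0P h
      · obtain ⟨Q, -, hQ⟩ := (hP.prod_mem_iff).1 h
        exact haP Q hQ
    · intro Q hQ hne
      apply Ideal.mul_mem_left
      exact Ideal.mem_of_dvd _ (Finset.dvd_prod_of_mem a (Finset.mem_univ ⟨Q, hQ⟩)) (haQ ⟨Q, hQ⟩ hne)
  choose n hn z hz hzP hzQ using h1
  refine ⟨∏ P, n P, Finset.prod_pos fun P _ => hn P, ∑ P, z P ^ (∏ Q ∈ Finset.univ.erase P, n Q), ?_, ?_⟩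
  · refine Submodule.sum_mem _ fun P _ => ?_
    have := SetLike.pow_mem_graded (∏ Q ∈ Finset.univ.erase P, n Q) (hz P)
    rwa [smul_eq_mul, Finset.prod_erase_mul _ _ (Finset.mem_univ P)] at this
  · intro P hP h
    have hpr := (hF P hP).1
    rw [← Finset.add_sum_erase _ _ (Finset.mem_univ (⟨P, hP⟩ : F))] at h
    rw [Ideal.add_mem_iff_left] at h
    · exact hzP ⟨P, hP⟩ (hpr.mem_of_pow_mem _ h)
    · refine Ideal.sum_mem _ fun Q hQ => ?_
      apply Ideal.pow_mem_of_mem _ (hzQ Q P hP _)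
      · exact Finset.prod_pos fun P _ => hn P
      · intro h
        rw [Finset.mem_erase] at hQ
        exact hQ.1 (Subtype.ext h.symm)
end
end HK

set_option linter.unusedSectionVars false
namespace HK
open MvPolynomial

section
variable {k R : Type*} [Field k] [CommRing R] [IsDomain R] [Algebra k R]
    (𝒜 : ℕ → Submodule k R) [GradedAlgebra 𝒜]

theorem two_le_of_finite (hdim : ringKrullDim R = 2) {s : ℕ} (c : Fin s → R)
    (hc : (aeval (R := k) c).toRingHom.Finite) : 2 ≤ s := by
  have h := dim_le_of_integral _ hc.to_isIntegral
  rw [hdim, MvPolynomial.ringKrullDim_of_isNoetherianRing, ringKrullDim_eq_zero_of_field] at h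
  simp only [Nat.card_eq_fintype_card, Fintype.card_fin, zero_add] at h
  exact_mod_cast h

theorem inj_of_finite (hdim : ringKrullDim R = 2) (c : Fin 2 → R)
    (hc : (aeval (R := k) c).toRingHom.Finite) : Function.Injective (aeval (R := k) c) := by
  rw [injective_iff_map_eq_zero]
  intro a ha
  by_contra hne
  let φ : Pol k →+* R := (aeval (R := k) c).toRingHom
  have h1 : φ.rangeRestrict a = 0 := by
    apply Subtype.ext; exact ha
  have h2 := ringKrullDim_succ_le_of_surjective φ.rangeRestrict φ.rangeRestrict_surjective
    (mem_nonZeroDivisors_of_ne_zero hne) h1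
  have h3 : ringKrullDim R ≤ ringKrullDim φ.range := by
    apply dim_le_of_integral φ.range.subtype
    intro r
    obtain ⟨P, hP, hr⟩ := hc.to_isIntegral r
    refine ⟨P.map φ.rangeRestrict, hP.map _, ?_⟩
    rw [Polynomial.eval₂_map]
    exact hr
  rw [MvPolynomial.ringKrullDim_of_isNoetherianRing, ringKrullDim_eq_zero_of_field] at h2
  simp only [Nat.card_eq_fintype_card, Fintype.card_fin, zero_add] at h2
  rw [hdim] at h3
  have h4 : (2 : WithBot ℕ∞) + 1 ≤ 2 := le_trans (by gcongr) h2
  exact absurd h4 (by decide)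

theorem piece_le_pow (hstd : ∀ n, 𝒜 (n + 1) = 𝒜 1 * 𝒜 n) (n : ℕ) :
    (𝒜 n : Set R) ⊆ ((HomogeneousIdeal.irrelevant 𝒜).toIdeal ^ n : Ideal R) := by
  suffices h : 𝒜 n ≤ ((HomogeneousIdeal.irrelevant 𝒜).toIdeal ^ n).restrictScalars k from h
  induction n with
  | zero => simp
  | succ n ih =>
    rw [hstd, Submodule.mul_le]
    intro a ha b hb
    rw [Submodule.restrictScalars_mem, pow_succ']
    exact Ideal.mul_mem_mul (HomogeneousIdeal.mem_irrelevant_of_mem _ one_pos ha) (ih hb)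

theorem finite_of_rad (h0 : 𝒜 0 = Submodule.span k {1}) (hstd : ∀ n, 𝒜 (n + 1) = 𝒜 1 * 𝒜 n)
    (hfg : FiniteDimensional k (𝒜 1)) {σ : Type*} [Finite σ] (c : σ → R) (d : σ → ℕ)
    (hd : ∀ i, 0 < d i) (hc : ∀ i, c i ∈ 𝒜 (d i))
    (hr : (HomogeneousIdeal.irrelevant 𝒜).toIdeal ≤ (Ideal.span (Set.range c)).radical) :
    (aeval (R := k) c).toRingHom.Finite := by
  have := finType 𝒜 h0 hstd hfg
  have : IsNoetherianRing R := Algebra.FiniteType.isNoetherianRing k R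
  obtain ⟨N, hN⟩ := Ideal.exists_pow_le_of_le_radical_of_fg hr (IsNoetherian.noetherian _)
  refine finite_of_params 𝒜 (piece_fin 𝒜 h0 hstd hfg) c d hd hc N fun n hn => ?_
  exact (piece_le_pow 𝒜 hstd n).trans ((Ideal.pow_le_pow_right hn).trans hN)

theorem exists_l (h0 : 𝒜 0 = Submodule.span k {1}) (hstd : ∀ n, 𝒜 (n + 1) = 𝒜 1 * 𝒜 n)
    (hfg : FiniteDimensional k (𝒜 1)) (hdim : ringKrullDim R = 2) : ∃ l ∈ 𝒜 1, l ≠ 0 := by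
  by_contra! hcon
  have h1 : 𝒜 1 = ⊥ := by rw [eq_bot_iff]; exact hcon
  have h2 : ∀ n ≥ 1, (𝒜 n : Set R) ⊆ Ideal.span (Set.range (Fin.elim0 : Fin 0 → R)) := by
    intro n hn
    obtain ⟨n, rfl⟩ := Nat.exists_eq_add_of_le' hn
    rw [hstd, h1, Submodule.bot_mul]
    simp
  have := two_le_of_finite hdim _ (finite_of_params 𝒜 (piece_fin 𝒜 h0 hstd hfg) (Fin.elim0 : Fin 0 → R) Fin.elim0
    (fun i => i.elim0) (fun i => i.elim0) 1 h2)
  omega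

theorem exists_params (h0 : 𝒜 0 = Submodule.span k {1}) (hstd : ∀ n, 𝒜 (n + 1) = 𝒜 1 * 𝒜 n)
    (hfg : FiniteDimensional k (𝒜 1)) (hdim : ringKrullDim R = 2) :
    ∃ (δ : ℕ) (c : Fin 2 → R), 0 < δ ∧ (∀ i, c i ∈ 𝒜 δ) ∧ (aeval (R := k) c).toRingHom.Finite ∧
      Function.Injective (aeval (R := k) c) := by
  have := finType 𝒜 h0 hstd hfg
  have : IsNoetherianRing R := Algebra.FiniteType.isNoetherianRing k R
  obtain ⟨l, hl, hl0⟩ := exists_l 𝒜 h0 hstd hfg hdim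
  set mm := (HomogeneousIdeal.irrelevant 𝒜).toIdeal with hmm
  have hmmp : mm.IsPrime := irrel_prime 𝒜 h0
  have hlh : (Ideal.span {l}).IsHomogeneous 𝒜 := Ideal.homogeneous_span 𝒜 _ (by rintro _ rfl; exact ⟨1, hl⟩)
  have hfinm := Ideal.finite_minimalPrimes_of_isNoetherianRing R (Ideal.span {l})
  have hnot : ∀ P ∈ (Ideal.span {l}).minimalPrimes, ¬ mm ≤ P := by
    intro P hP hle
    have hall : ∀ Q ∈ (Ideal.span {l}).minimalPrimes, mm ≤ Q := by
      intro Q hQ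
      have h1 : Q ≤ mm := le_irrel 𝒜 h0 Q (min_hom 𝒜 _ hlh Q hQ) hQ.1.1.ne_top
      exact hle.trans (hP.2 hQ.1 (h1.trans hle))
    have hr : mm ≤ (Ideal.span (Set.range (fun _ : Fin 1 => l))).radical := by
      rw [Set.range_const, ← Ideal.sInf_minimalPrimes]
      exact le_sInf hall
    have := two_le_of_finite hdim _ (finite_of_rad 𝒜 h0 hstd hfg _ (fun _ => 1) (fun _ => one_pos) (fun _ => hl) hr)
    omega
  obtain ⟨δ, hδ, y, hy, hyP⟩ := hom_avoid 𝒜 hfinm.toFinset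
    (fun P hP => by
      rw [Set.Finite.mem_toFinset] at hP
      exact ⟨hP.1.1, min_hom 𝒜 _ hlh P hP⟩)
    (fun P hP Q hQ h => by
      rw [Set.Finite.mem_toFinset] at hP hQ
      exact le_antisymm h (hQ.2 hP.1 h))
    (fun P hP => by
      rw [Set.Finite.mem_toFinset] at hP
      exact hnot P hP)
  have hc : ∀ i, (![l ^ δ, y] : Fin 2 → R) i ∈ 𝒜 δ := by
    intro i
    fin_cases i
    · have := SetLike.pow_mem_graded δ hl
      simpa using this
    · exact hy
  have hr : mm ≤ (Ideal.span (Set.range (![l ^ δ, y] : Fin 2 → R))).radical := by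
    rw [← Ideal.sInf_minimalPrimes]
    refine le_sInf fun Q hQ => ?_
    have hQp := hQ.1.1
    have hJh : (Ideal.span (Set.range (![l ^ δ, y] : Fin 2 → R))).IsHomogeneous 𝒜 :=
      Ideal.homogeneous_span 𝒜 _ (by rintro _ ⟨i, rfl⟩; exact ⟨δ, hc i⟩)
    have hQm : Q ≤ mm := le_irrel 𝒜 h0 Q (min_hom 𝒜 _ hJh Q hQ) hQp.ne_top
    have hlQ : l ∈ Q := hQp.mem_of_pow_mem δ (hQ.1.2 (Ideal.subset_span ⟨0, rfl⟩))
    have hyQ : y ∈ Q := hQ.1.2 (Ideal.subset_span ⟨1, rfl⟩)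
    obtain ⟨P, hP, hPQ⟩ := Ideal.exists_minimalPrimes_le (I := Ideal.span {l}) (J := Q)
      (by rw [Ideal.span_singleton_le_iff_mem]; exact hlQ)
    have hyP' := hyP P (by rwa [Set.Finite.mem_toFinset])
    by_contra hcon
    have hPp := hP.1.1
    let ch : LTSeries (PrimeSpectrum R) := {
      length := 3
      toFun := ![⟨⊥, Ideal.isPrime_bot⟩, ⟨P, hPp⟩, ⟨Q, hQp⟩, ⟨mm, hmmp⟩]
      step := by
        intro i
        have h1 : (⟨⊥, Ideal.isPrime_bot⟩ : PrimeSpectrum R) < ⟨P, hPp⟩ := by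
          rw [← PrimeSpectrum.asIdeal_lt_asIdeal]
          rw [bot_lt_iff_ne_bot]
          rintro (rfl : P = ⊥)
          exact hl0 (hP.1.2 (Ideal.mem_span_singleton_self l))
        have h2 : (⟨P, hPp⟩ : PrimeSpectrum R) < ⟨Q, hQp⟩ := by
          rw [← PrimeSpectrum.asIdeal_lt_asIdeal]
          exact lt_of_le_of_ne hPQ (fun h => hyP' (by rw [show P = Q from h]; exact hyQ))
        have h3 : (⟨Q, hQp⟩ : PrimeSpectrum R) < ⟨mm, hmmp⟩ := by
          rw [← PrimeSpectrum.asIdeal_lt_asIdeal]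
          exact lt_of_le_of_ne hQm (fun h => hcon (by rw [show Q = mm from h]))
        fin_cases i
        · exact h1
        · exact h2
        · exact h3 }
    have h5 : ((3 : ℕ) : WithBot ℕ∞) ≤ ringKrullDim R := Order.LTSeries.length_le_krullDim ch
    rw [hdim] at h5
    exact absurd h5 (by decide)
  have hfin := finite_of_rad 𝒜 h0 hstd hfg _ (fun _ => δ) (fun _ => hδ) hc hr
  exact ⟨δ, _, hδ, hc, hfin, inj_of_finite hdim _ hfin⟩
end
end HK

set_option linter.unusedSectionVars false
namespace HK
open MvPolynomial

section gZ
variable {k R : Type*} [Field k] [CommRing R] [IsDomain R] [Algebra k R]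
    (𝒜 : ℕ → Submodule k R) [GradedAlgebra 𝒜] (K : Type*) [Field K] [Algebra R K] [IsFractionRing R K]
    [Algebra k K] [IsScalarTower k R K]

open Classical in
/-- the graded pieces inside the fraction field, indexed by integers -/
noncomputable def gZ (t : ℤ) : Submodule k K :=
  if 0 ≤ t then (𝒜 t.toNat).map (IsScalarTower.toAlgHom k R K).toLinearMap else ⊥

theorem mem_gZ {n : ℕ} {z : K} : z ∈ gZ 𝒜 K n ↔ ∃ r ∈ 𝒜 n, algebraMap R K r = z := by
  unfold gZ
  rw [if_pos (by positivity)]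
  simp

theorem gZ_neg (t : ℤ) (ht : t < 0) : gZ 𝒜 K t = ⊥ := by
  unfold gZ; rw [if_neg (by omega)]

theorem gZ_cases {t : ℤ} {z : K} (h : z ∈ gZ 𝒜 K t) : z = 0 ∨ ∃ n : ℕ, t = n ∧ ∃ r ∈ 𝒜 n, algebraMap R K r = z := by
  rcases lt_or_ge t 0 with ht | ht
  · rw [gZ_neg 𝒜 K t ht] at h; exact Or.inl h
  · obtain ⟨n, rfl⟩ := Int.eq_ofNat_of_zero_le ht
    exact Or.inr ⟨n, rfl, (mem_gZ 𝒜 K).1 h⟩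

theorem gZ_mul (i j : ℤ) (a b : K) (ha : a ∈ gZ 𝒜 K i) (hb : b ∈ gZ 𝒜 K j) : a * b ∈ gZ 𝒜 K (i + j) := by
  rcases gZ_cases 𝒜 K ha with rfl | ⟨n, rfl, r, hr, rfl⟩
  · rw [zero_mul]; exact zero_mem _
  rcases gZ_cases 𝒜 K hb with rfl | ⟨m, rfl, s, hs, rfl⟩
  · rw [mul_zero]; exact zero_mem _
  rw [← Nat.cast_add, mem_gZ]
  exact ⟨r * s, SetLike.GradedMul.mul_mem hr hs, map_mul _ _ _⟩

theorem gZ_indep : iSupIndep (gZ 𝒜 K) := by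
  have hinj : Function.Injective (IsScalarTower.toAlgHom k R K).toLinearMap := IsFractionRing.injective R K
  have h := (DirectSum.Decomposition.isInternal 𝒜).submodule_iSupIndep
  rw [iSupIndep_def] at h ⊢
  intro t
  rcases lt_or_ge t 0 with ht | ht
  · rw [gZ_neg 𝒜 K t ht]; exact disjoint_bot_left
  · obtain ⟨n, rfl⟩ := Int.eq_ofNat_of_zero_le ht
    have h1 : gZ 𝒜 K n = (𝒜 n).map (IsScalarTower.toAlgHom k R K).toLinearMap := by
      unfold gZ; rw [if_pos (by positivity)]; simp
    have h2 : ⨆ j, ⨆ (_ : j ≠ (n : ℤ)), gZ 𝒜 K j ≤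
        (⨆ j, ⨆ (_ : j ≠ n), 𝒜 j).map (IsScalarTower.toAlgHom k R K).toLinearMap := by
      refine iSup₂_le fun j hj => ?_
      intro z hz
      rcases gZ_cases 𝒜 K hz with rfl | ⟨m, rfl, s, hs, rfl⟩
      · exact zero_mem _
      · refine ⟨s, ?_, rfl⟩
        have : m ≠ n := by rintro rfl; exact hj rfl
        exact Submodule.mem_iSup_of_mem m (Submodule.mem_iSup_of_mem this hs)
    refine Disjoint.mono_right h2 ?_
    rw [h1]
    exact Submodule.disjoint_map hinj (h n)
end gZ

section mk
variable {k R : Type*} [Field k] [CommRing R] [IsDomain R] [Algebra k R]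
    (𝒜 : ℕ → Submodule k R) [GradedAlgebra 𝒜]
    [Algebra (Pol k) R] [IsScalarTower k (Pol k) R]
    (δ : ℕ) (hδ : 0 < δ) (hX : ∀ i : Fin 2, algebraMap (Pol k) R (X i) ∈ 𝒜 δ)

include hX in
theorem alg_hom_mem (i : ℕ) (a : Pol k) (ha : a.IsHomogeneous i) : algebraMap (Pol k) R a ∈ 𝒜 (i * δ) := by
  rw [a.as_sum, map_sum]
  refine Submodule.sum_mem _ fun d hd => ?_
  have hdeg : d.degree = i := by
    have := ha (mem_support_iff.1 hd)
    rw [Finsupp.degree_eq_weight_one]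
    exact this
  have h1 : monomial d (coeff d a) = coeff d a • (∏ j : Fin 2, (X j : Pol k) ^ d j) := by
    rw [monomial_eq, smul_eq_C_mul, Finsupp.prod_fintype _ _ (by simp)]
  rw [h1, Algebra.algebraMap_eq_smul_one, smul_assoc, ← Algebra.algebraMap_eq_smul_one, map_prod]
  apply Submodule.smul_mem
  have h2 := SetLike.prod_mem_graded 𝒜 (fun j : Fin 2 => d j • δ) (fun j => algebraMap (Pol k) R (X j ^ d j))
    (F := Finset.univ) (fun j _ => by rw [map_pow]; exact SetLike.pow_mem_graded _ (hX j))
  convert h2 using 2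
  rw [← hdeg, Finsupp.degree_eq_sum, Finset.sum_mul]
  rfl

include hX in
theorem proj_mul_same (a : Pol k) (n d : ℕ) (r : R) (hr : r ∈ 𝒜 n) (hδ : 0 < δ) :
    GradedRing.proj 𝒜 (d * δ + n) (algebraMap (Pol k) R a * r) =
      algebraMap (Pol k) R (homogeneousComponent d a) * r := by
  conv_lhs => rw [← sum_homogeneousComponent a, map_sum, Finset.sum_mul, map_sum]
  have h1 : ∀ i, algebraMap (Pol k) R (homogeneousComponent i a) * r ∈ 𝒜 (i * δ + n) := fun i =>
    SetLike.GradedMul.mul_mem (alg_hom_mem 𝒜 δ hX i _ (homogeneousComponent_isHomogeneous i a)) hr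
  have h2 : ∀ i, i ≠ d → GradedRing.proj 𝒜 (d * δ + n) (algebraMap (Pol k) R (homogeneousComponent i a) * r) = 0 := by
    intro i hi
    rw [GradedRing.proj_apply, DirectSum.decompose_of_mem_ne _ (h1 i)]
    intro h
    exact hi (Nat.eq_of_mul_eq_mul_right hδ (by omega))
  rw [Finset.sum_eq_single d (fun i _ hi => h2 i hi)]
  · rw [GradedRing.proj_apply, DirectSum.decompose_of_mem_same _ (h1 d)]
  · intro hd
    rw [homogeneousComponent_eq_zero]
    · simp
    · simpa [Nat.lt_succ_iff] using hd

include hX in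
theorem proj_mul_ne (a : Pol k) (n N : ℕ) (r : R) (hr : r ∈ 𝒜 n) (hN : ∀ d, N ≠ d * δ + n) :
    GradedRing.proj 𝒜 N (algebraMap (Pol k) R a * r) = 0 := by
  rw [← sum_homogeneousComponent a, map_sum, Finset.sum_mul, map_sum]
  refine Finset.sum_eq_zero fun i _ => ?_
  have h1 : ∀ i, algebraMap (Pol k) R (homogeneousComponent i a) * r ∈ 𝒜 (i * δ + n) := fun i =>
    SetLike.GradedMul.mul_mem (alg_hom_mem 𝒜 δ hX i _ (homogeneousComponent_isHomogeneous i a)) hr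
  rw [GradedRing.proj_apply, DirectSum.decompose_of_mem_ne _ (h1 i)]
  exact (hN i).symm

theorem hc_mem_Az (a : Pol k) (d : ℕ) (u : ℤ) (hu : (d * δ : ℤ) = u) : homogeneousComponent d a ∈ Az k δ u := by
  rw [mem_Az]
  intro e he
  have := homogeneousComponent_isHomogeneous d a he
  have h2 : e.degree = d := by
    rw [Finsupp.degree_eq_weight_one]
    exact this
  rw [h2, hu]

variable {K0 K : Type*} [Field K0] [Field K] [Algebra R K] [IsFractionRing R K]
    [Algebra k K] [IsScalarTower k R K] [Algebra (Pol k) K0]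
  [IsFractionRing (Pol k) K0] [Algebra K0 K] [FiniteDimensional K0 K] [Algebra (Pol k) K]
  [IsScalarTower (Pol k) K0 K] [IsScalarTower k (Pol k) K] [IsScalarTower (Pol k) R K]
  [Module.Finite (Pol k) R] [FaithfulSMul (Pol k) R]

variable (K0 K) in
theorem exists_hbasis : ∃ (n : Fin (Module.finrank K0 K) → ℕ) (e : Fin (Module.finrank K0 K) → R),
    (∀ i, e i ∈ 𝒜 (n i)) ∧ LinearIndependent K0 (fun i => algebraMap R K (e i)) := by
  let v : (Σ n, 𝒜 n) → K := fun i => algebraMap R K (i.2 : R)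
  obtain ⟨κ, a, ha, hsp, hli⟩ := exists_linearIndependent' K0 v
  have htop : Submodule.span K0 (Set.range v) = ⊤ := by
    rw [eq_top_iff]
    have h1 : ∀ r : R, algebraMap R K r ∈ Submodule.span K0 (Set.range v) := by
      classical
      intro r
      rw [← DirectSum.sum_support_decompose 𝒜 r, map_sum]
      exact Submodule.sum_mem _ fun i _ => Submodule.subset_span ⟨⟨i, _⟩, rfl⟩
    intro z _
    obtain ⟨⟨r, ⟨_, s, hs, rfl⟩⟩, h2⟩ := IsLocalization.surj
      (Algebra.algebraMapSubmonoid R (nonZeroDivisors (Pol k))) z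
    have hs0 : algebraMap (Pol k) K0 s ≠ 0 := by
      simpa using nonZeroDivisors.ne_zero hs
    have h3 : algebraMap (Pol k) K0 s • z = algebraMap R K r := by
      rw [algebraMap_smul, Algebra.smul_def, mul_comm, IsScalarTower.algebraMap_apply (Pol k) R K]
      exact h2
    rw [← Submodule.smul_mem_iff _ hs0, h3]
    exact h1 r
  rw [htop] at hsp
  let B := Module.Basis.mk hli hsp.ge
  have := Module.Finite.finite_basis B
  let E : κ ≃ Fin (Module.finrank K0 K) := Finite.equivFinOfCardEq (Module.finrank_eq_nat_card_basis B).symm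
  refine ⟨fun i => (a (E.symm i)).1, fun i => ((a (E.symm i)).2 : R), fun i => (a (E.symm i)).2.2, ?_⟩
  exact hli.comp E.symm E.symm.injective

variable (K0 K) in
theorem exists_den (e : Fin (Module.finrank K0 K) → K) (he : LinearIndependent K0 e) :
    ∃ b : Pol k, b ≠ 0 ∧ ∀ r : R, ∃ a : Fin (Module.finrank K0 K) → Pol k,
      algebraMap (Pol k) K b * algebraMap R K r = ∑ l, algebraMap (Pol k) K (a l) * e l := by
  classical
  have : Nonempty (Fin (Module.finrank K0 K)) := ⟨⟨0, Module.finrank_pos⟩⟩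
  let B : Module.Basis (Fin (Module.finrank K0 K)) K0 K := basisOfLinearIndependentOfCardEqFinrank he (by simp)
  have hB : ∀ l, B l = e l := fun l => by simp [B]
  obtain ⟨G, hG⟩ := (Module.Finite.fg_top : (⊤ : Submodule (Pol k) R).FG)
  obtain ⟨b, hb⟩ := IsLocalization.exist_integer_multiples_of_finset (nonZeroDivisors (Pol k))
    ((G ×ˢ (Finset.univ : Finset (Fin (Module.finrank K0 K)))).image
      (fun x => B.repr (algebraMap R K x.1) x.2))
  refine ⟨b, nonZeroDivisors.ne_zero b.2, fun r => ?_⟩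
  have hr : r ∈ Submodule.span (Pol k) (G : Set R) := by rw [hG]; trivial
  induction hr using Submodule.span_induction with
  | mem g hg =>
    have h1 : ∀ l, ∃ c : Pol k, algebraMap (Pol k) K0 c = (b : Pol k) • B.repr (algebraMap R K g) l := by
      intro l
      exact hb _ (Finset.mem_image.2 ⟨(g, l), Finset.mem_product.2 ⟨hg, Finset.mem_univ _⟩, rfl⟩)
    choose c hc using h1
    refine ⟨c, ?_⟩
    conv_lhs => rw [← B.sum_repr (algebraMap R K g), Finset.mul_sum]
    refine Finset.sum_congr rfl fun l _ => ?_
    rw [IsScalarTower.algebraMap_apply (Pol k) K0 K (c l), hc,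
      Algebra.smul_def (B.repr (algebraMap R K g) l) (B l),
      Algebra.smul_def (b : Pol k) (B.repr (algebraMap R K g) l), map_mul, hB,
      ← IsScalarTower.algebraMap_apply, mul_assoc]
  | zero => exact ⟨0, by simp⟩
  | add x y _ _ hx hy =>
    obtain ⟨a1, h1⟩ := hx
    obtain ⟨a2, h2⟩ := hy
    refine ⟨a1 + a2, ?_⟩
    rw [map_add, mul_add, h1, h2, ← Finset.sum_add_distrib]
    simp [add_mul]
  | smul c x _ hx =>
    obtain ⟨a1, h1⟩ := hx
    refine ⟨fun l => c * a1 l, ?_⟩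
    rw [Algebra.smul_def, map_mul, mul_left_comm, h1, Finset.mul_sum, ← IsScalarTower.algebraMap_apply]
    simp [mul_assoc]

include hδ hX in
variable (K0 K) in
theorem mk_setup (hfin : ∀ n, FiniteDimensional k (𝒜 n)) (l : R) (hl : l ∈ 𝒜 1) (hl0 : l ≠ 0) :
    ∃ S : Setup k K0 K, ∀ t, S.g t = gZ 𝒜 K t := by
  obtain ⟨n, e, hen, heli⟩ := exists_hbasis (k := k) 𝒜 K0 K
  obtain ⟨b, hb, hden⟩ := exists_den (k := k) (R := R) K0 K _ heli
  have hinj : Function.Injective (algebraMap R K) := IsFractionRing.injective R K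
  obtain ⟨d, hd⟩ : ∃ d, homogeneousComponent d b ≠ 0 := by
    by_contra! h
    apply hb
    rw [← sum_homogeneousComponent b]
    exact Finset.sum_eq_zero fun i _ => h i
  refine ⟨{ g := gZ 𝒜 K
            g_neg := fun j hj => gZ_neg 𝒜 K j hj
            one_mem := (mem_gZ 𝒜 K (n := 0)).2 ⟨1, SetLike.GradedOne.one_mem, map_one _⟩
            mul_mem := gZ_mul 𝒜 K
            indep := gZ_indep 𝒜 K
            δ := δ
            δ_pos := hδ
            x_mem := (mem_gZ 𝒜 K).2 ⟨_, hX 0, (IsScalarTower.algebraMap_apply _ _ _ _).symm⟩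
            y_mem := (mem_gZ 𝒜 K).2 ⟨_, hX 1, (IsScalarTower.algebraMap_apply _ _ _ _).symm⟩
            l := algebraMap R K l
            l_ne := fun h => hl0 (hinj (by rw [h, map_zero]))
            l_mem := (mem_gZ 𝒜 K (n := 1)).2 ⟨l, hl, rfl⟩
            integral := ?_
            fin := ?_
            e := fun i => algebraMap R K (e i)
            ε := fun i => n i
            e_mem := fun i => (mem_gZ 𝒜 K).2 ⟨_, hen i, rfl⟩
            e_indep := heli
            b := homogeneousComponent d b
            b_ne := hd
            b0 := d * δ
            b_hom := hc_mem_Az δ b d _ rfl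
            FH := ?_ }, fun t => rfl⟩
  · intro i a ha
    rcases gZ_cases 𝒜 K ha with rfl | ⟨m, rfl, s, hs, rfl⟩
    · exact isIntegral_zero
    · exact (Algebra.IsIntegral.isIntegral (R := Pol k) s).algebraMap
  · intro i
    rcases lt_or_ge i 0 with ht | ht
    · rw [gZ_neg 𝒜 K i ht]; infer_instance
    · unfold gZ; rw [if_pos ht]
      have := hfin i.toNat
      infer_instance
  · intro t r hr
    rcases gZ_cases 𝒜 K hr with rfl | ⟨m, rfl, s, hs, rfl⟩
    · exact ⟨0, by simp, fun l => zero_mem _⟩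
    obtain ⟨a, ha⟩ := hden s
    have ha' : algebraMap (Pol k) R b * s = ∑ l, algebraMap (Pol k) R (a l) * e l := by
      apply hinj
      rw [map_mul, map_sum]
      simp only [map_mul, ← IsScalarTower.algebraMap_apply]
      exact ha
    have h1 := congrArg (GradedRing.proj 𝒜 (d * δ + m)) ha'
    rw [proj_mul_same 𝒜 δ hX b m d s hs hδ, map_sum] at h1
    have h2 : ∀ l, ∃ a' : Pol k, a' ∈ Az k δ (m + d * δ - n l) ∧
        GradedRing.proj 𝒜 (d * δ + m) (algebraMap (Pol k) R (a l) * e l) = algebraMap (Pol k) R a' * e l := by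
      intro l
      by_cases hN : ∃ j, d * δ + m = j * δ + n l
      · obtain ⟨j, hj⟩ := hN
        refine ⟨homogeneousComponent j (a l), hc_mem_Az δ _ j _ ?_, ?_⟩
        · have : ((d * δ + m : ℕ) : ℤ) = (j * δ + n l : ℕ) := by rw [hj]
          push_cast at this
          linarith
        · rw [hj, proj_mul_same 𝒜 δ hX _ _ _ _ (hen l) hδ]
      · push Not at hN
        exact ⟨0, zero_mem _, by rw [proj_mul_ne 𝒜 δ hX _ _ _ _ (hen l) hN]; simp⟩
    choose a' ha'1 ha'2 using h2
    refine ⟨a', ?_, ha'1⟩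
    have h3 := congrArg (algebraMap R K) h1
    simp only [ha'2] at h3
    rw [map_mul, map_sum] at h3
    simp only [map_mul, ← IsScalarTower.algebraMap_apply] at h3
    exact h3
end mk

theorem exists_setup {k R : Type*} [Field k] [CommRing R] [IsDomain R] [Algebra k R]
    (𝒜 : ℕ → Submodule k R) [GradedAlgebra 𝒜]
    (h0 : 𝒜 0 = Submodule.span k {1}) (hstd : ∀ n, 𝒜 (n + 1) = 𝒜 1 * 𝒜 n)
    (hfg : FiniteDimensional k (𝒜 1)) (hdim : ringKrullDim R = 2) :
    ∃ (_ : Algebra (Pol k) (FractionRing R)) (_ : Algebra (FractionRing (Pol k)) (FractionRing R))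
      (_ : FiniteDimensional (FractionRing (Pol k)) (FractionRing R))
      (_ : IsScalarTower (Pol k) (FractionRing (Pol k)) (FractionRing R))
      (_ : IsScalarTower k (Pol k) (FractionRing R))
      (S : Setup k (FractionRing (Pol k)) (FractionRing R)), ∀ t, S.g t = gZ 𝒜 (FractionRing R) t := by
  obtain ⟨δ, c, hδ, hc, hfin, hinj⟩ := exists_params 𝒜 h0 hstd hfg hdim
  obtain ⟨l, hl, hl0⟩ := exists_l 𝒜 h0 hstd hfg hdim
  letI i0 : Algebra (Pol k) R := (aeval (R := k) c).toRingHom.toAlgebra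
  have hal : ∀ a, algebraMap (Pol k) R a = aeval c a := fun a => rfl
  haveI : IsScalarTower k (Pol k) R := IsScalarTower.of_algebraMap_eq (fun a => by
    rw [hal, MvPolynomial.algebraMap_eq, aeval_C])
  haveI : Module.Finite (Pol k) R := hfin
  haveI : FaithfulSMul (Pol k) R := (faithfulSMul_iff_algebraMap_injective _ _).2 hinj
  haveI : FaithfulSMul (Pol k) (FractionRing R) := (faithfulSMul_iff_algebraMap_injective _ _).2 (by
    rw [IsScalarTower.algebraMap_eq (Pol k) R (FractionRing R)]
    exact (IsFractionRing.injective R (FractionRing R)).comp hinj)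
  letI i2 : Algebra (FractionRing (Pol k)) (FractionRing R) := FractionRing.liftAlgebra (Pol k) _
  haveI i3 : IsScalarTower (Pol k) (FractionRing (Pol k)) (FractionRing R) :=
    FractionRing.isScalarTower_liftAlgebra (Pol k) _
  haveI i4 : FiniteDimensional (FractionRing (Pol k)) (FractionRing R) :=
    Module.Finite.equiv (Algebra.IsAlgebraic.isBaseChange_of_isFractionRing (Pol k) R
      (FractionRing (Pol k)) (FractionRing R)).equiv
  haveI i5 : IsScalarTower k (Pol k) (FractionRing R) := IsScalarTower.of_algebraMap_eq (fun a => by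
    rw [IsScalarTower.algebraMap_apply (Pol k) R (FractionRing R), ← IsScalarTower.algebraMap_apply k (Pol k) R,
      IsScalarTower.algebraMap_apply k R (FractionRing R)])
  refine ⟨inferInstance, i2, i4, i3, i5, ?_⟩
  exact mk_setup 𝒜 δ hδ (fun i => by rw [hal, aeval_X]; exact hc i) _ _ (piece_fin 𝒜 h0 hstd hfg) l hl hl0
end HK

set_option linter.unusedSectionVars false
namespace HK
open MvPolynomial

section P6a
variable {k K0 K : Type*} [Field k] [Field K0] [Field K] [Algebra (Pol k) K0]
  [IsFractionRing (Pol k) K0] [Algebra K0 K] [FiniteDimensional K0 K] [Algebra (Pol k) K]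
  [IsScalarTower (Pol k) K0 K] [Algebra k K] [IsScalarTower k (Pol k) K] (S : Setup k K0 K)
  {ι : Type*} [Fintype ι] [DecidableEq ι] (F : ι → K) (d : ι → ℕ)

local notation "D" => Module.finrank K0 K

/-- degree `m` syzygies of the `q`-th powers. -/
noncomputable def VV (q : ℕ) (m : ℤ) : Submodule k (ι → K) :=
  Rt S (fun j => (q : ℤ) * d j) m ⊓
    (LinearMap.ker (Fintype.linearCombination K (fun i => F i ^ q))).restrictScalars k

/-- rank of the syzygies -/
noncomputable def rk (q : ℕ) (m : ℤ) : ℕ :=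
  Module.finrank K (Submodule.span K (VV S F d q m : Set (ι → K)))

theorem mem_VV {q : ℕ} {m : ℤ} {v : ι → K} : v ∈ VV S F d q m ↔
    v ∈ Rt S (fun j => (q : ℤ) * d j) m ∧ ∑ i, v i * F i ^ q = 0 := by
  simp [VV, Fintype.linearCombination_apply]

theorem VV_smul {q : ℕ} {m : ℤ} {v : ι → K} (hv : v ∈ VV S F d q m) (t : ℤ) (h : m ≤ t) :
    S.l ^ (t - m).toNat • v ∈ VV S F d q t := by
  rw [mem_VV] at hv ⊢
  constructor
  · have h1 := S.pow_mem S.l_mem (t - m).toNat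
    have h2 := Rt_smul S h1 hv.1
    have h3 : m + ((t - m).toNat : ℤ) * 1 = t := by
      rw [Int.toNat_of_nonneg (by omega)]; ring
    rwa [h3] at h2
  · simp only [Pi.smul_apply, smul_eq_mul, mul_assoc]
    rw [← Finset.mul_sum, hv.2, mul_zero]

theorem VV_fin (q : ℕ) (m : ℤ) : FiniteDimensional k (VV S F d q m) := by
  have := Rt_fin S (w := fun j => (q : ℤ) * d j) (t := m)
  unfold VV
  infer_instance

theorem VV_mono {q : ℕ} {m t : ℤ} (h : m ≤ t) :
    Module.finrank k (VV S F d q m) ≤ Module.finrank k (VV S F d q t) := by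
  have := VV_fin S F d q t
  have hne : S.l ^ (t - m).toNat ≠ 0 := pow_ne_zero _ S.l_ne
  let φ : VV S F d q m →ₗ[k] VV S F d q t :=
    LinearMap.codRestrict _ ((DistribSMul.toLinearMap k (ι → K) (S.l ^ (t - m).toNat)) ∘ₗ (VV S F d q m).subtype)
      (fun v => VV_smul S F d v.2 t h)
  apply LinearMap.finrank_le_finrank_of_injective (f := φ)
  intro a b hab
  have h1 : S.l ^ (t - m).toNat • (a : ι → K) = S.l ^ (t - m).toNat • (b : ι → K) := congrArg Subtype.val hab
  exact Subtype.ext (smul_right_injective _ hne h1)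

variable (p : ℕ) [Fact p.Prime] [CharP K p]

theorem VV_frob {q : ℕ} {m : ℤ} {v : ι → K} (hv : v ∈ VV S F d q m) (e : ℕ) :
    (fun j => v j ^ p ^ e) ∈ VV S F d (p ^ e * q) ((p ^ e : ℕ) * m) := by
  rw [mem_VV] at hv ⊢
  constructor
  · have := Rt_pow S hv.1 (p ^ e)
    convert this using 3
    push_cast; ring
  · have h1 : (∑ i, v i * F i ^ q) ^ p ^ e = 0 := by
      rw [hv.2, zero_pow (pow_pos (Fact.out : p.Prime).pos e).ne']
    rw [sum_pow_char_pow] at h1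
    rw [← h1]
    refine Finset.sum_congr rfl fun i _ => ?_
    rw [mul_pow, ← pow_mul, mul_comm q]

theorem exists_u (q : ℕ) (m : ℤ) : ∃ u : Fin (rk S F d q m) → ι → K, LinearIndependent K u ∧
    ∀ i, u i ∈ VV S F d q m := by
  obtain ⟨b, hb, hsp, hli⟩ := exists_linearIndependent K (VV S F d q m : Set (ι → K))
  have hfin := hli.setFinite
  have := hfin.fintype
  have hc : Fintype.card b = rk S F d q m := by
    have := finrank_span_eq_card hli
    rw [Subtype.range_coe, hsp] at this
    exact this.symm
  let E := Fintype.equivFinOfCardEq hc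
  exact ⟨fun i => (E.symm i : ι → K), hli.comp E.symm E.symm.injective, fun i => hb (E.symm i).2⟩

theorem frob_in_span {q : ℕ} {m : ℤ} {v : ι → K} (hv : v ∈ VV S F d q m) (e : ℕ) (t : ℤ)
    (ht : (p ^ e : ℕ) * m ≤ t) :
    (fun j => v j ^ p ^ e) ∈ Submodule.span K (VV S F d (p ^ e * q) t : Set (ι → K)) := by
  have h := VV_smul S F d (VV_frob S F d p hv e) t ht
  have hne : S.l ^ (t - (p ^ e : ℕ) * m).toNat ≠ 0 := pow_ne_zero _ S.l_ne
  rw [← Submodule.smul_mem_iff _ hne]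
  exact Submodule.subset_span h

theorem rk_le (q : ℕ) (m : ℤ) (e : ℕ) (t : ℤ) (ht : (p ^ e : ℕ) * m ≤ t) :
    rk S F d q m ≤ rk S F d (p ^ e * q) t := by
  obtain ⟨u, hli, hu⟩ := exists_u S F d q m
  have h1 := (pin S p u hli (fun i => ((mem_VV S F d).1 (hu i)).1)).1 e
  have h2 := finrank_span_eq_card h1
  rw [Fintype.card_fin] at h2
  rw [← h2]
  apply Submodule.finrank_mono
  rw [Submodule.span_le]
  rintro _ ⟨i, rfl⟩
  exact frob_in_span S F d p (hu i) e t ht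

theorem asym (q : ℕ) (m : ℤ) : ∃ (C : ℤ) (G : ℕ), ∀ (e : ℕ) (t : ℤ), (p ^ e : ℕ) * m ≤ t →
    rk S F d (p ^ e * q) t ≤ rk S F d q m →
    |(S.δ : ℤ) ^ 2 * (Module.finrank k (VV S F d (p ^ e * q) t) : ℤ) -
      (D * (rk S F d q m * t - (p ^ e : ℕ) * (rk S F d q m * m)) + S.δ * ((p ^ e : ℕ) * G))| ≤ C := by
  obtain ⟨u, hli, hu⟩ := exists_u S F d q m
  obtain ⟨h1, C, G, h2⟩ := pin S p u hli (fun i => ((mem_VV S F d).1 (hu i)).1)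
  refine ⟨C, G, fun e t ht hr => ?_⟩
  have h3 := finrank_span_eq_card (h1 e)
  rw [Fintype.card_fin] at h3
  have h4 : Submodule.span K (Set.range fun i j => u i j ^ p ^ e) =
      Submodule.span K (VV S F d (p ^ e * q) t : Set (ι → K)) := by
    apply Submodule.eq_of_le_of_finrank_le
    · rw [Submodule.span_le]
      rintro _ ⟨i, rfl⟩
      exact frob_in_span S F d p (hu i) e t ht
    · rw [h3]; exact hr
  have h5 : VV S F d (p ^ e * q) t = Rt S (fun j => ((p ^ e : ℕ) : ℤ) * ((q : ℤ) * d j)) t ⊓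
      (Submodule.span K (Set.range fun i j => u i j ^ p ^ e)).restrictScalars k := by
    have h6 : (fun j => ((p ^ e : ℕ) : ℤ) * ((q : ℤ) * d j)) = fun j => ((p ^ e * q : ℕ) : ℤ) * d j := by
      funext j; push_cast; ring
    rw [h4, h6]
    apply le_antisymm
    · intro v hv
      exact ⟨((mem_VV S F d).1 hv).1, Submodule.subset_span hv⟩
    · rintro v ⟨hv, hv2⟩
      refine ⟨hv, ?_⟩
      have : Submodule.span K (VV S F d (p ^ e * q) t : Set (ι → K)) ≤
          LinearMap.ker (Fintype.linearCombination K (fun i => F i ^ (p ^ e * q))) := by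
        rw [Submodule.span_le]
        intro v hv
        exact hv.2
      exact this hv2
  rw [h5]
  exact h2 e t ht

theorem rk_card (q : ℕ) (m : ℤ) : rk S F d q m ≤ Fintype.card ι := by
  unfold rk
  refine (Submodule.finrank_le _).trans ?_
  simp
end P6a

theorem finrank_map_inj {k E E' : Type*} [Field k] [AddCommGroup E] [Module k E] [AddCommGroup E']
    [Module k E'] {f : E →ₗ[k] E'} (hf : Function.Injective f) (V : Submodule k E) :
    Module.finrank k (V.map f) = Module.finrank k V :=
  (Submodule.equivMapOfInjective f hf V).finrank_eq.symm

section dimform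
variable {k R K0 K : Type*} [Field k] [CommRing R] [IsDomain R] [Algebra k R]
    (𝒜 : ℕ → Submodule k R) [GradedAlgebra 𝒜]
    [Field K0] [Field K] [Algebra R K] [IsFractionRing R K]
    [Algebra k K] [IsScalarTower k R K] [Algebra (Pol k) K0]
  [IsFractionRing (Pol k) K0] [Algebra K0 K] [FiniteDimensional K0 K] [Algebra (Pol k) K]
  [IsScalarTower (Pol k) K0 K] [IsScalarTower k (Pol k) K] (S : Setup k K0 K)
  (hS : ∀ t, S.g t = gZ 𝒜 K t)
  {ι : Type*} [Fintype ι] [DecidableEq ι] (f : ι → R) (d : ι → ℕ) (hf : ∀ i, f i ∈ 𝒜 (d i))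

include hS hf in
theorem image_eq (q m : ℕ) :
    (𝒜 m ⊓ (Ideal.span (Set.range fun i => f i ^ q)).restrictScalars k).map
        (IsScalarTower.toAlgHom k R K).toLinearMap =
      (Rt S (fun j => (q : ℤ) * d j) m).map
        ((Fintype.linearCombination K (fun i => (algebraMap R K (f i)) ^ q)).restrictScalars k) := by
  have hfq : ∀ i, f i ^ q ∈ 𝒜 (q * d i) := fun i => SetLike.pow_mem_graded q (hf i)
  apply le_antisymm
  · rintro _ ⟨r, ⟨hr, hrI⟩, rfl⟩
    have hrI' : r ∈ Ideal.span (Set.range fun i => f i ^ q) := hrI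
    rw [Ideal.mem_span_range_iff_exists_fun] at hrI'
    obtain ⟨c, hc⟩ := hrI'
    classical
    refine ⟨fun i => if q * d i ≤ m then
      algebraMap R K (DirectSum.decompose 𝒜 (c i) (m - q * d i) : R) else 0, ?_, ?_⟩
    · change _ ∈ Rt _ _ _
      rw [mem_Rt]
      intro i
      rw [hS]
      dsimp only
      split_ifs with h
      · have : ((m : ℤ) - q * d i) = ((m - q * d i : ℕ) : ℤ) := by
          rw [Nat.cast_sub h]; push_cast; ring
        rw [this, mem_gZ]
        exact ⟨_, SetLike.coe_mem _, rfl⟩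
      · exact zero_mem _
    · have h1 : (DirectSum.decompose 𝒜 r m : R) = r := DirectSum.decompose_of_mem_same _ hr
      rw [← hc] at h1
      have h2 : GradedRing.proj 𝒜 m (∑ i, c i * f i ^ q) = ∑ i, c i * f i ^ q := h1
      rw [map_sum] at h2
      simp only [GradedRing.proj_apply, DirectSum.coe_decompose_mul_of_right_mem 𝒜 m (hfq _)] at h2
      rw [← hc, ← h2]
      simp only [LinearMap.coe_restrictScalars, Fintype.linearCombination_apply, AlgHom.toLinearMap_apply,
        IsScalarTower.coe_toAlgHom', map_sum, smul_eq_mul]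
      refine Finset.sum_congr rfl fun i _ => ?_
      split_ifs <;> simp
  · rintro _ ⟨v, hv, rfl⟩
    replace hv : v ∈ Rt _ _ _ := hv
    rw [mem_Rt] at hv
    have h1 : ∀ i, ∃ r : R, algebraMap R K r = v i ∧ r * f i ^ q ∈ 𝒜 m := by
      intro i
      have := hv i
      rw [hS] at this
      rcases gZ_cases 𝒜 K this with h | ⟨n, hn, r, hr, h⟩
      · exact ⟨0, by rw [h, map_zero], by rw [zero_mul]; exact zero_mem _⟩
      · refine ⟨r, h, ?_⟩
        have h3 : m = n + q * d i := by
          zify; linarith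
        rw [h3]
        exact SetLike.GradedMul.mul_mem hr (hfq i)
    choose r hr hr2 using h1
    refine ⟨∑ i, r i * f i ^ q, ⟨Submodule.sum_mem _ fun i _ => hr2 i, ?_⟩, ?_⟩
    · exact Ideal.sum_mem _ fun i _ => Ideal.mul_mem_left _ _ (Ideal.subset_span ⟨i, rfl⟩)
    · simp [Fintype.linearCombination_apply, hr]

include hS hf in
theorem dim_formula (q m : ℕ) :
    (Module.finrank k ((𝒜 m) ⧸ (Submodule.comap (𝒜 m).subtype
      ((Ideal.span (Set.range fun i => f i ^ q)).restrictScalars k))) : ℤ) =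
    Module.finrank k (S.g m) - ∑ i, (Module.finrank k (S.g (m - q * d i)) : ℤ) +
      Module.finrank k (VV S (fun i => algebraMap R K (f i)) d q m) := by
  have hinj : Function.Injective (IsScalarTower.toAlgHom k R K).toLinearMap := IsFractionRing.injective R K
  have hg : S.g m = (𝒜 m).map (IsScalarTower.toAlgHom k R K).toLinearMap := by
    rw [hS]; unfold gZ; rw [if_pos (by positivity)]; simp
  have h1 : Module.finrank k (S.g m) = Module.finrank k (𝒜 m) := by
    rw [hg]; exact finrank_map_inj hinj _
  have hfd : FiniteDimensional k (𝒜 m) := by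
    have := S.fin m
    rw [hg] at this
    exact Module.Finite.equiv (Submodule.equivMapOfInjective _ hinj (𝒜 m)).symm
  have h2 := Submodule.finrank_quotient_add_finrank (Submodule.comap (𝒜 m).subtype
      ((Ideal.span (Set.range fun i => f i ^ q)).restrictScalars k))
  have h3 : Module.finrank k (Submodule.comap (𝒜 m).subtype
      ((Ideal.span (Set.range fun i => f i ^ q)).restrictScalars k)) =
      Module.finrank k ((𝒜 m ⊓ (Ideal.span (Set.range fun i => f i ^ q)).restrictScalars k).map
        (IsScalarTower.toAlgHom k R K).toLinearMap) := by
    rw [finrank_map_inj hinj, ← Submodule.map_comap_subtype,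
      finrank_map_inj (Submodule.injective_subtype _)]
  rw [image_eq 𝒜 S hS f d hf] at h3
  have := Rt_fin S (w := fun j => (q : ℤ) * d j) (t := m)
  have h4 := finrank_map_add_inf ((Fintype.linearCombination K
    (fun i => (algebraMap R K (f i)) ^ q)).restrictScalars k) (Rt S (fun j => (q : ℤ) * d j) m)
  rw [Rt_finrank S] at h4
  have h5 : Module.finrank k (VV S (fun i => algebraMap R K (f i)) d q m) = Module.finrank k
    (Rt S (fun j => (q : ℤ) * d j) m ⊓ LinearMap.ker ((Fintype.linearCombination K
    (fun i => (algebraMap R K (f i)) ^ q)).restrictScalars k) : Submodule k (ι → K)) := rfl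
  rw [← h5, ← h3] at h4
  rw [h1]
  have h6 : ∑ i, (Module.finrank k (S.g (m - q * d i)) : ℤ) =
    ((∑ i, Module.finrank k (S.g (m - q * d i)) : ℕ) : ℤ) := by push_cast; rfl
  rw [h6, ← h4]
  have h7 : (Module.finrank k (𝒜 m) : ℤ) = _ := congrArg Nat.cast h2.symm
  rw [h7]
  push_cast
  ring
end dimform
end HK

set_option linter.unusedSectionVars false
namespace HK
open Filter Topology

section endgame
variable (p : ℕ) (hp : p.Prime) (δ D : ℕ) (hδ : 0 < δ) (hD : 0 < D)
  {ι : Type*} [Fintype ι] (d : ι → ℕ) (a : ℕ → ℕ → ℕ) (h : ℤ → ℤ) (v : ℕ → ℤ → ℤ) (r : ℕ → ℤ → ℕ)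

theorem floor_tendsto (hp : p.Prime) (x : ℝ) (hx : 0 ≤ x) :
    Tendsto (fun n : ℕ => (⌊x * (p : ℝ) ^ n⌋₊ : ℝ) / (p : ℝ) ^ n) atTop (𝓝 x) := by
  have h1 : Tendsto (fun n : ℕ => (p : ℝ) ^ n) atTop atTop :=
    tendsto_pow_atTop_atTop_of_one_lt (by exact_mod_cast hp.one_lt)
  exact (tendsto_nat_floor_mul_div_atTop hx).comp h1

theorem const_tendsto (hp : p.Prime) (C : ℝ) :
    Tendsto (fun n : ℕ => C / (p : ℝ) ^ n) atTop (𝓝 0) := by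
  have h1 : Tendsto (fun n : ℕ => (p : ℝ) ^ n) atTop atTop :=
    tendsto_pow_atTop_atTop_of_one_lt (by exact_mod_cast hp.one_lt)
  exact h1.const_div_atTop C

theorem lips (C : ℤ) (hp : p.Prime)
    (H1 : ∀ n m : ℕ, (a n m : ℤ) = h m - ∑ i, h (m - (p ^ n : ℕ) * d i) + v n m)
    (H2 : ∀ t, |(δ : ℤ) ^ 2 * h t - D * max t 0| ≤ C)
    (H3 : ∀ s t, s ≤ t → h s ≤ h t)
    (H4 : ∀ n s t, s ≤ t → v n s ≤ v n t)
    (f : ℝ → ℝ)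
    (hf : ∀ x : ℝ, 0 ≤ x →
      Tendsto (fun n : ℕ => (a n ⌊x * (p : ℝ) ^ n⌋₊ : ℝ) / (p : ℝ) ^ n) atTop (𝓝 (f x)))
    (x y : ℝ) (hx : 0 ≤ x) (hxy : x ≤ y) :
    (δ : ℝ) ^ 2 * f x ≤ δ ^ 2 * f y + Fintype.card ι * D * (y - x) := by
  have key : ∀ n m m' : ℕ, m ≤ m' → (δ : ℤ) ^ 2 * a n m ≤ δ ^ 2 * a n m' +
      (Fintype.card ι * D * (m' - m) + 2 * Fintype.card ι * C) := by
    intro n m m' hm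
    have hm' : (m : ℤ) ≤ m' := by exact_mod_cast hm
    rw [H1, H1]
    have h3 := H3 _ _ hm'
    have h4 := H4 n _ _ hm'
    have h5 : (δ : ℤ) ^ 2 * ∑ i, h (m' - (p ^ n : ℕ) * d i) ≤ δ ^ 2 * ∑ i, h (m - (p ^ n : ℕ) * d i) +
       ∑ i : ι, (D * ((m' : ℤ) - m) + 2 * C) := by
      rw [Finset.mul_sum, Finset.mul_sum, ← Finset.sum_add_distrib]
      refine Finset.sum_le_sum fun i _ => ?_
      have e1 := abs_le.1 (H2 (m' - (p ^ n : ℕ) * d i))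
      have e2 := abs_le.1 (H2 (m - (p ^ n : ℕ) * d i))
      have e3 : max ((m' : ℤ) - (p ^ n : ℕ) * d i) 0 ≤ max ((m : ℤ) - (p ^ n : ℕ) * d i) 0 + (m' - m) := by
        omega
      have e4 := mul_le_mul_of_nonneg_left e3 (by positivity : (0 : ℤ) ≤ D)
      linarith [e1.1, e1.2, e2.1, e2.2]
    rw [Finset.sum_const, Finset.card_univ, nsmul_eq_mul] at h5
    have hd : (0 : ℤ) ≤ (δ : ℤ) ^ 2 := by positivity
    have e5 := mul_le_mul_of_nonneg_left h3 hd
    have e6 := mul_le_mul_of_nonneg_left h4 hd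
    linarith
  have hy : 0 ≤ y := hx.trans hxy
  have t1 := (hf x hx).const_mul ((δ : ℝ) ^ 2)
  have t2 := (((hf y hy).const_mul ((δ : ℝ) ^ 2)).add
    (((floor_tendsto p hp y hy).sub (floor_tendsto p hp x hx)).const_mul (Fintype.card ι * D : ℝ))).add
    (const_tendsto p hp (2 * Fintype.card ι * C))
  rw [add_zero] at t2
  refine le_of_tendsto_of_tendsto' t1 t2 fun n => ?_
  have hq : (0 : ℝ) < (p : ℝ) ^ n := pow_pos (by exact_mod_cast hp.pos) n
  have hm : ⌊x * (p : ℝ) ^ n⌋₊ ≤ ⌊y * (p : ℝ) ^ n⌋₊ := Nat.floor_mono (by gcongr)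
  have k1 := key n _ _ hm
  have k2 : (δ : ℝ) ^ 2 * a n ⌊x * (p : ℝ) ^ n⌋₊ ≤ δ ^ 2 * a n ⌊y * (p : ℝ) ^ n⌋₊ +
      (Fintype.card ι * D * (⌊y * (p : ℝ) ^ n⌋₊ - ⌊x * (p : ℝ) ^ n⌋₊) + 2 * Fintype.card ι * C) := by
    exact_mod_cast k1
  have k3 := div_le_div_of_nonneg_right k2 hq.le
  calc _ = _ := by ring
    _ ≤ _ := k3
    _ = _ := by ring

theorem formula (C C' : ℤ) (hp : p.Prime)
    (H1 : ∀ n m : ℕ, (a n m : ℤ) = h m - ∑ i, h (m - (p ^ n : ℕ) * d i) + v n m)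
    (H2 : ∀ t, |(δ : ℤ) ^ 2 * h t - D * max t 0| ≤ C)
    (f : ℝ → ℝ)
    (hf : ∀ x : ℝ, 0 ≤ x →
      Tendsto (fun n : ℕ => (a n ⌊x * (p : ℝ) ^ n⌋₊ : ℝ) / (p : ℝ) ^ n) atTop (𝓝 (f x)))
    (x : ℝ) (hx : 0 ≤ x) (n0 : ℕ) (ρ : ℕ) (m : ℤ) (G : ℕ)
    (H : ∀ e : ℕ, |(δ : ℤ) ^ 2 * v (n0 + e) ⌊x * (p : ℝ) ^ (n0 + e)⌋₊ -
      (D * (ρ * ⌊x * (p : ℝ) ^ (n0 + e)⌋₊ - (p ^ e : ℕ) * (ρ * m)) + δ * ((p ^ e : ℕ) * G))| ≤ C') :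
    (δ : ℝ) ^ 2 * f x = D * x - ∑ i, D * max (x - d i) 0 + D * ρ * x - (D * ρ * m - δ * G) / (p : ℝ) ^ n0 := by
  have hsh : Tendsto (fun e : ℕ => n0 + e) atTop atTop := tendsto_atTop_mono (fun e => Nat.le_add_left e n0) tendsto_id
  have t0 := (floor_tendsto p hp x hx).comp hsh
  have t1 := ((hf x hx).comp hsh).const_mul ((δ : ℝ) ^ 2)
  have t2 : Tendsto (fun e : ℕ => D * ((⌊x * (p : ℝ) ^ (n0 + e)⌋₊ : ℝ) / (p : ℝ) ^ (n0 + e)) -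
      ∑ i, D * max ((⌊x * (p : ℝ) ^ (n0 + e)⌋₊ : ℝ) / (p : ℝ) ^ (n0 + e) - d i) 0 +
      D * ρ * ((⌊x * (p : ℝ) ^ (n0 + e)⌋₊ : ℝ) / (p : ℝ) ^ (n0 + e)) - (D * ρ * m - δ * G) / (p : ℝ) ^ n0)
      atTop (𝓝 (D * x - ∑ i, D * max (x - d i) 0 + D * ρ * x - (D * ρ * m - δ * G) / (p : ℝ) ^ n0)) := by
    refine (((t0.const_mul (D : ℝ)).sub (tendsto_finsetSum _ fun i _ =>
      (((t0.sub_const (d i : ℝ)).max tendsto_const_nhds).const_mul (D : ℝ)))).add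
      (t0.const_mul (D * ρ : ℝ))).sub_const _
  have t3 := (const_tendsto p hp (C + Fintype.card ι * C + C')).comp hsh
  have hdiff := t1.sub t2
  refine sub_eq_zero.1 (tendsto_nhds_unique hdiff (squeeze_zero_norm (fun e => ?_) t3))
  have hq : (0 : ℝ) < (p : ℝ) ^ (n0 + e) := pow_pos (by exact_mod_cast hp.pos) _
  have hq0 : (0 : ℝ) < (p : ℝ) ^ n0 := pow_pos (by exact_mod_cast hp.pos) _
  have hqe : (0 : ℝ) < (p : ℝ) ^ e := pow_pos (by exact_mod_cast hp.pos) _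
  simp only [Function.comp]
  set t : ℕ := ⌊x * (p : ℝ) ^ (n0 + e)⌋₊ with ht
  have hb : |(δ : ℤ) ^ 2 * a (n0 + e) t - (D * t - ∑ i, (D : ℤ) * max (t - (p ^ (n0 + e) : ℕ) * d i : ℤ) 0
      + D * ρ * t - (p ^ e : ℕ) * (D * ρ * m - δ * G))| ≤ C + Fintype.card ι * C + C' := by
    have e1 := H2 t
    rw [max_eq_left (by positivity)] at e1
    have e2 : |∑ i, ((δ : ℤ) ^ 2 * h (t - (p ^ (n0 + e) : ℕ) * d i) -
        D * max (t - (p ^ (n0 + e) : ℕ) * d i : ℤ) 0)| ≤ Fintype.card ι * C := by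
      refine (Finset.abs_sum_le_sum_abs _ _).trans ?_
      refine (Finset.sum_le_sum fun i _ => H2 _).trans ?_
      rw [Finset.sum_const, Finset.card_univ, nsmul_eq_mul]
    rw [Finset.sum_sub_distrib, ← Finset.mul_sum] at e2
    have e3 := H e
    rw [H1]
    rw [abs_le] at *
    constructor <;> linarith [e1.1, e1.2, e2.1, e2.2, e3.1, e3.2]
  have hb' : |(δ : ℝ) ^ 2 * a (n0 + e) t - (D * t - ∑ i, (D : ℝ) * max (t - (p : ℝ) ^ (n0 + e) * d i) 0
      + D * ρ * t - (p : ℝ) ^ e * (D * ρ * m - δ * G))| ≤ C + Fintype.card ι * C + C' := by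
    exact_mod_cast hb
  have hs : ∀ i, max ((t : ℝ) / (p : ℝ) ^ (n0 + e) - d i) 0 =
      max (t - (p : ℝ) ^ (n0 + e) * d i) 0 / (p : ℝ) ^ (n0 + e) := by
    intro i
    rw [← max_div_div_right hq.le, zero_div]
    congr 1
    field_simp
  simp only [hs]
  rw [Real.norm_eq_abs, le_div_iff₀ hq]
  refine le_trans (le_of_eq ?_) hb'
  conv_lhs => rw [← abs_of_pos hq, ← abs_mul, abs_of_pos hq]
  congr 1
  have hsum : ∑ i, (D : ℝ) * (max (t - (p : ℝ) ^ (n0 + e) * d i) 0 / (p : ℝ) ^ (n0 + e)) =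
     (∑ i, (D : ℝ) * max (t - (p : ℝ) ^ (n0 + e) * d i) 0) / (p : ℝ) ^ (n0 + e) := by
    rw [Finset.sum_div]
    exact Finset.sum_congr rfl fun i _ => by ring
  rw [hsum, pow_add]
  field_simp

theorem endgame (C : ℤ) (hp : p.Prime) (hδ : 0 < δ) (hD : 0 < D)
    (H1 : ∀ n m : ℕ, (a n m : ℤ) = h m - ∑ i, h (m - (p ^ n : ℕ) * d i) + v n m)
    (H2 : ∀ t, |(δ : ℤ) ^ 2 * h t - D * max t 0| ≤ C)
    (H3 : ∀ s t, s ≤ t → h s ≤ h t)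
    (H4 : ∀ n s t, s ≤ t → v n s ≤ v n t)
    (H5' : ∀ n s, r n s ≤ Fintype.card ι)
    (H6 : ∀ n m, ∃ (C : ℤ) (G : ℕ), ∀ (e : ℕ) (t : ℤ), (p ^ e : ℕ) * m ≤ t → r (n + e) t ≤ r n m →
      |(δ : ℤ) ^ 2 * v (n + e) t - (D * (r n m * t - (p ^ e : ℕ) * (r n m * m)) + δ * ((p ^ e : ℕ) * G))| ≤ C)
    (f : ℝ → ℝ)
    (hf : ∀ x : ℝ, 0 ≤ x →
      Tendsto (fun n : ℕ => (a n ⌊x * (p : ℝ) ^ n⌋₊ : ℝ) / (p : ℝ) ^ n) atTop (𝓝 (f x))) :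
    ∃ α : ℚ, (α : ℝ) = sSup {x : ℝ | 0 ≤ x ∧ f x ≠ 0} := by
  set T := {x : ℝ | 0 ≤ x ∧ f x ≠ 0} with hT
  by_cases hne : T.Nonempty
  swap
  · rw [Set.not_nonempty_iff_eq_empty] at hne
    exact ⟨0, by rw [hne]; simp⟩
  by_cases hbd : BddAbove T
  swap
  · exact ⟨0, by rw [Real.sSup_of_not_bddAbove hbd]; simp⟩
  set α := sSup T with hα
  have hlub := isLUB_csSup hne hbd
  rw [← hα] at hlub
  have hLip := lips p δ D d a h v C hp H1 H2 H3 H4 f hf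
  have hfnn : ∀ x, 0 ≤ x → 0 ≤ f x := fun x hx => ge_of_tendsto' (hf x hx) fun n => by positivity
  have hα0 : 0 ≤ α := by
    obtain ⟨x, hx⟩ := hne
    exact hx.1.trans (hlub.1 hx)
  have hgt : ∀ y, α < y → f y = 0 := by
    intro y hy
    by_contra hc
    exact absurd (hlub.1 (show y ∈ T from ⟨hα0.trans hy.le, hc⟩)) (not_le.2 hy)
  have hδ' : (0 : ℝ) < δ := by exact_mod_cast hδ
  have hD' : (0 : ℝ) < D := by exact_mod_cast hD
  -- upper bound near α
  have hup : ∀ x, 0 ≤ x → x ≤ α → (δ : ℝ) ^ 2 * f x ≤ Fintype.card ι * D * (α - x) := by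
    intro x hx hxa
    refine le_of_forall_pos_le_add fun ε hε => ?_
    have hc : (0 : ℝ) ≤ Fintype.card ι * D := by positivity
    set y := α + ε / (Fintype.card ι * D + 1)
    have hy : α < y := by
      have : 0 < ε / ((Fintype.card ι : ℝ) * D + 1) := by positivity
      linarith
    have := hLip x y hx (hxa.trans hy.le)
    rw [hgt y hy, mul_zero, zero_add] at this
    refine this.trans ?_
    have h2 : (Fintype.card ι : ℝ) * D * (ε / (Fintype.card ι * D + 1)) ≤ ε := by
      rw [mul_div_assoc', div_le_iff₀ (by positivity)]
      nlinarith
    have h3 : y - x = (α - x) + ε / (Fintype.card ι * D + 1) := by ring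
    rw [h3, mul_add]
    linarith
  have hfα : f α = 0 := by
    have := hup α hα0 le_rfl
    rw [sub_self, mul_zero] at this
    have h2 := hfnn α hα0
    have h3 : (0 : ℝ) < δ ^ 2 := by positivity
    nlinarith
  have hαpos : 0 < α := by
    rcases hα0.lt_or_eq with h1 | h1
    · exact h1
    · exfalso
      obtain ⟨x, hx⟩ := hne
      have := hlub.1 hx
      have : x = α := le_antisymm this (by rw [← h1]; exact hx.1)
      exact hx.2 (by rw [this, hfα])
  -- maximal rank
  have hmax : ∃ (n0 : ℕ) (x0 : ℝ), 0 ≤ x0 ∧ x0 < α ∧ ∀ (n : ℕ) (x : ℝ), 0 ≤ x → x < α →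
      r n ⌊x * (p : ℝ) ^ n⌋₊ ≤ r n0 ⌊x0 * (p : ℝ) ^ n0⌋₊ := by
    let P : ℕ → Prop := fun ρ => ∃ (n0 : ℕ) (x0 : ℝ), 0 ≤ x0 ∧ x0 < α ∧ r n0 ⌊x0 * (p : ℝ) ^ n0⌋₊ = ρ
    classical
    have hP0 : P (r 0 ⌊(0 : ℝ) * (p : ℝ) ^ 0⌋₊) := ⟨0, 0, le_rfl, hαpos, rfl⟩
    obtain ⟨n0, x0, h1, h2, h3⟩ := Nat.findGreatest_spec (P := P) (H5' 0 _) hP0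
    refine ⟨n0, x0, h1, h2, fun n x hx hxa => ?_⟩
    rw [h3]
    exact Nat.le_findGreatest (H5' n _) ⟨n, x, hx, hxa, rfl⟩
  obtain ⟨n0, x0, hx0, hx0α, hmx⟩ := hmax
  set m : ℕ := ⌊x0 * (p : ℝ) ^ n0⌋₊ with hm
  set ρ := r n0 m with hρ
  obtain ⟨C', G, hCG⟩ := H6 n0 m
  obtain ⟨x1, hx01, hx1α, hx1d⟩ : ∃ x1, x0 ≤ x1 ∧ x1 < α ∧ ∀ i, (d i : ℝ) < α → (d i : ℝ) ≤ x1 := by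
    classical
    let s : Finset ℝ := insert x0 ((Finset.univ.filter fun i : ι => (d i : ℝ) < α).image fun i => (d i : ℝ))
    have hs : s.Nonempty := ⟨x0, Finset.mem_insert_self _ _⟩
    refine ⟨s.max' hs, Finset.le_max' _ _ (Finset.mem_insert_self _ _), ?_, fun i hi => ?_⟩
    · rw [Finset.max'_lt_iff]
      intro y hy
      rcases Finset.mem_insert.1 hy with rfl | hy
      · exact hx0α
      · obtain ⟨i, hi, rfl⟩ := Finset.mem_image.1 hy
        exact (Finset.mem_filter.1 hi).2
    · exact Finset.le_max' s _ (Finset.mem_insert_of_mem (Finset.mem_image.2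
        ⟨i, Finset.mem_filter.2 ⟨Finset.mem_univ _, hi⟩, rfl⟩))
  have hform : ∀ x, x1 ≤ x → x < α → (δ : ℝ) ^ 2 * f x = D * x - ∑ i, D * max (x - d i) 0 + D * ρ * x -
      (D * ρ * m - δ * G) / (p : ℝ) ^ n0 := by
    intro x hx hxα
    have hx' : 0 ≤ x := hx0.trans (hx01.trans hx)
    have := formula p δ D d a h v C C' hp H1 H2 f hf x hx' n0 ρ m G (fun e => by
      refine hCG e _ ?_ (hmx _ x hx' hxα)
      have : p ^ e * m ≤ ⌊x * (p : ℝ) ^ (n0 + e)⌋₊ := by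
        apply Nat.le_floor
        have h1 : (m : ℝ) ≤ x0 * (p : ℝ) ^ n0 := Nat.floor_le (by positivity)
        push_cast
        calc (p : ℝ) ^ e * m ≤ (p : ℝ) ^ e * (x0 * (p : ℝ) ^ n0) := by gcongr
          _ ≤ (p : ℝ) ^ e * (x * (p : ℝ) ^ n0) := by gcongr; exact hx01.trans hx
          _ = _ := by ring
      exact_mod_cast this)
    rw [this]
    push_cast
    rfl
  classical
  let A : ℚ := D - ∑ i ∈ Finset.univ.filter (fun i : ι => (d i : ℝ) < α), (D : ℚ) + D * ρ
  let B : ℚ := ∑ i ∈ Finset.univ.filter (fun i : ι => (d i : ℝ) < α), (D : ℚ) * d i - (D * ρ * m - δ * G) / (p : ℚ) ^ n0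
  have hlin : ∀ x, x1 ≤ x → x < α → (δ : ℝ) ^ 2 * f x = A * x + B := by
    intro x hx hxα
    rw [hform x hx hxα]
    have hs : ∑ i, (D : ℝ) * max (x - d i) 0 =
        ∑ i ∈ Finset.univ.filter (fun i : ι => (d i : ℝ) < α), (D : ℝ) * (x - d i) := by
      rw [Finset.sum_filter]
      refine Finset.sum_congr rfl fun i _ => ?_
      split_ifs with hi
      · rw [max_eq_left]; linarith [hx1d i hi]
      · rw [max_eq_right, mul_zero]; linarith
    rw [hs]
    simp only [A, B, mul_sub, Finset.sum_sub_distrib, ← Finset.sum_mul]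
    push_cast
    ring
  have hx1nn : 0 ≤ x1 := hx0.trans hx01
  -- value at α
  have hzero : (A : ℝ) * α + B = 0 := by
    have c1 : Tendsto (fun x : ℝ => (A : ℝ) * x + B) (𝓝[<] α) (𝓝 (A * α + B)) := by
      have : Continuous (fun x : ℝ => (A : ℝ) * x + B) := by fun_prop
      exact this.continuousAt.tendsto.mono_left nhdsWithin_le_nhds
    have c2 : Tendsto (fun x : ℝ => (Fintype.card ι : ℝ) * D * (α - x)) (𝓝[<] α) (𝓝 0) := by
      have : Continuous (fun x : ℝ => (Fintype.card ι : ℝ) * D * (α - x)) := by fun_prop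
      have h2 := this.continuousAt.tendsto.mono_left (nhdsWithin_le_nhds (a := α) (s := Set.Iio α))
      simpa using h2
    have hev : ∀ᶠ x in 𝓝[<] α, x1 ≤ x ∧ x < α := by
      filter_upwards [Ico_mem_nhdsLT hx1α] with x hx using hx
    apply le_antisymm
    · refine le_of_tendsto_of_tendsto c1 c2 ?_
      filter_upwards [hev] with x hx
      rw [← hlin x hx.1 hx.2]
      exact hup x (hx1nn.trans hx.1) hx.2.le
    · refine ge_of_tendsto c1 ?_
      filter_upwards [hev] with x hx
      rw [← hlin x hx.1 hx.2]
      have := hfnn x (hx1nn.trans hx.1)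
      positivity
  have hA : (A : ℝ) ≠ 0 := by
    intro hA
    have hB : (B : ℝ) = 0 := by rw [hA] at hzero; linarith
    obtain ⟨x, hxT, hx1⟩ := (lt_isLUB_iff hlub).1 hx1α
    have hxα : x < α := lt_of_le_of_ne (hlub.1 hxT) (fun h => hxT.2 (by rw [h, hfα]))
    have := hlin x hx1.le hxα
    rw [hA, hB] at this
    have h3 : (δ : ℝ) ^ 2 ≠ 0 := by positivity
    exact hxT.2 (by simpa [hδ.ne'] using this)
  refine ⟨-B / A, ?_⟩
  push_cast
  rw [div_eq_iff hA]
  linarith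
end endgame
end HK


theorem HK.exists_gens {k R : Type*} [Field k] [CommRing R] [IsDomain R] [Algebra k R]
    (𝒜 : ℕ → Submodule k R) [GradedAlgebra 𝒜]
    (h0 : 𝒜 0 = Submodule.span k {1}) (hstd : ∀ n, 𝒜 (n + 1) = 𝒜 1 * 𝒜 n)
    (hfg : FiniteDimensional k (𝒜 1)) (I : Ideal R) (hI : Ideal.IsHomogeneous 𝒜 I) :
    ∃ (ι : Type) (_ : Fintype ι) (g : ι → R) (d : ι → ℕ), (∀ i, g i ∈ 𝒜 (d i)) ∧
      I = Ideal.span (Set.range g) := by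
  have hft : Algebra.FiniteType k R := HK.finType 𝒜 h0 hstd hfg
  haveI : IsNoetherianRing R := Algebra.FiniteType.isNoetherianRing k R
  let T : Set R := {r | r ∈ I ∧ ∃ n, r ∈ 𝒜 n}
  have hT : I = Ideal.span T := by
    classical
    apply le_antisymm
    · intro r hr
      rw [← DirectSum.sum_support_decompose 𝒜 r]
      exact Ideal.sum_mem _ fun i _ => Ideal.subset_span ⟨hI i hr, i, SetLike.coe_mem _⟩
    · rw [Ideal.span_le]
      exact fun r hr => hr.1
  have hfgI : (Submodule.span R T).FG := IsNoetherian.noetherian _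
  obtain ⟨s, hs, hspan⟩ := Submodule.fg_span_iff_fg_span_finset_subset T |>.1 hfgI
  have hd : ∀ i : Fin s.card, ∃ n, (s.equivFin.symm i : R) ∈ 𝒜 n := fun i => (hs (s.equivFin.symm i).2).2
  choose d hd using hd
  refine ⟨Fin s.card, inferInstance, fun i => (s.equivFin.symm i : R), d, hd, ?_⟩
  rw [hT]
  have : Set.range (fun i => (s.equivFin.symm i : R)) = (s : Set R) := by
    ext x
    constructor
    · rintro ⟨i, rfl⟩
      exact (s.equivFin.symm i).2
    · intro hx
      exact ⟨s.equivFin ⟨x, hx⟩, by simp⟩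
  rw [this]
  exact hspan

/-- **Theorem (Statement 3).** Let `(R, I)` be a standard graded pair over a perfect field
`k` of characteristic `p > 0`, with `R` a two-dimensional domain, and let `f : ℝ → ℝ` be
the Hilbert–Kunz density function of `(R, I)`.  Then
`α(R, I) = sup {x ≥ 0 | f x ≠ 0}` is a rational number. -/
theorem alpha_rational
    (p : ℕ) (hp : p.Prime)
    (k : Type*) [Field k] [CharP k p] [ExpChar k p] [PerfectRing k p]
    (R : Type*) [CommRing R] [IsDomain R] [Algebra k R]
    (𝒜 : ℕ → Submodule k R) [GradedAlgebra 𝒜]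
    (h0 : 𝒜 0 = Submodule.span k {1})
    (hstd : ∀ n, 𝒜 (n + 1) = 𝒜 1 * 𝒜 n)
    (hfg : FiniteDimensional k (𝒜 1))
    (hdim : ringKrullDim R = 2)
    (I : Ideal R) (hIhom : Ideal.IsHomogeneous 𝒜 I)
    (hcolen : FiniteDimensional k (R ⧸ I))
    -- `f` is the Hilbert–Kunz density function of `(R, I)`:
    (f : ℝ → ℝ)
    (hf : ∀ x : ℝ, 0 ≤ x →
      Tendsto (fun n : ℕ =>
          (gradedPieceDim 𝒜 (I.frobPow (p ^ n)) ⌊x * (p : ℝ) ^ n⌋₊ : ℝ) / (p : ℝ) ^ n)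
        atTop (𝓝 (f x))) :
    ∃ α : ℚ, (α : ℝ) = sSup {x : ℝ | 0 ≤ x ∧ f x ≠ 0} := by
  
  haveI : Fact p.Prime := ⟨hp⟩
  haveI : CharP R p := charP_of_injective_algebraMap (algebraMap k R).injective p
  haveI : CharP (FractionRing R) p :=
    charP_of_injective_algebraMap (IsFractionRing.injective R (FractionRing R)) p
  haveI : ExpChar R p := ExpChar.prime hp
  classical
  obtain ⟨ι, _, g, d, hg, hI⟩ := HK.exists_gens 𝒜 h0 hstd hfg I hIhom
  obtain ⟨i1, i2, i3, i4, i5, S, hS⟩ := HK.exists_setup 𝒜 h0 hstd hfg hdim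
  obtain ⟨C, hC⟩ := S.h_bound
  have hfrob : ∀ n, I.frobPow (p ^ n) = Ideal.span (Set.range fun i => g i ^ (p ^ n)) := by
    intro n
    have h1 : I.frobPow (p ^ n) = I.map (iterateFrobenius R p n) := rfl
    rw [h1, hI, Ideal.map_span, ← Set.range_comp]
    rfl
  refine HK.endgame p S.δ (Module.finrank (FractionRing (Pol k)) (FractionRing R)) d
    (fun n m => gradedPieceDim 𝒜 (I.frobPow (p ^ n)) m)
    (fun t => (Module.finrank k (S.g t) : ℤ))
    (fun n m => (Module.finrank k (HK.VV S (fun i => algebraMap R (FractionRing R) (g i)) d (p ^ n) m) : ℤ))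
    (fun n m => HK.rk S (fun i => algebraMap R (FractionRing R) (g i)) d (p ^ n) m)
    C hp S.δ_pos Module.finrank_pos ?_ hC ?_ ?_ ?_ ?_ f hf
  · intro n m
    have := HK.dim_formula 𝒜 S hS g d hg (p ^ n) m
    rw [← hfrob n] at this
    exact this
  · intro s t hst
    have := S.h_mono t (t - s).toNat
    rw [Int.toNat_of_nonneg (by omega)] at this
    rw [sub_sub_cancel] at this
    exact_mod_cast this
  · intro n s t hst
    have := HK.VV_mono S (fun i => algebraMap R (FractionRing R) (g i)) d (q := p ^ n) hst
    exact_mod_cast this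
  · intro n s
    exact HK.rk_card _ _ _ _ _
  · intro n m
    obtain ⟨C, G, h⟩ := HK.asym S (fun i => algebraMap R (FractionRing R) (g i)) d p (p ^ n) m
    refine ⟨C, G, fun e t => ?_⟩
    have h2 := h e t
    have h3 : p ^ e * p ^ n = p ^ (n + e) := by rw [pow_add, mul_comm]
    rw [h3] at h2
    exact h2
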